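/- Affine RSK correspondence: for all positive integers m and n, the map κ, A ↦ (P₀, Q), is a bijection from M̂_{m×n} onto the disjoint union, over partitions λ ∈ 𝒫_m ∩ 𝒫_n, of the sets CSST_[m](λ) × B_n(λ). In particular, for every A ∈ M̂_{m×n} the tableau P₀ produced by the matrix-ball construction is column semistandard with entries in {1,…,m}, the common shape λ of P₀ and Q₀ lies in 𝒫_m ∩ 𝒫_n, and Q ∈ B_n(λ). -/

import Mathlib

open scoped Classical

namespace AffineRSK

/-- `ℤ × ℤ`-matrices with non-negative integer entries. -/
abbrev Mat : Type := ℤ → ℤ → ℕ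

abbrev Cell : Type := ℤ × ℤ

/-- Generalized affine permutations of period `(m, n)`:
`a_{i+m, j+n} = a_{ij}` and each column has finite support. -/
def IsGAP (m n : ℕ) (A : Mat) : Prop :=
  (∀ i j : ℤ, A (i + m) (j + n) = A i j) ∧ ∀ j : ℤ, {i : ℤ | A i j ≠ 0}.Finite

/-- Generalized dual affine permutations: entries in `{0, 1}`. -/
def IsGDAP (m n : ℕ) (A : Mat) : Prop :=
  IsGAP m n A ∧ ∀ i j : ℤ, A i j ≤ 1

def supp (A : Mat) : Set Cell := {c : Cell | A c.1 c.2 ≠ 0}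

def tauC (m n : ℕ) (c : Cell) : Cell := (c.1 + (m : ℤ), c.2 + (n : ℤ))

/-- `NW c₁ c₂` means `c₁ >_NW c₂`. -/
def NW (c₁ c₂ : Cell) : Prop := c₁.1 < c₂.1 ∧ c₁.2 < c₂.2

/-- `nwGe c₁ c₂` means `c₁ ≥_nw c₂`. -/
def nwGe (c₁ c₂ : Cell) : Prop := c₁.1 ≤ c₂.1 ∧ c₁.2 ≤ c₂.2

/-- `neLe c₁ c₂` means `c₁ ≤_ne c₂`. -/
def neLe (c₁ c₂ : Cell) : Prop := c₂.1 ≤ c₁.1 ∧ c₁.2 ≤ c₂.2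

/-- `nWgt c₁ c₂` means `c₁ >_nW c₂` (dual order). -/
def nWgt (c₁ c₂ : Cell) : Prop := c₁.1 ≤ c₂.1 ∧ c₁.2 < c₂.2

/-- `NeLt c₁ c₂` means `c₁ <_Ne c₂` (dual order). -/
def NeLt (c₁ c₂ : Cell) : Prop := c₂.1 < c₁.1 ∧ c₁.2 ≤ c₂.2

/-- A proper numbering on `A`. -/
def IsProper (A : Mat) (d : Cell → ℤ) : Prop :=
  (∀ c₁ ∈ supp A, ∀ c₂ ∈ supp A, NW c₂ c₁ → d c₂ < d c₁) ∧
    ∀ c₁ ∈ supp A, ∃ c₂ ∈ supp A, NW c₂ c₁ ∧ d c₂ = d c₁ - 1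

/-- A dual proper numbering on `A`. -/
def IsProper' (A : Mat) (d : Cell → ℤ) : Prop :=
  (∀ c₁ ∈ supp A, ∀ c₂ ∈ supp A, nWgt c₂ c₁ → d c₂ < d c₁) ∧
    ∀ c₁ ∈ supp A, ∃ c₂ ∈ supp A, nWgt c₂ c₁ ∧ d c₂ = d c₁ - 1

/-- An enumeration of a stream of flow `l`. -/
def IsStreamEnum (m n : ℕ) (e : ℤ → Cell) (l : ℕ) : Prop :=
  0 < l ∧ (∀ i : ℤ, NW (e i) (e (i + 1))) ∧ ∀ i : ℤ, tauC m n (e i) = e (i + l)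

def IsStreamEnum' (m n : ℕ) (e : ℤ → Cell) (l : ℕ) : Prop :=
  0 < l ∧ (∀ i : ℤ, nWgt (e i) (e (i + 1))) ∧ ∀ i : ℤ, tauC m n (e i) = e (i + l)

def IsStream (m n : ℕ) (S : Set Cell) (l : ℕ) : Prop :=
  ∃ e : ℤ → Cell, IsStreamEnum m n e l ∧ Set.range e = S

def IsStream' (m n : ℕ) (S : Set Cell) (l : ℕ) : Prop :=
  ∃ e : ℤ → Cell, IsStreamEnum' m n e l ∧ Set.range e = S

/-- A channel of `A`: a stream contained in `supp A` of maximal flow. -/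
def IsChannel (m n : ℕ) (A : Mat) (C : Set Cell) : Prop :=
  ∃ l : ℕ, IsStream m n C l ∧ C ⊆ supp A ∧
    ∀ (S : Set Cell) (l' : ℕ), IsStream m n S l' → S ⊆ supp A → l' ≤ l

def IsChannel' (m n : ℕ) (A : Mat) (C : Set Cell) : Prop :=
  ∃ l : ℕ, IsStream' m n C l ∧ C ⊆ supp A ∧
    ∀ (S : Set Cell) (l' : ℕ), IsStream' m n S l' → S ⊆ supp A → l' ≤ l

def Csw (A : Mat) (C : Set Cell) : Set Cell :=
  {c ∈ supp A | ∃ c' ∈ C, neLe c c'}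

def Csw' (A : Mat) (C : Set Cell) : Set Cell :=
  {c ∈ supp A | c ∈ C ∨ ∃ c' ∈ C, NeLt c c'}

/-- `swGe A C₁ C₂` means `C₁ ≽_sw C₂`. -/
def swGe (A : Mat) (C₁ C₂ : Set Cell) : Prop := C₁ ⊆ Csw A C₂

def swGe' (A : Mat) (C₁ C₂ : Set Cell) : Prop := C₁ ⊆ Csw' A C₂

/-- The set of values `d₀(c'_k) + k` over `>_NW`-chains from `c` to the channel
enumerated by `e` (where `d₀ (e idx) = idx`). -/
def chainSet (A : Mat) (e : ℤ → Cell) (c : Cell) : Set ℤ :=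
  {v : ℤ | ∃ (k : ℕ) (ch : ℕ → Cell),
      ch 0 = c ∧ (∀ i ≤ k, ch i ∈ supp A) ∧ (∀ i < k, NW (ch (i + 1)) (ch i)) ∧
        ∃ idx : ℤ, e idx = ch k ∧ v = idx + (k : ℤ)}

def chainSet' (A : Mat) (e : ℤ → Cell) (c : Cell) : Set ℤ :=
  {v : ℤ | ∃ (k : ℕ) (ch : ℕ → Cell),
      ch 0 = c ∧ (∀ i ≤ k, ch i ∈ supp A) ∧ (∀ i < k, nWgt (ch (i + 1)) (ch i)) ∧
        ∃ idx : ℤ, e idx = ch k ∧ v = idx + (k : ℤ)}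

/-- `d` is the channel numbering `d^C_A` for the channel enumerated by `e`. -/
def IsChannelNumbering (A : Mat) (e : ℤ → Cell) (d : Cell → ℤ) : Prop :=
  ∀ c ∈ supp A, IsGreatest (chainSet A e c) (d c)

def IsChannelNumbering' (A : Mat) (e : ℤ → Cell) (d : Cell → ℤ) : Prop :=
  ∀ c ∈ supp A, IsGreatest (chainSet' A e c) (d c)

/-- `e` enumerates the southwest channel of `A`. -/
def IsSWChannelEnum (m n : ℕ) (A : Mat) (e : ℤ → Cell) : Prop :=
  (∃ l : ℕ, IsStreamEnum m n e l) ∧ IsChannel m n A (Set.range e) ∧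
    ∀ C : Set Cell, IsChannel m n A C → swGe A (Set.range e) C

def IsSWChannelEnum' (m n : ℕ) (A : Mat) (e : ℤ → Cell) : Prop :=
  (∃ l : ℕ, IsStreamEnum' m n e l) ∧ IsChannel' m n A (Set.range e) ∧
    ∀ C : Set Cell, IsChannel' m n A C → swGe' A (Set.range e) C

/-- `d` is a southwest channel numbering of `A`. -/
def IsSWNumbering (m n : ℕ) (A : Mat) (d : Cell → ℤ) : Prop :=
  ∃ e : ℤ → Cell, IsSWChannelEnum m n A e ∧ IsChannelNumbering A e d

def IsSWNumbering' (m n : ℕ) (A : Mat) (d : Cell → ℤ) : Prop :=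
  ∃ e : ℤ → Cell, IsSWChannelEnum' m n A e ∧ IsChannelNumbering' A e d

/-- A zig-zag: bi-infinite east/north lattice path, eventually east on the
right and coming from the south on the left. -/
def IsZigZag (z : ℤ → Cell) : Prop :=
  (∀ i : ℤ, z (i + 1) = ((z i).1, (z i).2 + 1) ∨ z (i + 1) = ((z i).1 - 1, (z i).2)) ∧
  (∃ N : ℤ, ∀ i : ℤ, N ≤ i → z (i + 1) = ((z i).1, (z i).2 + 1)) ∧
    ∃ N : ℤ, ∀ i : ℤ, i ≤ N → z (i + 1) = ((z i).1 - 1, (z i).2)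

def innerCorners (z : ℤ → Cell) : Set Cell :=
  {c : Cell | ∃ i : ℤ, z i = c ∧ z i = ((z (i - 1)).1 - 1, (z (i - 1)).2) ∧
      z (i + 1) = ((z i).1, (z i).2 + 1)}

def outerCorners (z : ℤ → Cell) : Set Cell :=
  {c : Cell | ∃ i : ℤ, z i = c ∧ z i = ((z (i - 1)).1, (z (i - 1)).2 + 1) ∧
      z (i + 1) = ((z i).1 - 1, (z i).2)}

def levelSet (A : Mat) (d : Cell → ℤ) (k : ℤ) : Set Cell := {c ∈ supp A | d c = k}

/-- `≥_nw`-maximal cells of `S`. -/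
def nwMaximal (S : Set Cell) : Set Cell := {c ∈ S | ∀ c' ∈ S, nwGe c' c → c' = c}

/-- `>_nW`-maximal cells of `S` (dual). -/
def nWMaximal (S : Set Cell) : Set Cell := {c ∈ S | ∀ c' ∈ S, ¬ nWgt c' c}

/-- `z` is the zig-zag at level `k` associated to the numbering `d`. -/
def ZigZagAt (A : Mat) (d : Cell → ℤ) (k : ℤ) (z : ℤ → Cell) : Prop :=
  IsZigZag z ∧ innerCorners z = nwMaximal (levelSet A d k)

def ZigZagAt' (A : Mat) (d : Cell → ℤ) (k : ℤ) (z : ℤ → Cell) : Prop :=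
  IsZigZag z ∧ innerCorners z = nWMaximal (levelSet A d k)

def IsInnerOf (A : Mat) (d : Cell → ℤ) (c : Cell) : Prop :=
  ∃ (k : ℤ) (z : ℤ → Cell), ZigZagAt A d k z ∧ c ∈ innerCorners z

def IsOuterOf (A : Mat) (d : Cell → ℤ) (c : Cell) : Prop :=
  ∃ (k : ℤ) (z : ℤ → Cell), ZigZagAt A d k z ∧ c ∈ outerCorners z

def IsInnerOf' (A : Mat) (d : Cell → ℤ) (c : Cell) : Prop :=
  ∃ (k : ℤ) (z : ℤ → Cell), ZigZagAt' A d k z ∧ c ∈ innerCorners z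

def IsOuterOf' (A : Mat) (d : Cell → ℤ) (c : Cell) : Prop :=
  ∃ (k : ℤ) (z : ℤ → Cell), ZigZagAt' A d k z ∧ c ∈ outerCorners z

/-- `B` is obtained from `A` by subtracting `1` at inner corners and adding `1`
at outer corners. -/
def FlatEntries (A B : Mat) (Inn Out : Cell → Prop) : Prop :=
  ∀ c : Cell,
    (Inn c → B c.1 c.2 + 1 = A c.1 c.2) ∧
    (Out c → B c.1 c.2 = A c.1 c.2 + 1) ∧
    (¬ Inn c → ¬ Out c → B c.1 c.2 = A c.1 c.2)

/-- `B = A^♭`. -/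
def FlatRel (m n : ℕ) (A B : Mat) : Prop :=
  ∃ d : Cell → ℤ, IsSWNumbering m n A d ∧
    FlatEntries A B (IsInnerOf A d) (IsOuterOf A d)

/-- `B = A^{♭'}` (dual). -/
def FlatRel' (m n : ℕ) (A B : Mat) : Prop :=
  ∃ d : Cell → ℤ, IsSWNumbering' m n A d ∧
    FlatEntries A B (IsInnerOf' A d) (IsOuterOf' A d)

/-- `c` is the back-post corner of the zig-zag `z`:
`(row of rightmost inner corner, column of leftmost inner corner)`. -/
def IsBackPost (z : ℤ → Cell) (c : Cell) : Prop :=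
  ∃ cr ∈ innerCorners z, ∃ cl ∈ innerCorners z,
    (∀ c' ∈ innerCorners z, c'.2 ≤ cr.2) ∧ (∀ c' ∈ innerCorners z, cl.2 ≤ c'.2) ∧
      c = (cr.1, cl.2)

def backPostSet (A : Mat) (d : Cell → ℤ) : Set Cell :=
  {c : Cell | ∃ (k : ℤ) (z : ℤ → Cell), ZigZagAt A d k z ∧ IsBackPost z c}

def backPostSet' (A : Mat) (d : Cell → ℤ) : Set Cell :=
  {c : Cell | ∃ (k : ℤ) (z : ℤ → Cell), ZigZagAt' A d k z ∧ IsBackPost z c}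

/-- Defining data `(a, b, r)` of the stream enumerated by `e` of flow `l`. -/
def StreamData (m n : ℕ) (e : ℤ → Cell) (l : ℕ) (a b : ℕ → ℤ) (r : ℤ) : Prop :=
  ∃ r₁ r₂ : ℤ,
    (∀ p : ℕ, p < l → a p = (e (r₁ + 1 + p)).1 ∧ 1 ≤ a p ∧ a p ≤ (m : ℤ)) ∧
    (∀ p : ℕ, p < l → b p = (e (r₂ + 1 + p)).2 ∧ 1 ≤ b p ∧ b p ≤ (n : ℤ)) ∧
      r = r₁ - r₂

/-- The matrix-ball iteration `A = A^(0), A^(t) = (A^(t-1))^♭`, with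
`A^(t) ≠ O` for `t < s` and `A^(s) = O`. -/
def MBCseq (m n : ℕ) (A : Mat) (s : ℕ) (Aseq : ℕ → Mat) : Prop :=
  Aseq 0 = A ∧ (∀ t < s, Aseq t ≠ 0) ∧ Aseq s = 0 ∧
    ∀ t < s, FlatRel m n (Aseq t) (Aseq (t + 1))

def MBCseq' (m n : ℕ) (A : Mat) (s : ℕ) (Aseq : ℕ → Mat) : Prop :=
  Aseq 0 = A ∧ (∀ t < s, Aseq t ≠ 0) ∧ Aseq s = 0 ∧
    ∀ t < s, FlatRel' m n (Aseq t) (Aseq (t + 1))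

/-- `κ₀(A) = (P, Q, ρ)`, with shape given by the column lengths `μ`:
the `t`-th columns (from the left, `0`-based) of `P` and `Q` are the defining
data of the stream of back-post corners of the zig-zags of `d^{sw}_{A^(t)}`. -/
def Kappa0Rel (m n : ℕ) (A : Mat) (s : ℕ) (μ : ℕ → ℕ) (P Q : ℕ → ℕ → ℤ)
    (ρ : ℕ → ℤ) : Prop :=
  ∃ Aseq : ℕ → Mat, MBCseq m n A s Aseq ∧
    ∀ t < s, ∃ (d : Cell → ℤ) (e : ℤ → Cell),
      IsSWNumbering m n (Aseq t) d ∧ IsStreamEnum m n e (μ t) ∧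
        Set.range e = backPostSet (Aseq t) d ∧
        StreamData m n e (μ t) (fun x => P x t) (fun x => Q x t) (ρ t)

def Kappa0Rel' (m n : ℕ) (A : Mat) (s : ℕ) (μ : ℕ → ℕ) (P Q : ℕ → ℕ → ℤ)
    (ρ : ℕ → ℤ) : Prop :=
  ∃ Aseq : ℕ → Mat, MBCseq' m n A s Aseq ∧
    ∀ t < s, ∃ (d : Cell → ℤ) (e : ℤ → Cell),
      IsSWNumbering' m n (Aseq t) d ∧ IsStreamEnum' m n e (μ t) ∧
        Set.range e = backPostSet' (Aseq t) d ∧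
        StreamData m n e (μ t) (fun x => P x t) (fun x => Q x t) (ρ t)

/-! ### Columns and the shift `τ` -/

/-- Extension of a column `c` of length `b` to `ℤ`: `c̃(x + bq) = c(x) + nq`. -/
def colExt (n b : ℕ) (c : ℕ → ℤ) (z : ℤ) : ℤ :=
  c (Int.toNat (Int.emod z (b : ℤ))) + (n : ℤ) * Int.ediv z (b : ℤ)

/-- `τ_n^k` applied to a column of length `b`. -/
def tauPow (n b : ℕ) (k : ℤ) (c : ℕ → ℤ) : ℕ → ℤ :=
  fun x => colExt n b c ((x : ℤ) + k)

/-- The two-column tableau `(column t of T, τ_N^r(column (t+1) of T))`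
(both of height `μ t`) is `ℤ`-semistandard. -/
def pairCond (N : ℕ) (μ : ℕ → ℕ) (T : ℕ → ℕ → ℤ) (t : ℕ) (r : ℕ) : Prop :=
  (∀ x : ℕ, x + 1 < μ t → T x t < T (x + 1) t) ∧
  (∀ x : ℕ, x + 1 < μ t →
    tauPow N (μ t) (r : ℤ) (fun y => T y (t + 1)) x <
      tauPow N (μ t) (r : ℤ) (fun y => T y (t + 1)) (x + 1)) ∧
    ∀ x < μ t, T x t ≤ tauPow N (μ t) (r : ℤ) (fun y => T y (t + 1)) x

/-- The offset `r` for the adjacent pair of columns `(t, t+1)`. -/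
noncomputable def rOff (N : ℕ) (μ : ℕ → ℕ) (T : ℕ → ℕ → ℤ) (t : ℕ) : ℕ :=
  sInf {r : ℕ | pairCond N μ T t r}

/-- Dual version: placing row `t` above row `τ_N^r(row (t+1))` (rows of the
transposed tableau, i.e. columns of `T`) is `ℤ`-semistandard. -/
def dualPairCond (N : ℕ) (μ : ℕ → ℕ) (T : ℕ → ℕ → ℤ) (t : ℕ) (r : ℕ) : Prop :=
  (∀ x : ℕ, x + 1 < μ t → T x t ≤ T (x + 1) t) ∧
  (∀ x : ℕ, x + 1 < μ t →
    tauPow N (μ t) (r : ℤ) (fun y => T y (t + 1)) x ≤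
      tauPow N (μ t) (r : ℤ) (fun y => T y (t + 1)) (x + 1)) ∧
    ∀ x < μ t, T x t < tauPow N (μ t) (r : ℤ) (fun y => T y (t + 1)) x

noncomputable def rOffDual (N : ℕ) (μ : ℕ → ℕ) (T : ℕ → ℕ → ℤ) (t : ℕ) : ℕ :=
  sInf {r : ℕ | dualPairCond N μ T t r}

/-- First column of the rectangle block containing column `t`. -/
noncomputable def blockStart (μ : ℕ → ℕ) (t : ℕ) : ℕ := sInf {t' : ℕ | μ t' = μ t}

/-- The symmetrized offset entry attached to column `t`
(`η_j` where `j` is the position of `t` from the right in its block). -/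
noncomputable def etaCol (N : ℕ) (μ : ℕ → ℕ) (T : ℕ → ℕ → ℤ) (t : ℕ) : ℕ :=
  ∑ u ∈ Finset.Ico (blockStart μ t) t, rOff N μ T u

noncomputable def etaColDual (N : ℕ) (μ : ℕ → ℕ) (T : ℕ → ℕ → ℤ) (t : ℕ) : ℕ :=
  ∑ u ∈ Finset.Ico (blockStart μ t) t, rOffDual N μ T u

/-- Entries outside the shape are normalized to `0`. -/
def PadZeroT (s : ℕ) (μ : ℕ → ℕ) (T : ℕ → ℕ → ℤ) : Prop :=
  ∀ x t : ℕ, s ≤ t ∨ μ t ≤ x → T x t = 0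

/-- `μ` encodes (the conjugate of) a partition `λ ∈ 𝒫_m ∩ 𝒫_n` with `s` columns. -/
def ShapeOK (m n s : ℕ) (μ : ℕ → ℕ) : Prop :=
  (∀ t : ℕ, t + 1 < s → μ (t + 1) ≤ μ t) ∧ (∀ t < s, 0 < μ t ∧ μ t ≤ m ∧ μ t ≤ n) ∧
    ∀ t : ℕ, s ≤ t → μ t = 0

/-- Dual shape condition: `λ ∈ 𝒫_n`. -/
def ShapeOK' (n s : ℕ) (μ : ℕ → ℕ) : Prop :=
  (∀ t : ℕ, t + 1 < s → μ (t + 1) ≤ μ t) ∧ (∀ t < s, 0 < μ t ∧ μ t ≤ n) ∧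
    ∀ t : ℕ, s ≤ t → μ t = 0

/-- `κ(A) = (P, Q)` where `Q` is obtained by shifting the `t`-th column of `Q₀`
by `τ_n^{ρ_t + η_t}` (`η` the symmetrized offset vector of `P₀`). -/
def KappaRel (m n : ℕ) (A : Mat) (s : ℕ) (μ : ℕ → ℕ) (P Q : ℕ → ℕ → ℤ) : Prop :=
  ∃ (P' Q' : ℕ → ℕ → ℤ) (ρ : ℕ → ℤ),
    Kappa0Rel m n A s μ P' Q' ρ ∧
    (∀ t < s, ∀ x < μ t,
      P x t = P' x t ∧
        Q x t = tauPow n (μ t) (ρ t + (etaCol m μ P' t : ℤ)) (fun y => Q' y t) x) ∧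
    PadZeroT s μ P ∧ PadZeroT s μ Q ∧ ∀ t : ℕ, s ≤ t → μ t = 0

def KappaRel' (m n : ℕ) (A : Mat) (s : ℕ) (μ : ℕ → ℕ) (P Q : ℕ → ℕ → ℤ) : Prop :=
  ∃ (P' Q' : ℕ → ℕ → ℤ) (ρ : ℕ → ℤ),
    Kappa0Rel' m n A s μ P' Q' ρ ∧
    (∀ t < s, ∀ x < μ t,
      P x t = P' x t ∧
        Q x t = tauPow n (μ t) (ρ t + (etaColDual m μ P' t : ℤ)) (fun y => Q' y t) x) ∧
    PadZeroT s μ P ∧ PadZeroT s μ Q ∧ ∀ t : ℕ, s ≤ t → μ t = 0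

/-- Membership in `⨆_{λ ∈ 𝒫_m ∩ 𝒫_n} CSST_[m](λ) × B_n(λ)`:
`P` is column semistandard with entries in `{1, …, m}` and `Q` is a
`ℤ`-semistandard filling whose columns span less than `n` and whose rows
weakly increase within each rectangle block. -/
def InTargetRSK (m n s : ℕ) (μ : ℕ → ℕ) (P Q : ℕ → ℕ → ℤ) : Prop :=
  ShapeOK m n s μ ∧ PadZeroT s μ P ∧ PadZeroT s μ Q ∧
  (∀ t < s, ∀ x : ℕ, x + 1 < μ t → P x t < P (x + 1) t) ∧
  (∀ t < s, ∀ x < μ t, 1 ≤ P x t ∧ P x t ≤ (m : ℤ)) ∧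
  (∀ t < s, ∀ x : ℕ, x + 1 < μ t → Q x t < Q (x + 1) t) ∧
  (∀ t < s, Q (μ t - 1) t - Q 0 t < (n : ℤ)) ∧
    ∀ t : ℕ, t + 1 < s → μ t = μ (t + 1) → ∀ x < μ t, Q x t ≤ Q x (t + 1)

/-- Membership in `⨆_{λ ∈ 𝒫_n} RSST_[m](λ') × B_n(λ)`; the first component is
encoded by `P = P₀` (whose columns, weakly increasing with entries in
`{1, …, m}`, are the rows of `P₀ᵗ ∈ RSST_[m](λ')`). -/
def InTargetDual (m n s : ℕ) (μ : ℕ → ℕ) (P Q : ℕ → ℕ → ℤ) : Prop :=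
  ShapeOK' n s μ ∧ PadZeroT s μ P ∧ PadZeroT s μ Q ∧
  (∀ t < s, ∀ x : ℕ, x + 1 < μ t → P x t ≤ P (x + 1) t) ∧
  (∀ t < s, ∀ x < μ t, 1 ≤ P x t ∧ P x t ≤ (m : ℤ)) ∧
  (∀ t < s, ∀ x : ℕ, x + 1 < μ t → Q x t < Q (x + 1) t) ∧
  (∀ t < s, Q (μ t - 1) t - Q 0 t < (n : ℤ)) ∧
    ∀ t : ℕ, t + 1 < s → μ t = μ (t + 1) → ∀ x < μ t, Q x t ≤ Q x (t + 1)

/-- Dominance of a triple `(P, Q, ρ)`: within each rectangle block, the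
sequence `ρ - ζ` (read right to left) is weakly decreasing, where
`ζ = θ - η` with `η`, `θ` the symmetrized offset vectors of `P`, `Q`. -/
def Dominant (m n s : ℕ) (μ : ℕ → ℕ) (P Q : ℕ → ℕ → ℤ) (ρ : ℕ → ℤ) : Prop :=
  ∀ t : ℕ, t + 1 < s → μ t = μ (t + 1) →
    ρ t - ((etaCol n μ Q t : ℤ) - (etaCol m μ P t : ℤ)) ≤
      ρ (t + 1) - ((etaCol n μ Q (t + 1) : ℤ) - (etaCol m μ P (t + 1) : ℤ))

/-- `κ₀(A) = (P, Q, ρ)` with all data normalized outside the shape. -/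
def Kappa0RelPad (m n : ℕ) (A : Mat) (s : ℕ) (μ : ℕ → ℕ) (P Q : ℕ → ℕ → ℤ)
    (ρ : ℕ → ℤ) : Prop :=
  ∃ P' Q' : ℕ → ℕ → ℤ,
    Kappa0Rel m n A s μ P' Q' ρ ∧
    (∀ t < s, ∀ x < μ t, P x t = P' x t ∧ Q x t = Q' x t) ∧
    PadZeroT s μ P ∧ PadZeroT s μ Q ∧ (∀ t : ℕ, s ≤ t → μ t = 0) ∧
      ∀ t : ℕ, s ≤ t → ρ t = 0

/-- Membership in `Ω_dom`. -/
def InOmegaDom (m n s : ℕ) (μ : ℕ → ℕ) (P Q : ℕ → ℕ → ℤ) (ρ : ℕ → ℤ) : Prop :=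
  ShapeOK m n s μ ∧ PadZeroT s μ P ∧ PadZeroT s μ Q ∧ (∀ t : ℕ, s ≤ t → ρ t = 0) ∧
  (∀ t < s, ∀ x : ℕ, x + 1 < μ t → P x t < P (x + 1) t) ∧
  (∀ t < s, ∀ x < μ t, 1 ≤ P x t ∧ P x t ≤ (m : ℤ)) ∧
  (∀ t < s, ∀ x : ℕ, x + 1 < μ t → Q x t < Q (x + 1) t) ∧
  (∀ t < s, ∀ x < μ t, 1 ≤ Q x t ∧ Q x t ≤ (n : ℤ)) ∧
    Dominant m n s μ P Q ρ

/-- `A` has width `l`: some proper numbering has period `l`. -/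
def HasWidth (m n : ℕ) (A : Mat) (l : ℕ) : Prop :=
  ∃ d : Cell → ℤ, IsProper A d ∧ ∀ c ∈ supp A, d (tauC m n c) = d c + (l : ℤ)

/-! ### Crystal operators on matrices -/

/-- The first `+` of column `j` (row `i`) survives the signature reduction of
the sequence `σ` attached to rows `i, i+1`. -/
def SurvPlus (A : Mat) (i j : ℤ) : Prop :=
  0 < A i j ∧ ∀ j' : ℤ, j < j' →
    (∑ t ∈ Finset.Ioc j j', A (i + 1) t) ≤ (A i j - 1) + ∑ t ∈ Finset.Ioo j j', A i t

/-- The last `-` of column `j` (row `i+1`) survives the reduction. -/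
def SurvMinus (A : Mat) (i j : ℤ) : Prop :=
  0 < A (i + 1) j ∧ ∀ j' : ℤ, j' < j →
    (∑ t ∈ Finset.Ico j' j, A i t) ≤ (A (i + 1) j - 1) + ∑ t ∈ Finset.Ioo j' j, A (i + 1) t

/-- `A - Ê_{i₁ j} + Ê_{i₂ j}`. -/
noncomputable def subAddAt (m n : ℕ) (i₁ i₂ j : ℤ) (A : Mat) : Mat :=
  fun x y =>
    if ∃ k : ℤ, x = i₁ + k * m ∧ y = j + k * n then A x y - 1
    else if ∃ k : ℤ, x = i₂ + k * m ∧ y = j + k * n then A x y + 1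
    else A x y

/-- `f̃_i` on `M̂_{m×n}`, `0`-valued results encoded by `none`. -/
noncomputable def fMat (m n : ℕ) (i : ℤ) (A : Mat) : Option Mat :=
  if h : ∃ j : ℤ, SurvPlus A i j ∧ ∀ j' : ℤ, SurvPlus A i j' → j ≤ j' then
    some (subAddAt m n i (i + 1) h.choose A)
  else none

/-- `ẽ_i` on `M̂_{m×n}`. -/
noncomputable def eMat (m n : ℕ) (i : ℤ) (A : Mat) : Option Mat :=
  if h : ∃ j : ℤ, SurvMinus A i j ∧ ∀ j' : ℤ, SurvMinus A i j' → j' ≤ j then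
    some (subAddAt m n (i + 1) i h.choose A)
  else none

def transM (A : Mat) : Mat := fun i j => A j i

/-- `f̃^t_j A = (f̃_j (Aᵗ))ᵗ`. -/
noncomputable def fMatT (m n : ℕ) (j : ℤ) (A : Mat) : Option Mat :=
  (fMat n m j (transM A)).map transM

/-- `ẽ^t_j A = (ẽ_j (Aᵗ))ᵗ`. -/
noncomputable def eMatT (m n : ℕ) (j : ℤ) (A : Mat) : Option Mat :=
  (eMat n m j (transM A)).map transM

/-- Row operator (`f̃_i` if `x = true`, `ẽ_i` if `x = false`) on `M̂ ∪ {0}`. -/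
noncomputable def rowOp (m n : ℕ) (x : Bool) (i : ℤ) (o : Option Mat) : Option Mat :=
  o.bind (if x then fMat m n i else eMat m n i)

/-- Column operator (`f̃^t_j` or `ẽ^t_j`) on `M̂ ∪ {0}`. -/
noncomputable def colOp (m n : ℕ) (y : Bool) (j : ℤ) (o : Option Mat) : Option Mat :=
  o.bind (if y then fMatT m n j else eMatT m n j)

/-- The `+` of row `u`, column `j` survives the signature reduction of the
sequence attached to columns `j, j+1` (read along rows, top to bottom). -/
def ColSurvPlus (A : Mat) (j u : ℤ) : Prop :=
  0 < A u j ∧ ∀ u' : ℤ, u < u' →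
    (∑ i ∈ Finset.Ioc u u', A i (j + 1)) ≤ (A u j - 1) + ∑ i ∈ Finset.Ioo u u', A i j

/-- `A - Ê_{u j} + Ê_{u, j+1}`, the result of `f̃^t_j` acting at row `u`. -/
noncomputable def ftApply (m n : ℕ) (u j : ℤ) (A : Mat) : Mat :=
  fun x y =>
    if ∃ k : ℤ, x = u + k * m ∧ y = j + k * n then A x y - 1
    else if ∃ k : ℤ, x = u + k * m ∧ y = j + 1 + k * n then A x y + 1
    else A x y

/-! ### Crystal operators on tableaux -/

/-- Column `t` of `P` contributes a `+` for the letter `i`. -/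
def PhasPlus (μ : ℕ → ℕ) (P : ℕ → ℕ → ℤ) (i : ℤ) (t : ℕ) : Prop :=
  (∃ x < μ t, P x t = i) ∧ ∀ x < μ t, P x t ≠ i + 1

/-- Column `t` of `P` contributes a `-` for the letter `i`. -/
def PhasMinus (μ : ℕ → ℕ) (P : ℕ → ℕ → ℤ) (i : ℤ) (t : ℕ) : Prop :=
  (∃ x < μ t, P x t = i + 1) ∧ ∀ x < μ t, P x t ≠ i

/-- The `+` of column `t` survives the tensor-product signature reduction
(factors are the columns read from right to left). -/
def PSurvPlus (μ : ℕ → ℕ) (P : ℕ → ℕ → ℤ) (i : ℤ) (t : ℕ) : Prop :=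
  PhasPlus μ P i t ∧ ∀ t' < t,
    ((Finset.Ico t' t).filter (fun u => PhasMinus μ P i u)).card ≤
      ((Finset.Ioo t' t).filter (fun u => PhasPlus μ P i u)).card

def PSurvMinus (μ : ℕ → ℕ) (P : ℕ → ℕ → ℤ) (i : ℤ) (t : ℕ) : Prop :=
  PhasMinus μ P i t ∧ ∀ t'' : ℕ, t < t'' →
    ((Finset.Ioc t t'').filter (fun u => PhasPlus μ P i u)).card ≤
      ((Finset.Ioo t t'').filter (fun u => PhasMinus μ P i u)).card

/-- `f̃_i` on `P` acting on column `t₀` (replace the letter `i` by `i + 1`). -/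
noncomputable def applyPF (μ : ℕ → ℕ) (P : ℕ → ℕ → ℤ) (i : ℤ) (t₀ : ℕ) :
    ℕ → ℕ → ℤ :=
  fun x t => if t = t₀ ∧ x < μ t ∧ P x t = i then i + 1 else P x t

/-- `ẽ_i` on `P` acting on column `t₀`. -/
noncomputable def applyPE (μ : ℕ → ℕ) (P : ℕ → ℕ → ℤ) (i : ℤ) (t₀ : ℕ) :
    ℕ → ℕ → ℤ :=
  fun x t => if t = t₀ ∧ x < μ t ∧ P x t = i + 1 then i else P x t

/-- The entry at position `k` of a column `c` of height `b` can be increased. -/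
def QmovUp (n b : ℕ) (c : ℕ → ℤ) (k : ℕ) : Prop :=
  (k + 1 < b ∧ c k + 1 < c (k + 1)) ∨ (k + 1 = b ∧ c (b - 1) < c 0 + (n : ℤ) - 1)

/-- The entry at position `k` of a column `c` of height `b` can be decreased. -/
def QmovDown (n b : ℕ) (c : ℕ → ℤ) (k : ℕ) : Prop :=
  (0 < k ∧ c (k - 1) < c k - 1) ∨ (k = 0 ∧ c (b - 1) < c 0 + (n : ℤ) - 1)

def QhasPlus (n : ℕ) (μ : ℕ → ℕ) (Q : ℕ → ℕ → ℤ) (j : ℤ) (t : ℕ) : Prop :=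
  ∃ k < μ t, Int.emod (Q k t) (n : ℤ) = j ∧ QmovUp n (μ t) (fun y => Q y t) k

def QhasMinus (n : ℕ) (μ : ℕ → ℕ) (Q : ℕ → ℕ → ℤ) (j : ℤ) (t : ℕ) : Prop :=
  ∃ k < μ t, Int.emod (Q k t) (n : ℤ) = Int.emod (j + 1) (n : ℤ) ∧
    QmovDown n (μ t) (fun y => Q y t) k

def QSurvPlus (n : ℕ) (μ : ℕ → ℕ) (Q : ℕ → ℕ → ℤ) (j : ℤ) (t : ℕ) : Prop :=
  QhasPlus n μ Q j t ∧ ∀ t' < t,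
    ((Finset.Ico t' t).filter (fun u => QhasMinus n μ Q j u)).card ≤
      ((Finset.Ioo t' t).filter (fun u => QhasPlus n μ Q j u)).card

def QSurvMinus (n : ℕ) (μ : ℕ → ℕ) (Q : ℕ → ℕ → ℤ) (j : ℤ) (t : ℕ) : Prop :=
  QhasMinus n μ Q j t ∧ ∀ t'' : ℕ, t < t'' →
    ((Finset.Ioc t t'').filter (fun u => QhasPlus n μ Q j u)).card ≤
      ((Finset.Ioo t t'').filter (fun u => QhasMinus n μ Q j u)).card

/-- `f̃^t_j` on `Q` acting on column `t₀`. -/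
noncomputable def applyQF (n : ℕ) (μ : ℕ → ℕ) (Q : ℕ → ℕ → ℤ) (j : ℤ) (t₀ : ℕ) :
    ℕ → ℕ → ℤ :=
  fun x t =>
    if t = t₀ ∧ x < μ t ∧ Int.emod (Q x t) (n : ℤ) = j ∧
        QmovUp n (μ t) (fun y => Q y t) x
    then Q x t + 1 else Q x t

/-- `ẽ^t_j` on `Q` acting on column `t₀`. -/
noncomputable def applyQE (n : ℕ) (μ : ℕ → ℕ) (Q : ℕ → ℕ → ℤ) (j : ℤ) (t₀ : ℕ) :
    ℕ → ℕ → ℤ :=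
  fun x t =>
    if t = t₀ ∧ x < μ t ∧ Int.emod (Q x t) (n : ℤ) = Int.emod (j + 1) (n : ℤ) ∧
        QmovDown n (μ t) (fun y => Q y t) x
    then Q x t - 1 else Q x t

/-! ### Standardization -/

noncomputable def rowSumA (A : Mat) (i : ℤ) : ℕ := ∑ᶠ j : ℤ, A i j

noncomputable def colSumA (A : Mat) (j : ℤ) : ℕ := ∑ᶠ i : ℤ, A i j

/-- `A ∈ M̂_{m×n}(α, β)`. -/
def InMhatAB (m n : ℕ) (α β : ℕ → ℕ) (A : Mat) : Prop :=
  IsGAP m n A ∧ (∀ i : ℕ, 1 ≤ i → i ≤ m → rowSumA A i = α i) ∧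
    ∀ j : ℕ, 1 ≤ j → j ≤ n → colSumA A j = β j

/-- Extended affine permutations `W̃_K`. -/
def IsEAP (K : ℕ) (B : Mat) : Prop :=
  IsGAP K K B ∧ (∀ i j : ℤ, B i j ≤ 1) ∧ (∀ i : ℤ, ∃! j : ℤ, B i j ≠ 0) ∧
    ∀ j : ℤ, ∃! i : ℤ, B i j ≠ 0

/-- `i` is a descent of the matrix `B`. -/
def IsDescentM (B : Mat) (i : ℤ) : Prop :=
  ∃ j j' : ℤ, B i j ≠ 0 ∧ B (i + 1) j' ≠ 0 ∧ j' < j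

/-- Partial sums `α₁ + ⋯ + α_i`. -/
def psum (α : ℕ → ℕ) (i : ℕ) : ℕ := ∑ u ∈ Finset.Icc 1 i, α u

/-- `B` is `α`-descending. -/
def AlphaDescending (m : ℕ) (α : ℕ → ℕ) (B : Mat) : Prop :=
  ∀ k : ℕ, 1 ≤ k → k ≤ m → ∀ i : ℤ,
    (psum α (k - 1) : ℤ) < i → i < (psum α k : ℤ) → IsDescentM B i

/-- `B` is `(α, β)`-descending. -/
def IsABDescending (m n : ℕ) (α β : ℕ → ℕ) (B : Mat) : Prop :=
  AlphaDescending m α B ∧ AlphaDescending n β (transM B)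

/-- `B` standardizes `A`: blockwise entry sums of `B` over `𝓘_i × 𝓙_j`
equal the entries of `A`. -/
def PermOf (m n K : ℕ) (α β : ℕ → ℕ) (A B : Mat) : Prop :=
  ∀ (i₀ j₀ : ℕ) (q r : ℤ), 1 ≤ i₀ → i₀ ≤ m → 1 ≤ j₀ → j₀ ≤ n →
    A ((i₀ : ℤ) + q * m) ((j₀ : ℤ) + r * n) =
      ∑ k ∈ Finset.Icc ((psum α (i₀ - 1) : ℤ) + q * K + 1) ((psum α i₀ : ℤ) + q * K),
        ∑ l ∈ Finset.Icc ((psum β (j₀ - 1) : ℤ) + r * K + 1) ((psum β j₀ : ℤ) + r * K),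
          B k l

/-- Standardization of a column-semistandard tableau: for each value `v`, its
occurrences, from left to right, are replaced by consecutive integers starting
after the number of strictly smaller entries. -/
noncomputable def stdT (s : ℕ) (μ : ℕ → ℕ) (T : ℕ → ℕ → ℤ) : ℕ → ℕ → ℤ :=
  fun x t =>
    ((∑ t' ∈ Finset.range s,
        ((Finset.range (μ t')).filter (fun x' => T x' t' < T x t)).card : ℕ) : ℤ) +
      (((Finset.range t).filter (fun t' => ∃ x' < μ t', T x' t' = T x t)).card : ℤ) + 1

/-- `i` is a (column) descent of the tableau `T`: the letter `i + 1` occurs in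
a column strictly to the right of the column containing `i`. -/
def IsDescentT (s : ℕ) (μ : ℕ → ℕ) (T : ℕ → ℕ → ℤ) (i : ℤ) : Prop :=
  ∃ t < s, ∃ t' < s, ∃ x < μ t, ∃ x' < μ t', T x t = i ∧ T x' t' = i + 1 ∧ t < t'

/-! ### Rectangles, `B_n(R)` and `B_n(R)₀` (columns indexed from the right) -/

/-- `T ∈ B_n(R)` for the rectangle `R = (a^b)`; `T j x` is the entry at row `x`
of the `(j+1)`-st column from the right, normalized to `0` outside the shape. -/
def InBnR (n a b : ℕ) (T : ℕ → ℕ → ℤ) : Prop :=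
  (∀ j : ℕ, j + 1 < a → ∀ x < b, T (j + 1) x ≤ T j x) ∧
  (∀ j < a, ∀ x : ℕ, x + 1 < b → T j x < T j (x + 1)) ∧
  (∀ j < a, T j (b - 1) - T j 0 < (n : ℤ)) ∧
    ∀ j x : ℕ, a ≤ j ∨ b ≤ x → T j x = 0

/-- `T ∈ B_n(R)₀`: `(T^{j+1}, τ_n^{-1}(T^j))` is not semistandard for any `j`. -/
def InBnR0 (n a b : ℕ) (T : ℕ → ℕ → ℤ) : Prop :=
  InBnR n a b T ∧
    ∀ j : ℕ, j + 1 < a → ¬ ∀ x < b, T (j + 1) x ≤ tauPow n b (-1) (fun y => T j y) x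

/-- `ν ∈ 𝒫_{a-1}`: a partition `ν₁ ≥ ⋯ ≥ ν_{a-1} ≥ 0`, normalized. -/
def IsPartLen (a : ℕ) (ν : ℕ → ℕ) : Prop :=
  ν 0 = 0 ∧ (∀ j : ℕ, 1 ≤ j → j + 2 ≤ a → ν (j + 1) ≤ ν j) ∧ ∀ j : ℕ, a ≤ j → ν j = 0

/-- `(T, ν) ↦ τ_n^{ν_rev}(T)`: the column `j` (from the right, 0-based) is
shifted by `τ_n^{ν_{j+1}}`. -/
noncomputable def PhiMap (n a b : ℕ) (T : ℕ → ℕ → ℤ) (ν : ℕ → ℕ) : ℕ → ℕ → ℤ :=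
  fun j x => if j < a ∧ x < b then tauPow n b ((ν (j + 1) : ℤ)) (fun y => T j y) x else 0

/-- The offset `r_j` of `T` (columns from the right, paper indexing `j ≥ 1`). -/
noncomputable def rOffR (n b : ℕ) (T : ℕ → ℕ → ℤ) (j : ℕ) : ℕ :=
  sInf {r : ℕ | ∀ x < b, T j x ≤ tauPow n b ((r : ℤ)) (fun y => T (j - 1) y) x}

/-- The symmetrized offset `η_j = r_j + ⋯ + r_{a-1}`. -/
noncomputable def etaR (n a b : ℕ) (T : ℕ → ℕ → ℤ) (j : ℕ) : ℕ :=
  ∑ u ∈ Finset.Icc j (a - 1), rOffR n b T u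

/-! ### The two-column setup -/

/-- Row coordinates of the stream with defining data `(a, ·, ρ)`:
`X(p + ρ + ql) = a(p) + qm` for `1 ≤ p ≤ l`. -/
def streamX (m l : ℕ) (a : ℕ → ℤ) (ρ : ℤ) (idx : ℤ) : ℤ := colExt m l a (idx - ρ - 1)

/-- Column coordinates: `Y(p + ql) = b(p) + qn` for `1 ≤ p ≤ l`. -/
def streamY (n l : ℕ) (b : ℕ → ℤ) (idx : ℤ) : ℤ := colExt n l b (idx - 1)

/-- The matrix built from the interleaved streams `t` and `t'`. -/
noncomputable def twoColMat (m n l : ℕ) (a1 a2 b1 b2 : ℕ → ℤ) (ρ₁ ρ₂ k : ℤ) : Mat :=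
  fun x y =>
    (if ∃ i : ℤ, streamX m l a2 ρ₂ (i + k) = x ∧ streamY n l b1 i = y then 1 else 0) +
      (if ∃ i : ℤ, streamX m l a1 ρ₁ i = x ∧ streamY n l b2 (i + k) = y then 1 else 0)


section
def sh (m n : Nat) (a : Int) (c : Cell) : Cell := (c.1 + a * m, c.2 + a * n)
structure PN (m n : Nat) (l : Int) (S : Set Cell) (d : Cell -> Int) : Prop where
  ne : S.Nonempty
  lpos : 0 < l
  mem : ∀ a c, c ∈ S -> sh m n a c ∈ S
  per : ∀ a c, c ∈ S -> d (sh m n a c) = d c + a * l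
  mono : ∀ c ∈ S, ∀ c' ∈ S, NW c c' -> d c < d c'
  pred : ∀ c ∈ S, ∃ c' ∈ S, NW c' c ∧ d c' = d c - 1
  fin : ∀ k, {c ∈ S | d c = k}.Finite
def Tight (S : Set Cell) (d : Cell -> Int) (e : Int -> Cell) : Prop :=
  ∀ k, e k ∈ S ∧ d (e k) = k ∧ NW (e k) (e (k + 1))
lemma sh_sh (m n : Nat) (a b : Int) (c : Cell) : sh m n a (sh m n b c) = sh m n (a + b) c := by
  ext <;> simp [sh] <;> ring
lemma sh_zero (m n : Nat) (c : Cell) : sh m n 0 c = c := by simp [sh]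
lemma sh_neg (m n : Nat) (a : Int) (c : Cell) : sh m n (-a) (sh m n a c) = c := by
  rw [sh_sh]; simp [sh_zero]
lemma sh_neg' (m n : Nat) (a : Int) (c : Cell) : sh m n a (sh m n (-a) c) = c := by
  rw [sh_sh]; simp [sh_zero]
lemma NW_sh {m n : Nat} {a : Int} {c c' : Cell} : NW (sh m n a c) (sh m n a c') ↔ NW c c' := by
  simp [NW, sh]
lemma neLe_sh {m n : Nat} {a : Int} {c c' : Cell} :
    neLe (sh m n a c) (sh m n a c') ↔ neLe c c' := by
  simp [neLe, sh]
lemma neLe_antisymm {c c' : Cell} (h : neLe c c') (h' : neLe c' c) : c = c' := by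
  obtain ⟨a, b⟩ := c; obtain ⟨a', b'⟩ := c'
  simp only [neLe] at *; ext <;> simp <;> omega
lemma neLe_trans {a b c : Cell} (h : neLe a b) (h' : neLe b c) : neLe a c := by
  simp only [neLe] at *; omega
lemma NW_trans {a b c : Cell} (h : NW a b) (h' : NW b c) : NW a c := by
  simp only [NW] at *; omega
lemma pigeon {α : Type*} {F : Set α} (hF : F.Finite) (Q : Nat -> α -> Prop)
    (anti : ∀ N c, Q (N + 1) c -> Q N c) (h : ∀ N, ∃ c ∈ F, Q N c) :
    ∃ c ∈ F, ∀ N, Q N c := by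
  have anti' : ∀ N M c, N ≤ M -> Q M c -> Q N c := by
    intro N M c hNM
    induction hNM with
    | refl => exact id
    | step _ ih => exact fun hq => ih (anti _ _ hq)
  by_contra! hc
  choose! f hf using hc
  obtain ⟨c, hc, hq⟩ := h (hF.toFinset.sup f)
  exact hf c hc (anti' _ _ c (Finset.le_sup (f := f) (hF.mem_toFinset.2 hc)) hq)
def Pw (S : Set Cell) (d : Cell -> Int) : Nat -> Cell -> Prop
  | 0, c => c ∈ S
  | N + 1, c => c ∈ S ∧ ∃ c' ∈ S, NW c c' ∧ d c' = d c + 1 ∧ Pw S d N c'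
lemma Pw.mem {S : Set Cell} {d} {N : Nat} {c : Cell} (h : Pw S d N c) : c ∈ S := by
  cases N with
  | zero => exact h
  | succ N => exact h.1
lemma Pw.anti {S : Set Cell} {d} : ∀ (N : Nat) (c : Cell), Pw S d (N + 1) c -> Pw S d N c := by
  intro N
  induction N with
  | zero => intro c h; exact h.1
  | succ N ih =>
    rintro c ⟨h, c', h1, h2, h3, h4⟩
    exact ⟨h, c', h1, h2, h3, ih _ h4⟩
lemma PN.level_ne {m n l S d} (h : PN m n l S d) (k : Int) : ∃ c ∈ S, d c = k := by
  obtain ⟨c0, hc0⟩ := h.ne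
  have key : ∀ (j : Nat) (c : Cell), c ∈ S -> ∃ c' ∈ S, d c' = d c - j := by
    intro j
    induction j with
    | zero => intro c hc; exact ⟨c, hc, by simp⟩
    | succ j ih =>
      intro c hc
      obtain ⟨c', h1, h2⟩ := ih c hc
      obtain ⟨c'', h3, h4, h5⟩ := h.pred c' h1
      exact ⟨c'', h3, by push_cast; omega⟩
  have hl := h.lpos
  have h1 := h.per |k - d c0| c0 hc0
  have h2 : k ≤ d (sh m n |k - d c0| c0) := by
    rw [h1]; nlinarith [abs_nonneg (k - d c0), le_abs_self (k - d c0)]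
  obtain ⟨c', h3, h4⟩ := key (d (sh m n |k - d c0| c0) - k).toNat _ (h.mem |k - d c0| _ hc0)
  exact ⟨c', h3, by omega⟩
lemma PN.Pw_level {m n l S d} (h : PN m n l S d) (N : Nat) : ∀ k, ∃ c, d c = k ∧ Pw S d N c := by
  have key : ∀ (N j : Nat) (c : Cell), Pw S d j c -> ∃ c', d c' = d c - N ∧ Pw S d (N + j) c' := by
    intro N
    induction N with
    | zero => intro j c hc; exact ⟨c, by simp, by simpa using hc⟩
    | succ N ih =>
      intro j c hc
      obtain ⟨c', h1, h2⟩ := ih j c hc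
      obtain ⟨c'', h3, h4, h5⟩ := h.pred c' h2.mem
      refine ⟨c'', by push_cast; omega, ?_⟩
      rw [show N + 1 + j = (N + j) + 1 by ring]
      exact ⟨h3, c', h2.mem, h4, by omega, h2⟩
  intro k
  obtain ⟨c, h1, h2⟩ := h.level_ne (k + N)
  obtain ⟨c', h3, h4⟩ := key N 0 c h1
  exact ⟨c', by omega, h4⟩
lemma neLe_total_of {c c' : Cell} (h : ¬ NW c c') (h' : ¬ NW c' c) : neLe c c' ∨ neLe c' c := by
  simp only [neLe, NW] at *; omega
theorem river {m n l S d} (h : PN m n l S d) : ∃ e : Int -> Cell, Tight S d e ∧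
    (∀ a k, sh m n a (e k) = e (k + a * l)) ∧
    ∀ e', Tight S d e' -> ∀ k, neLe (e k) (e' k) := by
  set O : Set Cell := {c | ∀ N, Pw S d N c} with hO
  have OS : ∀ c ∈ O, c ∈ S := fun c hc => hc 0
  have Ofin : ∀ k, {c ∈ O | d c = k}.Finite := fun k =>
    (h.fin k).subset (fun c hc => ⟨OS c hc.1, hc.2⟩)
  have One : ∀ k, ∃ c ∈ O, d c = k := by
    intro k
    obtain ⟨c, h1, h2⟩ := pigeon (h.fin k) (fun N c => Pw S d N c) Pw.anti (by
      intro N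
      obtain ⟨c, h1, h2⟩ := h.Pw_level N k
      exact ⟨c, ⟨h2.mem, h1⟩, h2⟩)
    exact ⟨c, h2, h1.2⟩
  have Osucc : ∀ c ∈ O, ∃ c' ∈ O, NW c c' ∧ d c' = d c + 1 := by
    intro c hc
    obtain ⟨c', h1, h2⟩ := pigeon (h.fin (d c + 1)) (fun N c' => NW c c' ∧ Pw S d N c')
      (fun N c h => ⟨h.1, Pw.anti _ _ h.2⟩) (by
      intro N
      obtain ⟨_, c', h1, h2, h3, h4⟩ := hc (N + 1)
      exact ⟨c', ⟨h1, h3⟩, h2, h4⟩)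
    exact ⟨c', fun N => (h2 N).2, (h2 0).1, h1.2⟩
  have Opred : ∀ c ∈ O, ∃ c' ∈ O, NW c' c ∧ d c' = d c - 1 := by
    intro c hc
    obtain ⟨c', h1, h2, h3⟩ := h.pred c (OS c hc)
    refine ⟨c', ?_, h2, h3⟩
    intro N
    apply Pw.anti
    exact ⟨h1, c, OS c hc, h2, by omega, hc N⟩
  have nocomp : ∀ c ∈ O, ∀ c' ∈ O, d c = d c' -> neLe c c' ∨ neLe c' c := by
    intro c hc c' hc' hd
    apply neLe_total_of
    · intro hh; have := h.mono _ (OS c hc) _ (OS c' hc') hh; omega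
    · intro hh; have := h.mono _ (OS c' hc') _ (OS c hc) hh; omega
  have hmin : ∀ k, ∃ c ∈ O, d c = k ∧ ∀ c' ∈ O, d c' = k -> neLe c c' := by
    intro k
    obtain ⟨c, h1, h2⟩ := Set.exists_min_image _ (fun c : Cell => c.2 - c.1) (Ofin k)
      (by obtain ⟨c, h1, h2⟩ := One k; exact ⟨c, h1, h2⟩)
    refine ⟨c, h1.1, h1.2, fun c' hc' hd => ?_⟩
    have h3 := h2 c' ⟨hc', hd⟩
    rcases nocomp c h1.1 c' hc' (h1.2.trans hd.symm) with h4 | h4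
    · exact h4
    · simp only [neLe] at *; omega
  choose e he1 he2 he3 using hmin
  have Osh : ∀ a, ∀ c ∈ O, sh m n a c ∈ O := by
    intro a c hc N
    have : ∀ N c, Pw S d N c -> Pw S d N (sh m n a c) := by
      intro N
      induction N with
      | zero => intro c hc; exact h.mem a c hc
      | succ N ih =>
        rintro c ⟨h1, c', h2, h3, h4, h5⟩
        refine ⟨h.mem a c h1, sh m n a c', h.mem a c' h2, NW_sh.2 h3, ?_, ih _ h5⟩
        rw [h.per a c h1, h.per a c' h2]; omega
    exact this N c (hc N)
  refine ⟨e, ?_, ?_, ?_⟩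
  · intro k
    refine ⟨OS _ (he1 k), he2 k, ?_⟩
    obtain ⟨c, h1, h2, h3⟩ := Opred _ (he1 (k + 1))
    obtain ⟨c', h4, h5, h6⟩ := Osucc _ (he1 k)
    have h7 := he3 k c h1 (by rw [h3, he2]; ring)
    have h8 := he3 (k + 1) c' h4 (by rw [h6, he2])
    simp only [neLe, NW] at *; omega
  · intro a k
    apply neLe_antisymm
    · have := he3 k (sh m n (-a) (e (k + a * l))) (Osh _ _ (he1 _)) (by
        rw [h.per _ _ (OS _ (he1 _)), he2]; ring)
      rw [<- neLe_sh (m := m) (n := n) (a := a), sh_neg'] at this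
      exact this
    · exact he3 _ _ (Osh _ _ (he1 _)) (by rw [h.per _ _ (OS _ (he1 _)), he2])
  · intro e' he' k
    apply he3 k _ _ (he' k).2.1
    have : ∀ N k, Pw S d N (e' k) := by
      intro N
      induction N with
      | zero => intro k; exact (he' k).1
      | succ N ih =>
        intro k
        exact ⟨(he' k).1, e' (k + 1), (he' _).1, (he' k).2.2, by
          rw [(he' k).2.1, (he' (k + 1)).2.1], ih _⟩
    exact fun N => this N k
lemma switch {b b' c c' : Cell} (h1 : NW b b') (h2 : NW c c') (h3 : neLe b c) (h4 : neLe c' b') :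
    NW b c' ∧ NW c b' := by
  simp only [neLe, NW] at *; omega
lemma Tight.mono {S d e} (h : Tight S d e) {i j : Int} (hij : i < j) : NW (e i) (e j) := by
  have : ∀ k : Nat, NW (e i) (e (i + 1 + k)) := by
    intro k
    induction k with
    | zero => simpa using (h i).2.2
    | succ k ih => 
      have := NW_trans ih (h _).2.2
      push_cast; rwa [<- add_assoc]
  have := this (j - (i + 1)).toNat
  rwa [show i + 1 + ((j - (i + 1)).toNat : Int) = j by omega] at this
end
section
def Ch (S : Set Cell) : Nat -> Cell -> Cell -> Prop
  | 0, a, b => a ∈ S ∧ a = b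
  | k + 1, a, b => a ∈ S ∧ ∃ c, NW a c ∧ Ch S k c b
lemma Ch.left {S : Set Cell} {k : Nat} {a b : Cell} (h : Ch S k a b) : a ∈ S := by
  cases k with
  | zero => exact h.1
  | succ k => exact h.1
lemma Ch.trans {S : Set Cell} : ∀ {k k' : Nat} {a b c : Cell}, Ch S k a b -> Ch S k' b c ->
    Ch S (k + k') a c := by
  intro k
  induction k with
  | zero => rintro k' a b c ⟨_, rfl⟩ h; simpa using h
  | succ k ih =>
    rintro k' a b c ⟨h, d, h1, h2⟩ h3
    rw [show k + 1 + k' = (k + k') + 1 by ring]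
    exact ⟨h, d, h1, ih h2 h3⟩
lemma Ch.right {S : Set Cell} : ∀ {k : Nat} {a b : Cell}, Ch S k a b -> b ∈ S := by
  intro k
  induction k with
  | zero => rintro a b ⟨h, rfl⟩; exact h
  | succ k ih => rintro a b ⟨_, d, _, h⟩; exact ih h
lemma Ch.one {S : Set Cell} {a b : Cell} (ha : a ∈ S) (hb : b ∈ S) (h : NW a b) : Ch S 1 a b :=
  ⟨ha, b, h, hb, rfl⟩
lemma Ch.toFun {S : Set Cell} : ∀ {k : Nat} {a b : Cell}, Ch S k a b -> ∃ p : Nat -> Cell,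
    p 0 = a ∧ p k = b ∧ (∀ i ≤ k, p i ∈ S) ∧ ∀ i < k, NW (p i) (p (i + 1)) := by
  intro k
  induction k with
  | zero =>
    rintro a b ⟨h, rfl⟩
    exact ⟨fun _ => a, rfl, rfl, fun _ _ => h, fun i hi => absurd hi (by omega)⟩
  | succ k ih =>
    rintro a b ⟨h, d, h1, h2⟩
    obtain ⟨p, q1, q2, q3, q4⟩ := ih h2
    refine ⟨fun i => match i with | 0 => a | i + 1 => p i, rfl, q2, ?_, ?_⟩
    · rintro (_ | i) hi
      · exact h
      · exact q3 i (by omega)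
    · rintro (_ | i) hi
      · simpa [q1] using h1
      · exact q4 i (by omega)
lemma Ch.ofFun {S : Set Cell} {k : Nat} {p : Nat -> Cell} (h : ∀ i ≤ k, p i ∈ S)
    (h' : ∀ i < k, NW (p i) (p (i + 1))) {i j : Nat} (hij : i ≤ j) (hj : j ≤ k) :
    Ch S (j - i) (p i) (p j) := by
  induction j with
  | zero => obtain rfl : i = 0 := by omega
            exact ⟨h 0 (by omega), rfl⟩
  | succ j ih =>
    rcases Nat.lt_or_ge j i with h1 | h1
    · obtain rfl : i = j + 1 := by omega
      rw [Nat.sub_self]; exact ⟨h _ hj, rfl⟩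
    · rw [show j + 1 - i = (j - i) + 1 by omega]
      exact (ih h1 (by omega)).trans (Ch.one (h _ (by omega)) (h _ hj) (h' _ (by omega)))
lemma Ch.shf {S : Set Cell} {m n : Nat} {a : Int} (hS : ∀ c ∈ S, sh m n a c ∈ S) : ∀ {k : Nat} {b c : Cell},
    Ch S k b c -> Ch S k (sh m n a b) (sh m n a c) := by
  intro k
  induction k with
  | zero => rintro b c ⟨h, rfl⟩; exact ⟨hS _ h, rfl⟩
  | succ k ih => rintro b c ⟨h, d, h1, h2⟩; exact ⟨hS _ h, _, NW_sh.2 h1, ih h2⟩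
lemma tauC_eq (m n : Nat) (c : Cell) : tauC m n c = sh m n 1 c := by simp [tauC, sh]
lemma Ch.cyc {S : Set Cell} {m n : Nat} (hS : ∀ a, ∀ c ∈ S, sh m n a c ∈ S) {L : Nat} (hL : 0 < L)
    {b : Cell} (h : Ch S L b (tauC m n b)) :
    ∃ e, IsStreamEnum m n e L ∧ ∀ k, e k ∈ S := by
  obtain ⟨p, h0, h1, h2, h3⟩ := h.toFun
  refine ⟨fun z => sh m n (z / L) (p (z % L).toNat), ⟨hL, ?_, ?_⟩, ?_⟩
  · intro z
    have hLz : (0 : Int) < L := by exact_mod_cast hL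
    have e1 := Int.emod_nonneg z hLz.ne'
    have e2 := Int.emod_lt_of_pos z hLz
    have e3 := Int.emod_add_mul_ediv z L
    rcases lt_or_eq_of_le (show z % L + 1 ≤ L by omega) with h4 | h4
    · have e4 : (z + 1) / L = z / L := by
        rw [Int.ediv_eq_iff_of_pos hLz]; constructor <;> nlinarith
      have e5 : (z + 1) % L = z % L + 1 := by
        rw [Int.emod_def, e4]; linarith
      simp only [e4, e5]
      rw [NW_sh]
      have := h3 (z % L).toNat (by omega)
      rwa [show (z % L + 1).toNat = (z % L).toNat + 1 by omega]
    · have e4 : (z + 1) / L = z / L + 1 := by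
        rw [Int.ediv_eq_iff_of_pos hLz]; constructor <;> nlinarith
      have e5 : (z + 1) % L = 0 := by
        rw [Int.emod_def, e4]; linarith
      simp only [e4, e5]
      rw [<- sh_sh, NW_sh]
      have := h3 (z % L).toNat (by omega)
      rw [show (z % L).toNat + 1 = L by omega, h1, tauC_eq, <- h0] at this
      exact this
  · intro z
    have hLz : (L : Int) ≠ 0 := by exact_mod_cast hL.ne'
    simp only
    rw [tauC_eq, sh_sh, Int.add_emod_right, Int.add_ediv_of_dvd_right (dvd_refl _), Int.ediv_self hLz,
      add_comm]
  · intro z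
    have hLz : (0 : Int) < L := by exact_mod_cast hL
    have e1 := Int.emod_nonneg z hLz.ne'
    have e2 := Int.emod_lt_of_pos z hLz
    exact hS _ _ (h2 (z % L).toNat (by omega))
structure Side (m n : Nat) (R : Cell -> Cell -> Prop) : Prop where
  tot : ∀ a b, ¬ NW a b -> ¬ NW b a -> R a b ∨ R b a
  sw : ∀ b b' c c', NW b b' -> NW c c' -> R b c -> R c' b' -> NW b c' ∧ NW c b'
  no : ∀ a b c, R a b -> R b c -> ¬ NW a c
  shi : ∀ a b c, R (sh m n a b) (sh m n a c) -> R b c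
lemma side_neLe (m n : Nat) : Side m n neLe where
  tot := fun a b h h' => neLe_total_of h h'
  sw := fun _ _ _ _ h1 h2 h3 h4 => switch h1 h2 h3 h4
  no := by intro a b c; simp only [neLe, NW]; omega
  shi := by intro a b c; exact neLe_sh.1
lemma side_flip (m n : Nat) : Side m n (fun a b => neLe b a) where
  tot := fun a b h h' => (neLe_total_of h h').symm
  sw := by intro a b c d; simp only [neLe, NW]; omega
  no := by intro a b c; simp only [neLe, NW]; omega
  shi := by intro a b c; exact neLe_sh.1
lemma noExcess_aux {S : Set Cell} {m n : Nat} (hS : ∀ a, ∀ c ∈ S, sh m n a c ∈ S) {l : Nat} {e : Int -> Cell}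
    (he : IsStreamEnum m n e l) (heS : ∀ k, e k ∈ S)
    (hmax : ∀ e' l', IsStreamEnum m n e' l' -> (∀ k, e' k ∈ S) -> l' ≤ l)
    {s : Nat} (hs : l < s) (ih : ∀ s' < s, ∀ x k, Ch S k (e x) (e (x + s')) -> k ≤ s')
    {x : Int} {p : Nat -> Cell} (p0 : p 0 = e x) (pk : p (s + 1) = e (x + s))
    (pS : ∀ i ≤ s + 1, p i ∈ S) (pN : ∀ i < s + 1, NW (p i) (p (i + 1)))
    {R : Cell -> Cell -> Prop} (hR : Side m n R) (h0 : R (p l) (e (x + l))) : False := by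
  have hl := he.1
  have C : ∀ i j, i ≤ j -> j ≤ s + 1 -> Ch S (j - i) (p i) (p j) := fun i j h1 h2 => Ch.ofFun pS pN h1 h2
  have I : ∀ (s' : Nat) (y z : Int) (k : Nat), s' < s -> z = y + s' -> Ch S k (e y) (e z) -> k ≤ s' := by
    rintro s' y z k h1 rfl h2; exact ih s' h1 y k h2
  have eN := he.2.1
  have eT : ∀ i, sh m n 1 (e i) = e (i + l) := fun i => by rw [<- tauC_eq, he.2.2]
  have st : ∀ i, 1 ≤ i -> i ≤ s - 1 -> i ≤ l -> R (p i) (e (x + i)) := by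
    have : ∀ j, j ≤ l -> 1 ≤ l - j -> R (p (l - j)) (e (x + (l - j : Nat))) := by
      intro j
      induction j with
      | zero => intro _ _; simpa using h0
      | succ j ihj =>
        intro h1 h2
        have h3 := ihj (by omega) (by omega)
        set i := l - (j + 1) with hi
        have hi' : l - j = i + 1 := by omega
        rw [hi'] at h3
        have g1 : ¬ NW (p i) (e (x + i)) := by
          intro h
          have h4 := (C 0 i (by omega) (by omega)).trans (Ch.one (pS i (by omega)) (heS _) h)
          rw [p0] at h4
          have := I i _ _ _ (by omega) rfl h4
          omega
        have g2 : ¬ NW (e (x + i)) (p i) := by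
          intro h
          have h4 := (Ch.one (heS _) (pS i (by omega)) h).trans (C i (s + 1) (by omega) (by omega))
          rw [pk] at h4
          have := I (s - i) _ _ _ (by omega) (by omega) h4
          omega
        rcases hR.tot _ _ g1 g2 with h5 | h5
        · exact h5
        · exfalso
          have e1 := eN (x + i)
          push_cast at h3
          rw [<- add_assoc] at h3
          have := (hR.sw _ _ _ _ e1 (pN i (by omega)) h5 h3).1
          have h4 := (Ch.one (heS _) (pS (i + 1) (by omega)) this).trans
            (C (i + 1) (s + 1) (by omega) (by omega))
          rw [pk] at h4
          have := I (s - i) _ _ _ (by omega) (by omega) h4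
          omega
    intro i h1 h2 h3
    have := this (l - i) (by omega) (by omega)
    rwa [show l - (l - i) = i by omega] at this
  have ta : ∀ i, i + l ≤ s + 1 -> R (p (i + l)) (sh m n 1 (p i)) := by
    intro i
    induction i with
    | zero => intro _; rw [p0, eT]; simpa using h0
    | succ i ihi =>
      intro h1
      have h2 := ihi (by omega)
      have hT : ∀ i, i ≤ s + 1 -> Ch S i (e (x + l)) (sh m n 1 (p i)) := by
        intro i hi
        have := (C 0 i (by omega) hi).shf (hS 1)
        rwa [p0, eT] at this
      have g1 : ¬ NW (p (i + 1 + l)) (sh m n 1 (p (i + 1))) := by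
        intro h
        have h3 := (C (i + 1) (i + 1 + l) (by omega) (by omega)).trans
          (Ch.one (pS _ h1) (hS _ _ (pS (i + 1) (by omega))) h)
        rw [<- tauC_eq] at h3
        obtain ⟨e', h4, h5⟩ := Ch.cyc hS (by omega) h3
        have := hmax _ _ h4 h5
        omega
      have g2 : ¬ NW (sh m n 1 (p (i + 1))) (p (i + 1 + l)) := by
        intro h
        have h3 := ((hT (i + 1) (by omega)).trans (Ch.one (hS _ _ (pS (i + 1) (by omega))) (pS _ h1) h)).trans
          (C _ (s + 1) h1 le_rfl)
        rw [pk] at h3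
        have := I (s - l) _ _ _ (by omega) (by omega) h3
        omega
      rcases hR.tot _ _ g1 g2 with h5 | h5
      · exact h5
      · exfalso
        have e1 := pN (i + l) (by omega)
        have e2 := (NW_sh (m := m) (n := n) (a := 1)).2 (pN i (by omega))
        rw [show i + l + 1 = i + 1 + l by ring] at e1
        have := (hR.sw _ _ _ _ e1 e2 h2 h5).2
        have h3 := ((hT i (by omega)).trans (Ch.one (hS _ _ (pS i (by omega))) (pS _ h1) this)).trans
          (C _ (s + 1) h1 le_rfl)
        rw [pk] at h3
        have := I (s - l) _ _ _ (by omega) (by omega) h3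
        omega
  have t1 := ta (s + 1 - l) (by omega)
  rw [show s + 1 - l + l = s + 1 by omega, pk, show x + (s : Int) = x + (s - l : Nat) + l by omega, <- eT] at t1
  have t2 := hR.shi _ _ _ t1
  have en : ∀ j, j ≤ s + 1 - l -> 2 ≤ s + 1 - l - j ->
      R (e (x + (s + 1 - l - j : Nat) - 1)) (p (s + 1 - l - j)) := by
    intro j
    induction j with
    | zero =>
      intro _ _
      rw [show x + (s + 1 - l - 0 : Nat) - 1 = x + (s - l : Nat) by omega]
      exact t2
    | succ j ihj =>
      intro h1 h2
      have h3 := ihj (by omega) (by omega)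
      set i := s + 1 - l - (j + 1) with hi
      have hi' : s + 1 - l - j = i + 1 := by omega
      rw [hi', show x + (i + 1 : Nat) - 1 = x + (i : Int) - 1 + 1 by push_cast; ring] at h3
      have g1 : ¬ NW (p i) (e (x + i - 1)) := by
        intro h
        have h4 := (C 0 i (by omega) (by omega)).trans (Ch.one (pS i (by omega)) (heS _) h)
        rw [p0] at h4
        have := I (i - 1) _ _ _ (by omega) (by omega) h4
        omega
      have g2 : ¬ NW (e (x + i - 1)) (p i) := by
        intro h
        have h4 := (Ch.one (heS _) (pS i (by omega)) h).trans (C i (s + 1) (by omega) (by omega))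
        rw [pk] at h4
        have := I (s - i + 1) _ _ _ (by omega) (by omega) h4
        omega
      rcases hR.tot _ _ g1 g2 with h5 | h5
      · exfalso
        have := (hR.sw _ _ _ _ (pN i (by omega)) (eN _) h5 h3).1
        have h4 := (C 0 i (by omega) (by omega)).trans (Ch.one (pS i (by omega)) (heS _) this)
        rw [p0] at h4
        have := I i _ _ _ (by omega) (by omega) h4
        omega
      · exact h5
  have a1 := st 1 le_rfl (by omega) hl
  have a2 := en (s + 1 - l - 2) (by omega) (by omega)
  rw [show s + 1 - l - (s + 1 - l - 2) = 2 by omega, show x + (2 : Nat) - 1 = x + (1 : Nat) by push_cast; ring] at a2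
  exact hR.no _ _ _ a1 a2 (pN 1 (by omega))
lemma stream_ch {S : Set Cell} {m n : Nat} {l : Nat} {e : Int -> Cell}
    (he : IsStreamEnum m n e l) (heS : ∀ k, e k ∈ S) (x : Int) (k : Nat) : Ch S k (e x) (e (x + k)) := by
  have := Ch.ofFun (S := S) (k := k) (p := fun i => e (x + i)) (fun i _ => heS _)
    (fun i _ => by have := he.2.1 (x + i); push_cast; rwa [<- add_assoc]) (Nat.zero_le k) le_rfl
  simpa using this
theorem noExcess {S : Set Cell} {m n : Nat} (hS : ∀ a, ∀ c ∈ S, sh m n a c ∈ S) {l : Nat} {e : Int -> Cell}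
    (he : IsStreamEnum m n e l) (heS : ∀ k, e k ∈ S)
    (hmax : ∀ e' l', IsStreamEnum m n e' l' -> (∀ k, e' k ∈ S) -> l' ≤ l) (s : Nat) :
    ∀ x k, Ch S k (e x) (e (x + s)) -> k ≤ s := by
  induction s using Nat.strong_induction_on with
  | _ s ih =>
    intro x k hk
    by_contra! hks
    obtain ⟨q, q0, q1, q2, q3⟩ := hk.toFun
    have hsh : Ch S (s + 1) (e x) (e (x + s)) := by
      have h1 := Ch.ofFun q2 q3 (Nat.zero_le s) hks.le
      rw [q0] at h1
      refine Ch.trans h1 (Ch.one h1.right (heS _) ?_)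
      rw [<- q1]
      obtain ⟨r, hr⟩ : ∃ r, k = s + 1 + r := ⟨k - (s + 1), by omega⟩
      have : ∀ r, s + 1 + r ≤ k -> NW (q s) (q (s + 1 + r)) := by
        intro r
        induction r with
        | zero => intro h; exact q3 _ (by omega)
        | succ r ihr => intro h; exact NW_trans (ihr (by omega)) (q3 _ (by omega))
      rw [hr]; exact this r (by omega)
    rcases Nat.lt_or_ge l s with h1 | h1
    · obtain ⟨p, p0, pk, pS, pN⟩ := hsh.toFun
      have hl := he.1
      have C : ∀ i j, i ≤ j -> j ≤ s + 1 -> Ch S (j - i) (p i) (p j) := fun i j h1 h2 => Ch.ofFun pS pN h1 h2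
      have g1 : ¬ NW (p l) (e (x + l)) := by
        intro h
        have h4 := (C 0 l (by omega) (by omega)).trans (Ch.one (pS l (by omega)) (heS _) h)
        rw [p0] at h4
        have := ih l (by omega) _ _ h4
        omega
      have g2 : ¬ NW (e (x + l)) (p l) := by
        intro h
        have h4 := (Ch.one (heS _) (pS l (by omega)) h).trans (C l (s + 1) (by omega) (by omega))
        rw [pk, show x + (s : Int) = x + l + (s - l : Nat) by omega] at h4
        have := ih (s - l) (by omega) _ _ h4
        omega
      rcases neLe_total_of g1 g2 with h | h
      · exact noExcess_aux hS he heS hmax h1 ih p0 pk pS pN (side_neLe m n) h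
      · exact noExcess_aux hS he heS hmax h1 ih p0 pk pS pN (side_flip m n) h
    · have h2 := hsh.trans (stream_ch he heS (x + s) (l - s))
      rw [show x + (s : Int) + (l - s : Nat) = x + l by omega, <- he.2.2] at h2
      obtain ⟨e', h4, h5⟩ := Ch.cyc hS (by omega) h2
      have := hmax _ _ h4 h5
      omega
end
section
structure Per (m n : Nat) (S : Set Cell) : Prop where
  mem : ∀ a, ∀ c ∈ S, sh m n a c ∈ S
  fd : {c ∈ S | 0 ≤ c.2 ∧ c.2 < n}.Finite
lemma Per.rep {m n : Nat} {S : Set Cell} (h : Per m n S) (hn : 0 < n) {c : Cell} (hc : c ∈ S) :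
    ∃ f ∈ {c ∈ S | 0 ≤ c.2 ∧ c.2 < n}, ∃ a, c = sh m n a f := by
  have hn' : (0 : Int) < n := by exact_mod_cast hn
  refine ⟨sh m n (-(c.2 / n)) c, ⟨h.mem _ _ hc, ?_⟩, c.2 / n, (sh_neg' _ _ _ _).symm⟩
  have e1 := Int.emod_nonneg c.2 hn'.ne'
  have e2 := Int.emod_lt_of_pos c.2 hn'
  have e3 := Int.emod_add_mul_ediv c.2 n
  simp only [sh]
  constructor <;> nlinarith
lemma Per.fin {m n : Nat} {S : Set Cell} (h : Per m n S) (hn : 0 < n) {l : Int} (hl : 0 < l)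
    {d : Cell -> Int} (hd : ∀ a, ∀ c ∈ S, d (sh m n a c) = d c + a * l) (k : Int) :
    {c ∈ S | d c = k}.Finite := by
  apply (h.fd.image (fun f => sh m n ((k - d f) / l) f)).subset
  rintro c ⟨hc, hk⟩
  obtain ⟨f, hf, a, rfl⟩ := h.rep hn hc
  refine ⟨f, hf, ?_⟩
  rw [hd a f hf.1] at hk
  simp only
  rw [show k - d f = a * l by omega, Int.mul_ediv_cancel _ hl.ne']
lemma Per.bdd {m n : Nat} {S : Set Cell} (h : Per m n S) (hn : 0 < n)
    (F : Cell -> Int) (hF : ∀ a, ∀ c ∈ S, F (sh m n a c) = F c) : ∃ N, 0 ≤ N ∧ ∀ c ∈ S, |F c| ≤ N := by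
  obtain ⟨N, hN⟩ := (h.fd.image (fun f => |F f|)).bddAbove
  refine ⟨max N 0, le_max_right _ _, fun c hc => ?_⟩
  obtain ⟨f, hf, a, rfl⟩ := h.rep hn hc
  rw [hF a f hf.1]
  exact le_max_of_le_left (hN ⟨f, hf, rfl⟩)
lemma Per.band {m n : Nat} {S : Set Cell} (h : Per m n S) (hn : 0 < n) :
    ∃ N : Int, 0 ≤ N ∧ ∀ c ∈ S, |n * c.1 - m * c.2| ≤ N := by
  apply h.bdd hn (fun c => n * c.1 - m * c.2)
  intro a c _
  simp only [sh]; ring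
lemma supp_sh {m n : Nat} {A : Mat} (hA : IsGAP m n A) (a : Int) (i j : Int) :
    A (i + a * m) (j + a * n) = A i j := by
  induction a using Int.induction_on with
  | zero => simp
  | succ a ih =>
    rw [<- ih, <- hA.1 (i + a * m) (j + a * n)]; congr 1 <;> ring
  | pred a ih =>
    rw [<- ih, <- hA.1 (i + (-a - 1) * m) (j + (-a - 1) * n)]; congr 1 <;> ring
lemma GAP_per {m n : Nat} {A : Mat} (hA : IsGAP m n A) : Per m n (supp A) := by
  refine ⟨fun a c hc => ?_, ?_⟩
  · simp only [supp, Set.mem_setOf_eq, sh] at *; rwa [supp_sh hA]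
  · have : ({c : Cell | c ∈ supp A ∧ 0 ≤ c.2 ∧ c.2 < n}) ⊆
        ⋃ j ∈ Set.Ico (0 : Int) n, (fun i => (i, j)) '' {i : Int | A i j ≠ 0} := by
      rintro ⟨i, j⟩ ⟨h1, h2⟩
      simp only [Set.mem_iUnion]
      exact ⟨j, h2, i, h1, rfl⟩
    apply Set.Finite.subset _ this
    exact (Set.finite_Ico _ _).biUnion (fun j _ => (hA.2 j).image _)
lemma stream_sh {m n l : Nat} {e : Int -> Cell} (he : IsStreamEnum m n e l) (a k : Int) :
    sh m n a (e k) = e (k + a * l) := by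
  have h1 : ∀ k, sh m n 1 (e k) = e (k + l) := fun k => by rw [<- tauC_eq, he.2.2]
  induction a using Int.induction_on generalizing k with
  | zero => simp [sh_zero]
  | succ a ih => 
    rw [show (a : Int) + 1 = 1 + a by ring, <- sh_sh, ih, h1]; congr 1; ring
  | pred a ih =>
    have := h1 (k + (-a - 1) * l)
    rw [show k + (-(a : Int) - 1) * l + l = k + -a * l by ring, <- ih] at this
    rw [show -(a : Int) - 1 = -1 + -a by ring, <- sh_sh, <- this, sh_neg]; congr 1; ring
lemma stream_mono {m n l : Nat} {e : Int -> Cell} (he : IsStreamEnum m n e l) {i j : Int} (hij : i < j) :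
    NW (e i) (e j) := by
  have := stream_ch (S := Set.univ) he (fun _ => trivial) (i + 1) (j - (i + 1)).toNat
  have h1 : Tight (Set.range e) (fun c => 0) e -> True := fun _ => trivial
  have : ∀ k : Nat, NW (e i) (e (i + 1 + k)) := by
    intro k
    induction k with
    | zero => simpa using he.2.1 i
    | succ k ih =>
      have := NW_trans ih (he.2.1 _)
      push_cast; rwa [<- add_assoc]
  have := this (j - (i + 1)).toNat
  rwa [show i + 1 + ((j - (i + 1)).toNat : Int) = j by omega] at this
lemma stream_flow_le {m n l : Nat} {e : Int -> Cell} (he : IsStreamEnum m n e l) : l ≤ m ∧ l ≤ n := by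
  have : ∀ k : Nat, (e 0).1 + k ≤ (e k).1 ∧ (e 0).2 + k ≤ (e k).2 := by
    intro k
    induction k with
    | zero => simp
    | succ k ih =>
      have := he.2.1 k
      simp only [NW] at this; push_cast; omega
  have h1 := this l
  have h2 := he.2.2 0
  rw [zero_add] at h2
  rw [<- h2] at h1
  simp only [tauC] at h1; omega
lemma Ch.snoc {S : Set Cell} : ∀ {k : Nat} {a b : Cell}, Ch S (k + 1) a b ->
    ∃ c, Ch S k a c ∧ NW c b ∧ b ∈ S := by
  intro k
  induction k with
  | zero => rintro a b ⟨h1, c, h2, h3, rfl⟩; exact ⟨a, ⟨h1, rfl⟩, h2, h3⟩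
  | succ k ih =>
    rintro a b ⟨h1, c, h2, h3⟩
    obtain ⟨d, h4, h5⟩ := ih h3
    exact ⟨d, ⟨h1, c, h2, h4⟩, h5⟩
lemma Ch.nw {S : Set Cell} {k : Nat} {a b : Cell} (h : Ch S k a b) : a = b ∨ NW a b := by
  induction k generalizing a with
  | zero => exact Or.inl h.2
  | succ k ih =>
    obtain ⟨_, c, h1, h2⟩ := h
    rcases ih h2 with rfl | h3
    · exact Or.inr h1
    · exact Or.inr (NW_trans h1 h3)
lemma mem_chainSet {A : Mat} {e : Int -> Cell} {c : Cell} {v : Int} :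
    v ∈ chainSet A e c ↔ ∃ (idx : Int) (k : Nat), Ch (supp A) k (e idx) c ∧ v = idx + k := by
  constructor
  · rintro ⟨k, ch, h0, h1, h2, idx, h3, rfl⟩
    refine ⟨idx, k, ?_, rfl⟩
    have := Ch.ofFun (S := supp A) (k := k) (p := fun i => ch (k - i)) (fun i _ => h1 _ (by omega))
      (fun i hi => by
        have := h2 (k - (i + 1)) (by omega)
        rwa [show k - (i + 1) + 1 = k - i by omega] at this) (Nat.zero_le k) le_rfl
    simpa [h0, h3] using this
  · rintro ⟨idx, k, h, rfl⟩
    obtain ⟨p, h0, h1, h2, h3⟩ := h.toFun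
    refine ⟨k, fun i => p (k - i), by simpa using h1, fun i _ => h2 _ (by omega), ?_, idx, by simp [h0], rfl⟩
    intro i hi
    have := h3 (k - (i + 1)) (by omega)
    rwa [show k - (i + 1) + 1 = k - i by omega] at this
structure CN (m n : Nat) (l : Int) (S : Set Cell) (e : Int -> Cell) (d : Cell -> Int) : Prop where
  pn : PN m n l S d
  tight : Tight S d e
  eqv : ∀ a k, sh m n a (e k) = e (k + a * l)
  gen : ∀ Pr : Cell -> Prop, (∀ k, Pr (e k)) ->
    (∀ c ∈ S, ∀ c' ∈ S, Pr c -> NW c c' -> d c' = d c + 1 -> Pr c') -> ∀ c ∈ S, Pr c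
theorem CN_of {m n l : Nat} {A : Mat} (hA : IsGAP m n A) (hn : 0 < n) {e : Int -> Cell}
    (he : IsStreamEnum m n e l) (heS : ∀ k, e k ∈ supp A) {d : Cell -> Int}
    (hd : IsChannelNumbering A e d) : CN m n l (supp A) e d := by
  have P := GAP_per hA
  have hl : (0 : Int) < l := by exact_mod_cast he.1
  have ub : ∀ c ∈ supp A, ∀ idx k, Ch (supp A) k (e idx) c -> idx + k ≤ d c := fun c hc idx k h =>
    (hd c hc).2 (mem_chainSet.2 ⟨idx, k, h, rfl⟩)
  have at' : ∀ c ∈ supp A, ∃ idx k, Ch (supp A) k (e idx) c ∧ d c = idx + k := fun c hc =>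
    mem_chainSet.1 (hd c hc).1
  have mono : ∀ c ∈ supp A, ∀ c' ∈ supp A, NW c c' -> d c < d c' := by
    intro c hc c' hc' h
    obtain ⟨idx, k, h1, h2⟩ := at' c hc
    have := ub c' hc' idx (k + 1) (h1.trans (Ch.one hc hc' h))
    push_cast at this; omega
  have per1 : ∀ a c, c ∈ supp A -> d c + a * l ≤ d (sh m n a c) := by
    intro a c hc
    obtain ⟨idx, k, h1, h2⟩ := at' c hc
    have := h1.shf (P.mem a)
    rw [stream_sh he] at this
    have := ub _ (P.mem _ _ hc) _ _ this
    omega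
  have per : ∀ a c, c ∈ supp A -> d (sh m n a c) = d c + a * l := by
    intro a c hc
    apply le_antisymm _ (per1 a c hc)
    have := per1 (-a) _ (P.mem a c hc)
    rw [sh_neg] at this; linarith
  have dmono : ∀ (k : Int) (j : Nat), d (e k) + j ≤ d (e (k + j)) := by
    intro k j
    induction j with
    | zero => simp
    | succ j ih =>
      have := mono _ (heS (k + j)) _ (heS (k + j + 1)) (he.2.1 _)
      push_cast; rw [<- add_assoc, <- add_assoc]; omega
  have chd : ∀ k c c', Ch (supp A) k c c' -> d c + k ≤ d c' := by
    intro k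
    induction k with
    | zero => rintro c c' ⟨_, rfl⟩; simp
    | succ k ih =>
      rintro c c' ⟨h1, c'', h2, h3⟩
      have := ih _ _ h3
      have := mono _ h1 _ h3.left h2
      push_cast; omega
  have dlow : ∀ k, k ≤ d (e k) := by
    intro k
    have := ub _ (heS k) k 0 ⟨heS k, rfl⟩
    simpa using this
  have eps : ∀ k : Int, d (e k) - k = d (e 0) := by
    have mon : ∀ i j : Int, i ≤ j -> d (e i) - i ≤ d (e j) - j := by
      intro i j hij
      have := dmono i (j - i).toNat
      rw [show i + ((j - i).toNat : Int) = j by omega] at this; omega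
    have pe : ∀ i a : Int, d (e (i + a * l)) - (i + a * l) = d (e i) - i := by
      intro i a
      rw [<- stream_sh he, per a _ (heS i)]; ring
    intro k
    have h1 := mon k (0 + |k| * l) (by nlinarith [abs_nonneg k, le_abs_self k])
    have h2 := mon (0 + -|k| * l) k (by nlinarith [abs_nonneg k, neg_abs_le k])
    rw [pe] at h1 h2; omega
  have tight0 : ∀ k, d (e k) = k := by
    obtain ⟨idx, k, h1, h2⟩ := at' _ (heS 0)
    have h3 := chd _ _ _ h1
    have h4 := eps idx
    have h5 := dlow 0
    intro k'
    have := eps k'; omega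
  have pn : PN m n l (supp A) d := by
    refine ⟨⟨e 0, heS 0⟩, hl, P.mem, per, mono, ?_, P.fin hn hl per⟩
    intro c hc
    obtain ⟨idx, k, h1, h2⟩ := at' c hc
    cases k with
    | zero =>
      obtain ⟨_, rfl⟩ := h1
      refine ⟨e (idx - 1), heS _, stream_mono he (by omega), by rw [tight0, tight0]⟩
    | succ k =>
      obtain ⟨c', h3, h4, h5⟩ := h1.snoc
      refine ⟨c', h3.right, h4, ?_⟩
      have := ub c' h3.right _ _ h3
      have := mono c' h3.right c hc h4
      push_cast at h2; omega
  refine ⟨pn, fun k => ⟨heS k, tight0 k, he.2.1 k⟩, stream_sh he, ?_⟩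
  intro Pr h0 hs c hc
  obtain ⟨idx, k, h1, h2⟩ := at' c hc
  induction k generalizing c with
  | zero => obtain ⟨_, rfl⟩ := h1; exact h0 idx
  | succ k ih =>
    obtain ⟨c', h3, h4, h5⟩ := h1.snoc
    have h6 := ub c' h3.right _ _ h3
    have h7 := mono c' h3.right c hc h4
    push_cast at h2
    exact hs c' h3.right c hc (ih c' h3.right h3 (by omega)) h4 (by omega)
theorem CN_exists {m n l : Nat} (hm : 0 < m) (hn : 0 < n) {A : Mat} (hA : IsGAP m n A) {e : Int -> Cell}
    (he : IsStreamEnum m n e l) (heS : ∀ k, e k ∈ supp A)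
    (hmax : ∀ e' l', IsStreamEnum m n e' l' -> (∀ k, e' k ∈ supp A) -> l' ≤ l) :
    ∃ d, IsChannelNumbering A e d := by
  have P := GAP_per hA
  have hm' : (1 : Int) ≤ m := by exact_mod_cast hm
  have hn' : (1 : Int) ≤ n := by exact_mod_cast hn
  have below : ∀ c : Cell, ∃ k, NW (e k) c := by
    intro c
    set b := |c.1 - (e 0).1| + |c.2 - (e 0).2| + 1 with hb
    refine ⟨0 + -b * l, ?_⟩
    rw [<- stream_sh he]
    have := neg_abs_le (c.1 - (e 0).1)
    have := neg_abs_le (c.2 - (e 0).2)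
    have := abs_nonneg (c.1 - (e 0).1)
    have := abs_nonneg (c.2 - (e 0).2)
    constructor <;> simp only [sh] <;> nlinarith
  have above : ∀ c : Cell, ∃ k, NW c (e k) := by
    intro c
    set b := |c.1 - (e 0).1| + |c.2 - (e 0).2| + 1 with hb
    refine ⟨0 + b * l, ?_⟩
    rw [<- stream_sh he]
    have := le_abs_self (c.1 - (e 0).1)
    have := le_abs_self (c.2 - (e 0).2)
    have := abs_nonneg (c.1 - (e 0).1)
    have := abs_nonneg (c.2 - (e 0).2)
    constructor <;> simp only [sh] <;> nlinarith
  have : ∀ c, ∃ v, c ∈ supp A -> IsGreatest (chainSet A e c) v := by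
    intro c
    by_cases hc : c ∈ supp A
    · obtain ⟨y, hy⟩ := above c
      obtain ⟨x, hx⟩ := below c
      obtain ⟨v, h1, h2⟩ := Int.exists_greatest_of_bdd (P := fun v => v ∈ chainSet A e c) ⟨y, by
        intro z hz
        obtain ⟨idx, k, h1, rfl⟩ := mem_chainSet.1 hz
        have h2 := h1.trans (Ch.one hc (heS y) hy)
        rcases lt_or_ge y idx with h3 | h3
        · have h4 := stream_mono he h3
          rcases h2.nw with h5 | h5
          · rw [h5] at h4; simp [NW] at h4
          · simp only [NW] at h4 h5; omega
        · rw [show y = idx + (y - idx).toNat by omega] at h2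
          have := noExcess P.mem he heS hmax _ _ _ h2
          omega⟩ ⟨x + 1, mem_chainSet.2 ⟨x, 1, Ch.one (heS x) hc hx, by simp⟩⟩
      exact ⟨v, fun _ => ⟨h1, fun z hz => h2 z hz⟩⟩
    · exact ⟨0, fun h => absurd h hc⟩
  choose d hd using this
  exact ⟨d, hd⟩
lemma exists_max_stream {m n : Nat} (hm : 0 < m) (hn : 0 < n) {A : Mat} (hA : IsGAP m n A) (h0 : A ≠ 0) :
    ∃ e l, IsStreamEnum m n e l ∧ (∀ k, e k ∈ supp A) ∧
      ∀ e' l', IsStreamEnum m n e' l' -> (∀ k, e' k ∈ supp A) -> l' ≤ l := by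
  obtain ⟨c, hc⟩ : (supp A).Nonempty := by
    by_contra h
    apply h0
    funext i j
    by_contra h'
    exact h ⟨(i, j), h'⟩
  have P := GAP_per hA
  have h1 : ∃ e, IsStreamEnum m n e 1 ∧ ∀ k, e k ∈ supp A := by
    apply Ch.cyc P.mem one_pos (b := c)
    rw [tauC_eq]
    apply Ch.one hc (P.mem _ _ hc)
    constructor <;> simp [sh] <;> assumption
  obtain ⟨e, he, heS⟩ := h1
  have h2 := Nat.findGreatest_spec (P := fun l => ∃ e, IsStreamEnum m n e l ∧ ∀ k, e k ∈ supp A)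
    (m := 1) (n := m) hm ⟨e, he, heS⟩
  obtain ⟨e', h3, h4⟩ := h2
  refine ⟨e', _, h3, h4, fun e'' l' h5 h6 => ?_⟩
  exact Nat.le_findGreatest (P := fun l => ∃ e, IsStreamEnum m n e l ∧ ∀ k, e k ∈ supp A)
    (stream_flow_le h5).1 ⟨e'', h5, h6⟩
lemma stream_tight {m n l : Nat} {S : Set Cell} {d : Cell -> Int} (hl : 0 < l)
    (per : ∀ a, ∀ c ∈ S, d (sh m n a c) = d c + a * l)
    (mono : ∀ c ∈ S, ∀ c' ∈ S, NW c c' -> d c < d c') {e : Int -> Cell}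
    (he : IsStreamEnum m n e l) (heS : ∀ k, e k ∈ S) : ∃ r, Tight S d (fun k => e (k + r)) := by
  have hl : (0 : Int) < l := by exact_mod_cast hl
  have dmono : ∀ (k : Int) (j : Nat), d (e k) + j ≤ d (e (k + j)) := by
    intro k j
    induction j with
    | zero => simp
    | succ j ih =>
      have := mono _ (heS (k + j)) _ (heS (k + j + 1)) (he.2.1 _)
      push_cast; rw [<- add_assoc, <- add_assoc]; omega
  have eps : ∀ k : Int, d (e k) - k = d (e 0) := by
    have mon : ∀ i j : Int, i ≤ j -> d (e i) - i ≤ d (e j) - j := by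
      intro i j hij
      have := dmono i (j - i).toNat
      rw [show i + ((j - i).toNat : Int) = j by omega] at this; omega
    have pe : ∀ i a : Int, d (e (i + a * l)) - (i + a * l) = d (e i) - i := by
      intro i a
      rw [<- stream_sh he, per a _ (heS i)]; ring
    intro k
    have h1 := mon k (0 + |k| * l) (by nlinarith [abs_nonneg k, le_abs_self k])
    have h2 := mon (0 + -|k| * l) k (by nlinarith [abs_nonneg k, neg_abs_le k])
    rw [pe] at h1 h2; omega
  refine ⟨-d (e 0), fun k => ⟨heS _, ?_, ?_⟩⟩
  · have := eps (k + -d (e 0)); simp only; omega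
  · have := he.2.1 (k + -d (e 0))
    rwa [show k + -d (e 0) + 1 = k + 1 + -d (e 0) by ring] at this
lemma flow_le_of_mono {m n : Nat} {l : Int} {S : Set Cell} {d : Cell -> Int}
    (per : ∀ a, ∀ c ∈ S, d (sh m n a c) = d c + a * l)
    (mono : ∀ c ∈ S, ∀ c' ∈ S, NW c c' -> d c < d c') {e : Int -> Cell} {l' : Nat}
    (he : IsStreamEnum m n e l') (heS : ∀ k, e k ∈ S) : (l' : Int) ≤ l := by
  have dmono : ∀ (j : Nat), d (e 0) + j ≤ d (e j) := by
    intro j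
    induction j with
    | zero => simp
    | succ j ih =>
      have := mono _ (heS j) _ (heS (j + 1)) (he.2.1 _)
      push_cast; omega
  have h1 := dmono l'
  have h2 := per 1 _ (heS 0)
  rw [stream_sh he] at h2
  simp at h2; omega
lemma tight_stream {m n l : Nat} {S : Set Cell} {d : Cell -> Int} {e : Int -> Cell} (hl : 0 < l)
    (h : Tight S d e) (hq : ∀ a k, sh m n a (e k) = e (k + a * l)) : IsStreamEnum m n e l := by
  refine ⟨hl, fun k => (h k).2.2, fun k => ?_⟩
  rw [tauC_eq, hq]; simp
theorem SW_exists {m n : Nat} (hm : 0 < m) (hn : 0 < n) {A : Mat} (hA : IsGAP m n A) (h0 : A ≠ 0) :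
    ∃ e d, IsSWChannelEnum m n A e ∧ IsChannelNumbering A e d := by
  obtain ⟨e0, l, h1, h2, hmax⟩ := exists_max_stream hm hn hA h0
  obtain ⟨d0, hd0⟩ := CN_exists hm hn hA h1 h2 hmax
  have c0 := CN_of hA hn h1 h2 hd0
  obtain ⟨e, t1, t2, t3⟩ := river c0.pn
  have he : IsStreamEnum m n e l := tight_stream h1.1 t1 t2
  have heS : ∀ k, e k ∈ supp A := fun k => (t1 k).1
  obtain ⟨d, hd⟩ := CN_exists hm hn hA he heS hmax
  have hch : ∀ (S : Set Cell) (l' : Nat), IsStream m n S l' -> S ⊆ supp A -> l' ≤ l := by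
    rintro S l' ⟨e', h3, rfl⟩ h4
    exact hmax _ _ h3 (fun k => h4 ⟨k, rfl⟩)
  refine ⟨e, d, ⟨⟨l, he⟩, ⟨l, ⟨e, he, rfl⟩, ?_, hch⟩, ?_⟩, hd⟩
  · rintro _ ⟨k, rfl⟩; exact heS k
  · rintro C ⟨l', ⟨e', h3, rfl⟩, h4, h5⟩
    have hll : l' = l := le_antisymm (hch _ _ ⟨e', h3, rfl⟩ h4)
      (h5 _ _ ⟨e, he, rfl⟩ (by rintro _ ⟨k, rfl⟩; exact heS k))
    subst hll
    obtain ⟨r, hr⟩ := stream_tight h1.1 c0.pn.per c0.pn.mono h3 (fun k => h4 ⟨k, rfl⟩)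
    rintro _ ⟨k, rfl⟩
    exact ⟨heS k, _, ⟨k + r, rfl⟩, t3 _ hr k⟩
theorem SW_formal {m n : Nat} (hn : 0 < n) {A : Mat} (hA : IsGAP m n A) {e : Int -> Cell} {d : Cell -> Int}
    (he : IsSWChannelEnum m n A e) (hd : IsChannelNumbering A e d) :
    ∃ l : Nat, IsStreamEnum m n e l ∧ CN m n l (supp A) e d ∧
      ∀ e', Tight (supp A) d e' -> ∀ k, neLe (e k) (e' k) := by
  obtain ⟨⟨l, h1⟩, hch, hsw⟩ := he
  have heS : ∀ k, e k ∈ supp A := by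
    obtain ⟨_, _, h, _⟩ := hch
    exact fun k => h ⟨k, rfl⟩
  have c := CN_of hA hn h1 heS hd
  refine ⟨l, h1, c, ?_⟩
  have hlpos := c.pn.lpos
  have key : ∀ e', Tight (supp A) d e' -> (∀ a k, sh m n a (e' k) = e' (k + a * l)) ->
      ∀ k, neLe (e k) (e' k) := by
    intro e' t1 t2 k
    have hs : IsStreamEnum m n e' l := tight_stream h1.1 t1 t2
    have hsS : Set.range e' ⊆ supp A := by rintro _ ⟨k, rfl⟩; exact (t1 k).1
    have hch' : IsChannel m n A (Set.range e') := by
      refine ⟨l, ⟨e', hs, rfl⟩, hsS, fun S l' h3 h4 => ?_⟩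
      obtain ⟨e'', h5, rfl⟩ := h3
      have := flow_le_of_mono c.pn.per c.pn.mono h5 (fun k => h4 ⟨k, rfl⟩)
      omega
    obtain ⟨_, _, ⟨j, rfl⟩, h3⟩ := hsw _ hch' ⟨k, rfl⟩
    have nc : neLe (e k) (e' k) ∨ neLe (e' k) (e k) := by
      apply neLe_total_of
      · intro h; have := c.pn.mono _ (heS k) _ (t1 k).1 h
        rw [(c.tight k).2.1, (t1 k).2.1] at this; omega
      · intro h; have := c.pn.mono _ (t1 k).1 _ (heS k) h
        rw [(c.tight k).2.1, (t1 k).2.1] at this; omega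
    rcases lt_trichotomy j k with hj | rfl | hj
    · have := t1.mono hj
      rcases nc with h | h
      · exact h
      · simp only [neLe, NW] at *; omega
    · exact h3
    · have := t1.mono hj
      rcases nc with h | h
      · exact h
      · simp only [neLe, NW] at *; omega
  obtain ⟨e1, t1, t2, t3⟩ := river c.pn
  intro e' he' k
  exact neLe_trans (key e1 t1 t2 k) (t3 e' he' k)
end
section
structure Hgt (m n : Nat) (l : Int) (D : Int -> Int -> Int) (X Y : Int -> Int) : Prop where
  lpos : 0 < l
  row : ∀ i j, D (i - 1) j ≤ D i j ∧ D i j ≤ D (i - 1) j + 1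
  col : ∀ i j, D i (j - 1) ≤ D i j ∧ D i j ≤ D i (j - 1) + 1
  per : ∀ a i j, D (i + a * m) (j + a * n) = D i j + a * l
  hX : ∃ N : Int, ∀ i j, n * i + N ≤ m * j -> D i j = X i
  hY : ∃ N : Int, ∀ i j, m * j + N ≤ n * i -> D i j = Y j
def dD (D : Int -> Int -> Int) : Cell -> Int := fun c => D c.1 c.2
def FR (A : Mat) (D : Int -> Int -> Int) : Prop := ∀ i j,
  (A i j ≠ 0 -> D i j = D (i - 1) (j - 1) + 1) ∧ (A i j = 0 -> D i j = max (D (i - 1) j) (D i (j - 1)))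
def BR (B : Mat) (D : Int -> Int -> Int) : Prop := ∀ i j,
  (B i j ≠ 0 -> D (i - 1) (j - 1) = D i j - 1) ∧
  (B i j = 0 -> D (i - 1) (j - 1) = min (D (i - 1) j) (D i (j - 1)))
def FL (A B : Mat) (D : Int -> Int -> Int) : Prop := ∀ i j,
  (B i j : Int) = A i j - (D i j - D (i - 1) j - D i (j - 1) + D (i - 1) (j - 1))
section
variable {m n : Nat} {l : Int} {D : Int -> Int -> Int} {X Y : Int -> Int} {A B : Mat}
lemma FR_BR (H : Hgt m n l D X Y) (h : FR A D) (hf : FL A B D) : BR B D := by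
  intro i j
  have h1 := h i j
  have h2 := hf i j
  have h3 := H.row i j
  have h4 := H.col i j
  have h5 := H.row i (j - 1)
  have h6 := H.col (i - 1) j
  rcases Nat.eq_zero_or_pos (A i j) with h7 | h7
  · have := h1.2 h7; omega
  · have := h1.1 (by omega); omega
lemma BR_FR (H : Hgt m n l D X Y) (h : BR B D) (hf : FL A B D) : FR A D := by
  intro i j
  have h1 := h i j
  have h2 := hf i j
  have h3 := H.row i j
  have h4 := H.col i j
  have h5 := H.row i (j - 1)
  have h6 := H.col (i - 1) j
  rcases Nat.eq_zero_or_pos (B i j) with h7 | h7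
  · have := h1.2 h7; omega
  · have := h1.1 (by omega); omega
lemma FL_exists (H : Hgt m n l D X Y) (h : FR A D) : ∃ B, FL A B D := by
  refine ⟨fun i j => (A i j - (D i j - D (i - 1) j - D i (j - 1) + D (i - 1) (j - 1))).toNat, ?_⟩
  intro i j
  have h1 := h i j
  have h3 := H.row i j
  have h4 := H.col i j
  have h5 := H.row i (j - 1)
  have h6 := H.col (i - 1) j
  rcases Nat.eq_zero_or_pos (A i j) with h7 | h7
  · have := h1.2 h7; simp only; omega
  · have := h1.1 (by omega); simp only; omega
lemma FL_exists' (H : Hgt m n l D X Y) (h : BR B D) : ∃ A, FL A B D := by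
  refine ⟨fun i j => (B i j + (D i j - D (i - 1) j - D i (j - 1) + D (i - 1) (j - 1))).toNat, ?_⟩
  intro i j
  have h1 := h i j
  have h3 := H.row i j
  have h4 := H.col i j
  have h5 := H.row i (j - 1)
  have h6 := H.col (i - 1) j
  rcases Nat.eq_zero_or_pos (B i j) with h7 | h7
  · have := h1.2 h7; simp only; omega
  · have := h1.1 (by omega); simp only; omega
lemma mono_of_step {f : Int -> Int} (h : ∀ x, f (x - 1) ≤ f x) {a b : Int} (hab : a ≤ b) : f a ≤ f b := by
  induction b, hab using Int.le_induction with
  | base => exact le_rfl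
  | succ b _ ih => have := h (b + 1); simp at this; omega
lemma step_find {f : Int -> Int} (h : ∀ x, f (x - 1) ≤ f x ∧ f x ≤ f (x - 1) + 1) {a b k : Int}
    (h1 : f a ≤ k) (h2 : k < f b) : ∃ x, a ≤ x ∧ x < b ∧ f x = k ∧ f (x + 1) = k + 1 := by
  have hab : a ≤ b := by
    by_contra! hh
    have := mono_of_step (fun x => (h x).1) hh.le; omega
  induction b, hab using Int.le_induction with
  | base => omega
  | succ b hb ih =>
    rcases lt_or_ge k (f b) with h3 | h3
    · obtain ⟨x, q1, q2, q3⟩ := ih h3; exact ⟨x, q1, by omega, q3⟩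
    · have := h (b + 1); simp at this
      exact ⟨b, hb, by omega, by omega, by omega⟩
lemma Hgt.monoR (H : Hgt m n l D X Y) {i i' : Int} (j : Int) (h : i ≤ i') : D i j ≤ D i' j :=
  mono_of_step (f := fun i => D i j) (fun x => (H.row x j).1) h
lemma Hgt.monoC (H : Hgt m n l D X Y) (i : Int) {j j' : Int} (h : j ≤ j') : D i j ≤ D i j' :=
  mono_of_step (f := fun j => D i j) (fun x => (H.col i x).1) h
lemma Hgt.mono (H : Hgt m n l D X Y) {i i' j j' : Int} (h : i ≤ i') (h' : j ≤ j') : D i j ≤ D i' j' :=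
  (H.monoR j h).trans (H.monoC i' h')
lemma Hgt.findE (H : Hgt m n l D X Y) {i a b k : Int} (h1 : D i a ≤ k) (h2 : k < D i b) :
    ∃ j, a ≤ j ∧ j < b ∧ D i j = k ∧ D i (j + 1) = k + 1 :=
  step_find (f := fun j => D i j) (fun x => H.col i x) h1 h2
lemma Hgt.findS (H : Hgt m n l D X Y) {j a b k : Int} (h1 : D a j ≤ k) (h2 : k < D b j) :
    ∃ i, a ≤ i ∧ i < b ∧ D i j = k ∧ D (i + 1) j = k + 1 :=
  step_find (f := fun i => D i j) (fun x => H.row x j) h1 h2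
lemma far (hm : 0 < m) (n : Nat) (i N : Int) : ∃ J : Int, ∀ j, J ≤ j -> n * i + N ≤ m * j := by
  have hm' : (1 : Int) ≤ m := by exact_mod_cast hm
  refine ⟨|n * i + N|, fun j hj => ?_⟩
  have := le_abs_self (n * i + N)
  have := abs_nonneg (n * i + N)
  nlinarith
lemma Hgt.X_at (H : Hgt m n l D X Y) (hm : 0 < m) (i : Int) : ∃ J, ∀ j, J ≤ j -> D i j = X i := by
  obtain ⟨N, hN⟩ := H.hX
  obtain ⟨J, hJ⟩ := far hm n i N
  exact ⟨J, fun j hj => hN i j (hJ j hj)⟩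
lemma Hgt.Y_at (H : Hgt m n l D X Y) (hn : 0 < n) (j : Int) : ∃ I, ∀ i, I ≤ i -> D i j = Y j := by
  obtain ⟨N, hN⟩ := H.hY
  obtain ⟨J, hJ⟩ := far hn m j N
  exact ⟨J, fun i hi => hN i j (hJ i hi)⟩
lemma Hgt.le_X (H : Hgt m n l D X Y) (hm : 0 < m) (i j : Int) : D i j ≤ X i := by
  obtain ⟨J, hJ⟩ := H.X_at hm i
  rw [<- hJ (max J j) (le_max_left _ _)]
  exact H.monoC i (le_max_right _ _)
lemma Hgt.le_Y (H : Hgt m n l D X Y) (hn : 0 < n) (i j : Int) : D i j ≤ Y j := by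
  obtain ⟨J, hJ⟩ := H.Y_at hn j
  rw [<- hJ (max J i) (le_max_left _ _)]
  exact H.monoR j (le_max_right _ _)
lemma Hgt.X_per (H : Hgt m n l D X Y) (hm : 0 < m) (a i : Int) : X (i + a * m) = X i + a * l := by
  obtain ⟨J, hJ⟩ := H.X_at hm i
  obtain ⟨J', hJ'⟩ := H.X_at hm (i + a * m)
  rw [<- hJ (max J (J' - a * n)) (le_max_left _ _), <- H.per, hJ']
  have := le_max_right J (J' - a * n); omega
lemma Hgt.Y_per (H : Hgt m n l D X Y) (hn : 0 < n) (a i : Int) : Y (i + a * n) = Y i + a * l := by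
  obtain ⟨J, hJ⟩ := H.Y_at hn i
  obtain ⟨J', hJ'⟩ := H.Y_at hn (i + a * n)
  rw [<- hJ (max J (J' - a * m)) (le_max_left _ _), <- H.per, hJ']
  have := le_max_right J (J' - a * m); omega
lemma Hgt.X_step (H : Hgt m n l D X Y) (hm : 0 < m) (i : Int) : X (i - 1) ≤ X i ∧ X i ≤ X (i - 1) + 1 := by
  obtain ⟨J, hJ⟩ := H.X_at hm i
  obtain ⟨J', hJ'⟩ := H.X_at hm (i - 1)
  rw [<- hJ (max J J') (le_max_left _ _), <- hJ' (max J J') (le_max_right _ _)]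
  exact H.row _ _
lemma Hgt.Y_step (H : Hgt m n l D X Y) (hn : 0 < n) (i : Int) : Y (i - 1) ≤ Y i ∧ Y i ≤ Y (i - 1) + 1 := by
  obtain ⟨J, hJ⟩ := H.Y_at hn i
  obtain ⟨J', hJ'⟩ := H.Y_at hn (i - 1)
  rw [<- hJ (max J J') (le_max_left _ _), <- hJ' (max J J') (le_max_right _ _)]
  exact H.col _ _
lemma low_of {f : Int -> Int} {m : Nat} (hl : 0 < l) (hs : ∀ x, f (x - 1) ≤ f x)
    (hp : ∀ a i, f (i + a * m) = f i + a * l) (k : Int) : ∃ i0, ∀ i, k ≤ f i -> i0 < i := by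
  refine ⟨0 + -(|k - f 0| + 1) * m, fun i hi => ?_⟩
  by_contra! h
  have := mono_of_step hs h
  rw [hp] at this
  nlinarith [neg_abs_le (k - f 0), abs_nonneg (k - f 0)]
lemma Hgt.lowR (H : Hgt m n l D X Y) (hm : 0 < m) (k : Int) : ∃ i0, ∀ i j, k ≤ D i j -> i0 < i := by
  obtain ⟨i0, h⟩ := low_of H.lpos (fun x => (H.X_step hm x).1) (H.X_per hm) k
  exact ⟨i0, fun i j hk => h i (hk.trans (H.le_X hm i j))⟩
lemma Hgt.lowC (H : Hgt m n l D X Y) (hn : 0 < n) (k : Int) : ∃ i0, ∀ i j, k ≤ D i j -> i0 < j := by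
  obtain ⟨i0, h⟩ := low_of H.lpos (fun x => (H.Y_step hn x).1) (H.Y_per hn) k
  exact ⟨i0, fun i j hk => h j (hk.trans (H.le_Y hn i j))⟩
lemma FR_attain (H : Hgt m n l D X Y) (hm : 0 < m) (hn : 0 < n) (h : FR A D) (i j : Int) :
    ∃ c ∈ supp A, c.1 ≤ i ∧ c.2 ≤ j ∧ D c.1 c.2 = D i j := by
  obtain ⟨i0, hi0⟩ := H.lowR hm (D i j)
  obtain ⟨j0, hj0⟩ := H.lowC hn (D i j)
  have : ∀ (N : Nat) (i' j' : Int), (i' - i0) + (j' - j0) ≤ N -> D i' j' = D i j ->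
      ∃ c ∈ supp A, c.1 ≤ i' ∧ c.2 ≤ j' ∧ D c.1 c.2 = D i j := by
    intro N
    induction N with
    | zero =>
      intro i' j' h1 h2
      have := hi0 i' j' h2.ge
      have := hj0 i' j' h2.ge
      push_cast at h1; omega
    | succ N ih =>
      intro i' j' h1 h2
      by_cases h3 : A i' j' = 0
      · have h4 := (h i' j').2 h3
        rcases max_choice (D (i' - 1) j') (D i' (j' - 1)) with h5 | h5
        · obtain ⟨c, q1, q2, q3, q4⟩ := ih (i' - 1) j' (by push_cast at h1; omega) (by omega)
          exact ⟨c, q1, by omega, q3, q4⟩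
        · obtain ⟨c, q1, q2, q3, q4⟩ := ih i' (j' - 1) (by push_cast at h1; omega) (by omega)
          exact ⟨c, q1, by omega, by omega, q4⟩
      · exact ⟨(i', j'), h3, le_rfl, le_rfl, h2⟩
  exact this ((i - i0) + (j - j0)).toNat i j (by omega) rfl
lemma Hgt.dper (H : Hgt m n l D X Y) (a : Int) (c : Cell) : dD D (sh m n a c) = dD D c + a * l :=
  H.per _ _ _
lemma FR_PN (H : Hgt m n l D X Y) (hm : 0 < m) (hn : 0 < n) (hA : IsGAP m n A) (h : FR A D) :
    PN m n l (supp A) (dD D) := by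
  refine ⟨?_, H.lpos, (GAP_per hA).mem, fun a c _ => H.dper a c, ?_, ?_,
    (GAP_per hA).fin hn H.lpos (fun a c _ => H.dper a c)⟩
  · obtain ⟨c, hc, _⟩ := FR_attain H hm hn h 0 0; exact ⟨c, hc⟩
  · intro c _ c' hc' hnw
    have := (h c'.1 c'.2).1 hc'
    have := H.mono (show c.1 ≤ c'.1 - 1 by have := hnw.1; omega) (show c.2 ≤ c'.2 - 1 by have := hnw.2; omega)
    simp only [dD]; omega
  · intro c hc
    obtain ⟨c', h1, h2, h3, h4⟩ := FR_attain H hm hn h (c.1 - 1) (c.2 - 1)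
    refine ⟨c', h1, ⟨by omega, by omega⟩, ?_⟩
    have := (h c.1 c.2).1 hc
    simp only [dD]; omega
theorem Ext (hm : 0 < m) (hn : 0 < n) (hA : IsGAP m n A) {d : Cell -> Int} (hd : PN m n l (supp A) d) :
    ∃ D X Y, Hgt m n l D X Y ∧ FR A D ∧ ∀ c ∈ supp A, d c = D c.1 c.2 := by
  have P := GAP_per hA
  obtain ⟨N, hN0, hN⟩ := P.band hn
  have hm' : (1 : Int) ≤ m := by exact_mod_cast hm
  have hn' : (1 : Int) ≤ n := by exact_mod_cast hn
  have gex : ∀ i j : Int, ∃ v, IsGreatest {v | ∃ c ∈ supp A, c.1 ≤ i ∧ c.2 ≤ j ∧ d c = v} v := by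
    intro i j
    obtain ⟨c, hc⟩ := hd.ne
    set b := |i - c.1| + |j - c.2| + 1 with hb
    have a1 := neg_abs_le (i - c.1)
    have a2 := neg_abs_le (j - c.2)
    have a3 := le_abs_self (i - c.1)
    have a4 := le_abs_self (j - c.2)
    have a5 := abs_nonneg (i - c.1)
    have a6 := abs_nonneg (j - c.2)
    obtain ⟨v, h1, h2⟩ := Int.exists_greatest_of_bdd
      (P := fun v => ∃ c ∈ supp A, c.1 ≤ i ∧ c.2 ≤ j ∧ d c = v) ⟨d (sh m n b c), by
        rintro z ⟨c', h1, h2, h3, rfl⟩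
        apply le_of_lt
        apply hd.mono _ h1 _ (P.mem _ _ hc)
        constructor <;> simp only [sh] <;> nlinarith⟩
      ⟨_, sh m n (-b) c, P.mem _ _ hc, by simp only [sh]; nlinarith, by simp only [sh]; nlinarith, rfl⟩
    exact ⟨v, h1, fun z hz => h2 z hz⟩
  choose D hD using gex
  have ub : ∀ i j, ∀ c ∈ supp A, c.1 ≤ i -> c.2 ≤ j -> d c ≤ D i j := fun i j c h1 h2 h3 =>
    (hD i j).2 ⟨c, h1, h2, h3, rfl⟩
  have att : ∀ i j, ∃ c ∈ supp A, c.1 ≤ i ∧ c.2 ≤ j ∧ d c = D i j := fun i j => (hD i j).1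
  have bandU : ∀ c ∈ supp A, m * c.2 ≤ n * c.1 + N ∧ n * c.1 ≤ m * c.2 + N := by
    intro c hc; have := abs_le.1 (hN c hc); constructor <;> linarith
  have fX : ∀ i j j' : Int, n * i + N ≤ m * j -> D i j' ≤ D i j := by
    intro i j j' h
    obtain ⟨c, h1, h2, h3, h4⟩ := att i j'
    rw [<- h4]
    apply ub _ _ _ h1 h2
    have := (bandU c h1).1
    nlinarith
  have fY : ∀ i j i' : Int, m * j + N ≤ n * i -> D i' j ≤ D i j := by
    intro i j i' h
    obtain ⟨c, h1, h2, h3, h4⟩ := att i' j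
    rw [<- h4]
    apply ub _ _ _ h1 _ h3
    have := (bandU c h1).2
    nlinarith
  have farX := fun i => far hm n i N
  have farY := fun j => far hn m j N
  choose JX hJX using farX
  choose JY hJY using farY
  have hs : ∀ c ∈ supp A, d c = D c.1 c.2 := by
    intro c hc
    apply le_antisymm (ub _ _ _ hc le_rfl le_rfl)
    obtain ⟨c', h1, h2, h3, h4⟩ := att c.1 c.2
    obtain ⟨c'', g1, g2, g3⟩ := hd.pred c' h1
    have := hd.mono _ g1 _ hc ⟨by have := g2.1; omega, by have := g2.2; omega⟩
    omega
  refine ⟨D, fun i => D i (JX i), fun j => D (JY j) j, ⟨hd.lpos, ?_, ?_, ?_, ⟨N, ?_⟩, ⟨N, ?_⟩⟩, ?_, hs⟩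
  · intro i j
    constructor
    · obtain ⟨c, h1, h2, h3, h4⟩ := att (i - 1) j
      rw [<- h4]; exact ub _ _ _ h1 (by omega) h3
    · obtain ⟨c, h1, h2, h3, h4⟩ := att i j
      obtain ⟨c', g1, g2, g3⟩ := hd.pred c h1
      have := ub (i - 1) j c' g1 (by have := g2.1; omega) (by have := g2.2; omega)
      omega
  · intro i j
    constructor
    · obtain ⟨c, h1, h2, h3, h4⟩ := att i (j - 1)
      rw [<- h4]; exact ub _ _ _ h1 (by omega) (by omega)
    · obtain ⟨c, h1, h2, h3, h4⟩ := att i j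
      obtain ⟨c', g1, g2, g3⟩ := hd.pred c h1
      have := ub i (j - 1) c' g1 (by have := g2.1; omega) (by have := g2.2; omega)
      omega
  · have key : ∀ a i j, D i j + a * l ≤ D (i + a * m) (j + a * n) := by
      intro a i j
      obtain ⟨c, h1, h2, h3, h4⟩ := att i j
      rw [<- h4, <- hd.per a c h1]
      exact ub _ _ _ (P.mem _ _ h1) (by simp only [sh]; omega) (by simp only [sh]; omega)
    intro a i j
    apply le_antisymm _ (key a i j)
    have := key (-a) (i + a * m) (j + a * n)
    simp only [neg_mul, add_neg_cancel_right] at this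
    linarith
  · intro i j h
    exact le_antisymm (fX i _ _ (hJX i _ le_rfl)) (fX i _ _ h)
  · intro i j h
    exact le_antisymm (fY _ j _ (hJY j _ le_rfl)) (fY _ j _ h)
  · intro i j
    constructor
    · intro h
      have h0 := hs (i, j) h
      simp only at h0
      rw [<- h0]
      apply le_antisymm
      · obtain ⟨c', g1, g2, g3⟩ := hd.pred (i, j) h
        have := ub (i - 1) (j - 1) c' g1 (by have := g2.1; simp at this; omega) (by have := g2.2; simp at this; omega)
        omega
      · obtain ⟨c, h1, h2, h3, h4⟩ := att (i - 1) (j - 1)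
        have := hd.mono c h1 (i, j) h ⟨by simp; omega, by simp; omega⟩
        omega
    · intro h
      apply le_antisymm
      · obtain ⟨c, h1, h2, h3, h4⟩ := att i j
        rw [<- h4]
        by_cases h5 : c.1 = i
        · have h6 : c.2 ≠ j := by
            rintro h6; apply h1; rw [h5, h6]; exact h
          exact le_max_of_le_right (ub _ _ _ h1 h2 (by omega))
        · exact le_max_of_le_left (ub _ _ _ h1 (by omega) h3)
      · apply max_le
        · obtain ⟨c, h1, h2, h3, h4⟩ := att (i - 1) j
          rw [<- h4]; exact ub _ _ _ h1 (by omega) h3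
        · obtain ⟨c, h1, h2, h3, h4⟩ := att i (j - 1)
          rw [<- h4]; exact ub _ _ _ h1 h2 (by omega)
lemma Hgt.delta (H : Hgt m n l D X Y) (hm : 0 < m) (hn : 0 < n) (j : Int) : ∃ M : Int, ∀ i, (i < -M ∨ M < i) ->
    D i j - D (i - 1) j - D i (j - 1) + D (i - 1) (j - 1) = 0 := by
  obtain ⟨N, hN⟩ := H.hX
  obtain ⟨I, hI⟩ := H.Y_at hn j
  obtain ⟨I', hI'⟩ := H.Y_at hn (j - 1)
  obtain ⟨K, hK⟩ := far hn m (-(j - 1)) N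
  refine ⟨|K| + |I| + |I'| + 1, ?_⟩
  have := le_abs_self K
  have := le_abs_self I
  have := le_abs_self I'
  have := abs_nonneg I
  have := abs_nonneg I'
  have := abs_nonneg K
  have hm' : (1 : Int) ≤ m := by exact_mod_cast hm
  have hn' : (1 : Int) ≤ n := by exact_mod_cast hn
  rintro i (hi | hi)
  · have h0 := hK (-i) (by omega)
    rw [hN i j (by nlinarith), hN (i - 1) j (by nlinarith), hN i (j - 1) (by nlinarith),
      hN (i - 1) (j - 1) (by nlinarith)]; ring
  · rw [hI i (by omega), hI (i - 1) (by omega), hI' i (by omega), hI' (i - 1) (by omega)]; ring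
lemma GAP_FL (H : Hgt m n l D X Y) (hm : 0 < m) (hn : 0 < n) (hf : FL A B D) :
    IsGAP m n A ↔ IsGAP m n B := by
  have per : ∀ i j, D (i + m) (j + n) = D i j + l := by
    intro i j; have := H.per 1 i j; simpa using this
  have hp : ∀ i j, (B (i + m) (j + n) : Int) - A (i + m) (j + n) = B i j - A i j := by
    intro i j
    have h1 := hf i j
    have h2 := hf (i + m) (j + n)
    rw [show i + (m : Int) - 1 = i - 1 + m by ring, show j + (n : Int) - 1 = j - 1 + n by ring,
      per, per, per, per] at h2
    omega
  have hfin : ∀ j, ∃ M : Int, ∀ i, (i < -M ∨ M < i) -> A i j = B i j := by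
    intro j
    obtain ⟨M, hM⟩ := H.delta hm hn j
    refine ⟨M, fun i hi => ?_⟩
    have := hf i j
    rw [hM i hi] at this; omega
  constructor
  · rintro ⟨h1, h2⟩
    refine ⟨fun i j => by have := hp i j; rw [h1] at this; omega, fun j => ?_⟩
    obtain ⟨M, hM⟩ := hfin j
    apply ((h2 j).union (Set.finite_Icc (-M) M)).subset
    intro i hi
    by_cases h : i ∈ Set.Icc (-M) M
    · exact Or.inr h
    · left; simp only [Set.mem_Icc, not_and_or, not_le] at h
      have := hM i h; show A i j ≠ 0; rw [this]; exact hi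
  · rintro ⟨h1, h2⟩
    refine ⟨fun i j => by have := hp i j; rw [h1] at this; omega, fun j => ?_⟩
    obtain ⟨M, hM⟩ := hfin j
    apply ((h2 j).union (Set.finite_Icc (-M) M)).subset
    intro i hi
    by_cases h : i ∈ Set.Icc (-M) M
    · exact Or.inr h
    · left; simp only [Set.mem_Icc, not_and_or, not_le] at h
      have := hM i h; show B i j ≠ 0; rw [<- this]; exact hi
lemma colSum_FL (H : Hgt m n l D X Y) (hm : 0 < m) (hn : 0 < n) (hA : IsGAP m n A) (hf : FL A B D) (j : Int) :
    (colSumA B j : Int) = colSumA A j - (Y j - Y (j - 1)) := by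
  have hB := (GAP_FL H hm hn hf).1 hA
  obtain ⟨N, hN⟩ := H.hX
  obtain ⟨I, hI⟩ := H.Y_at hn j
  obtain ⟨I', hI'⟩ := H.Y_at hn (j - 1)
  obtain ⟨K, hK⟩ := far hn m (-(j - 1)) N
  obtain ⟨M1, hM1⟩ := (hA.2 j).bddAbove
  obtain ⟨M2, hM2⟩ := (hA.2 j).bddBelow
  obtain ⟨M3, hM3⟩ := (hB.2 j).bddAbove
  obtain ⟨M4, hM4⟩ := (hB.2 j).bddBelow
  have hn' : (1 : Int) ≤ n := by exact_mod_cast hn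
  have hm' : (1 : Int) ≤ m := by exact_mod_cast hm
  set U := max (max I I') (max M1 M3) with hU
  set L := min (-|K|) (min M2 M4) - 1 with hL
  have gA : colSumA A j = ∑ i ∈ Finset.Ioc L U, A i j := by
    apply finsum_eq_sum_of_support_subset
    intro i hi
    have h1 := hM1 hi
    have h2 := hM2 hi
    simp only [Finset.coe_Ioc, Set.mem_Ioc]; omega
  have gB : colSumA B j = ∑ i ∈ Finset.Ioc L U, B i j := by
    apply finsum_eq_sum_of_support_subset
    intro i hi
    have h1 := hM3 hi
    have h2 := hM4 hi
    simp only [Finset.coe_Ioc, Set.mem_Ioc]; omega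
  have tel : ∀ U, L ≤ U -> ∑ i ∈ Finset.Ioc L U, (B i j : Int) = ∑ i ∈ Finset.Ioc L U, (A i j : Int) -
      ((D U j - D U (j - 1)) - (D L j - D L (j - 1))) := by
    intro U hU
    induction U, hU using Int.le_induction with
    | base => simp
    | succ U hU ih =>
      have e1 : Finset.Ioc L (U + 1) = insert (U + 1) (Finset.Ioc L U) := by
        ext x; simp only [Finset.mem_Ioc, Finset.mem_insert]; omega
      rw [e1, Finset.sum_insert (by simp), Finset.sum_insert (by simp), ih, hf (U + 1) j]
      simp only [add_sub_cancel_right]; ring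
  have hle : L ≤ U ∨ U < L := le_or_gt _ _
  have hLX : D L j = X L ∧ D L (j - 1) = X L := by
    have h0 := hK (-L) (by have := neg_abs_le K; have := le_abs_self K; omega)
    exact ⟨hN _ _ (by nlinarith), hN _ _ (by nlinarith)⟩
  rcases le_or_gt L U with h | h
  · have := tel U h
    rw [gA, gB]; push_cast
    rw [this, hI U (by omega), hI' U (by omega), hLX.1, hLX.2]; ring
  · rw [gA, gB, Finset.Ioc_eq_empty (by omega)]
    have e1 := hI L (by omega)
    have e2 := hI' L (by omega)
    rw [<- e1, <- e2, hLX.1, hLX.2]; simp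
noncomputable def Hsum (n : Nat) (A : Mat) : Nat := ∑ j ∈ Finset.range n, colSumA A j
lemma Hsum_FL (H : Hgt m n l D X Y) (hm : 0 < m) (hn : 0 < n) (hA : IsGAP m n A) (hf : FL A B D) :
    Hsum n B < Hsum n A := by
  have tel : ∀ N : Nat, (∑ j ∈ Finset.range N, (colSumA B j : Int)) =
      (∑ j ∈ Finset.range N, (colSumA A j : Int)) - (Y (N - 1) - Y (-1)) := by
    intro N
    induction N with
    | zero => simp
    | succ N ih =>
      rw [Finset.sum_range_succ, Finset.sum_range_succ, ih, colSum_FL H hm hn hA hf]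
      push_cast; simp only [add_sub_cancel_right]; ring
  have h1 := tel n
  have h2 := H.Y_per hn 1 (-1)
  rw [show -1 + 1 * (n : Int) = n - 1 by ring] at h2
  have h3 := H.lpos
  zify [Hsum]
  linarith
end
lemma diff_max {m n : Nat} (hm : 0 < m) (hn : 0 < n) {l : Int} {D D' : Int -> Int -> Int} {X Y X' Y' : Int -> Int}
    (H : Hgt m n l D X Y) (H' : Hgt m n l D' X' Y') :
    ∃ M, (∃ i j, D' i j - D i j = M) ∧ ∀ i j, D' i j - D i j ≤ M := by
  have hm' : (1 : Int) ≤ m := by exact_mod_cast hm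
  have hn' : (1 : Int) ≤ n := by exact_mod_cast hn
  have per : ∀ a i j, D' (i + a * m) (j + a * n) - D (i + a * m) (j + a * n) = D' i j - D i j := by
    intro a i j; rw [H.per, H'.per]; ring
  have hbd : ∃ K, ∀ i j, D' i j - D i j ≤ K := by
    obtain ⟨N, hN⟩ := H.hX
    obtain ⟨N', hN'⟩ := H'.hX
    obtain ⟨I, hI⟩ := far hn m (n : Int) (|N| + |N'|)
    have hYs : ∃ I, ∀ j ∈ Set.Ico (0 : Int) n, ∀ i, I ≤ i -> D i j = Y j ∧ D' i j = Y' j := by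
      obtain ⟨R, hR⟩ := H.hY
      obtain ⟨R', hR'⟩ := H'.hY
      obtain ⟨I, hI⟩ := far hn m (n : Int) (|R| + |R'|)
      refine ⟨I, fun j hj i hi => ?_⟩
      have := hI i hi
      have := le_abs_self R
      have := le_abs_self R'
      have := abs_nonneg R
      have := abs_nonneg R'
      have := hj.2
      exact ⟨hR _ _ (by nlinarith), hR' _ _ (by nlinarith)⟩
    obtain ⟨J, hJ⟩ := hYs
    obtain ⟨K1, hK1⟩ := ((Set.finite_Icc (-|I|) |J|).prod (Set.finite_Icc (0 : Int) n)).image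
      (fun p => D' p.1 p.2 - D p.1 p.2) |>.bddAbove
    obtain ⟨K2, hK2⟩ := (Set.finite_Icc (0 : Int) m).image (fun i => X' i - X i) |>.bddAbove
    obtain ⟨K3, hK3⟩ := (Set.finite_Icc (0 : Int) n).image (fun j => Y' j - Y j) |>.bddAbove
    refine ⟨max K1 (max K2 K3), ?_⟩
    have base : ∀ i, ∀ j ∈ Set.Ico (0 : Int) n, D' i j - D i j ≤ max K1 (max K2 K3) := by
      intro i j hj
      rcases lt_or_ge i (-|I|) with h | h
      · have e0 := hI (-i) (by have := le_abs_self I; omega)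
        have := le_abs_self N
        have := le_abs_self N'
        have := abs_nonneg N
        have := abs_nonneg N'
        have := hj.1
        have e1 : D i j = X i := hN _ _ (by nlinarith)
        have e2 : D' i j = X' i := hN' _ _ (by nlinarith)
        have e3 : X' i - X i = X' (i % m) - X (i % m) := by
          have h1 := H.X_per hm (i / m) (i % m)
          have h2 := H'.X_per hm (i / m) (i % m)
          rw [mul_comm, Int.emod_add_mul_ediv] at h1 h2
          rw [h1, h2]; ring
        rw [e1, e2, e3]
        have := hK2 ⟨i % m, ⟨Int.emod_nonneg _ (by omega), (Int.emod_lt_of_pos _ (by omega)).le⟩, rfl⟩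
        exact le_max_of_le_right (le_max_of_le_left this)
      · rcases lt_or_ge |J| i with h' | h'
        · have := hJ j hj i (by have := le_abs_self J; omega)
          rw [this.1, this.2]
          exact le_max_of_le_right (le_max_of_le_right (hK3 ⟨j, ⟨hj.1, hj.2.le⟩, rfl⟩))
        · exact le_max_of_le_left (hK1 ⟨(i, j), ⟨⟨h, h'⟩, ⟨hj.1, hj.2.le⟩⟩, rfl⟩)
    intro i j
    have := base (i - (j / n) * m) (j % n) ⟨Int.emod_nonneg _ (by omega), Int.emod_lt_of_pos _ (by omega)⟩
    rw [<- per (j / n)] at this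
    rwa [sub_add_cancel, show j % (n : Int) + j / n * n = j by rw [mul_comm, Int.emod_add_mul_ediv]] at this
  obtain ⟨K, hK⟩ := hbd
  obtain ⟨M, ⟨i, j, h1⟩, h2⟩ := Int.exists_greatest_of_bdd (P := fun v => ∃ i j, D' i j - D i j = v)
    ⟨K, by rintro z ⟨i, j, rfl⟩; exact hK i j⟩ ⟨_, 0, 0, rfl⟩
  exact ⟨M, ⟨i, j, h1⟩, fun i j => h2 _ ⟨i, j, rfl⟩⟩
end
section
structure SWD (m n : Nat) (l : Int) (A : Mat) (D : Int -> Int -> Int) (X Y : Int -> Int) (e : Int -> Cell) : Prop where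
  H : Hgt m n l D X Y
  fr : FR A D
  cn : CN m n l (supp A) e (dD D)
  sw : ∀ e', Tight (supp A) (dD D) e' -> ∀ k, neLe (e k) (e' k)
section
variable {m n : Nat} {l : Int} {D D' : Int -> Int -> Int} {X Y X' Y' : Int -> Int} {A B : Mat} {e : Int -> Cell}
lemma Hgt.X_mono (H : Hgt m n l D X Y) (hm : 0 < m) {i i' : Int} (h : i ≤ i') : X i ≤ X i' :=
  mono_of_step (fun x => (H.X_step hm x).1) h
lemma Hgt.stepE (H : Hgt m n l D X Y) (hm : 0 < m) {i j k : Int} (h : D i j = k) (hX : k < X i) :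
    ∃ j', j ≤ j' ∧ D i j' = k ∧ D i (j' + 1) = k + 1 := by
  obtain ⟨J, hJ⟩ := H.X_at hm i
  obtain ⟨j', h1, _, h2⟩ := H.findE (b := J) h.le (by rw [hJ J le_rfl]; exact hX)
  exact ⟨j', h1, h2⟩
lemma cornerE (H : Hgt m n l D X Y) (hm : 0 < m) (h : BR B D) {i j k : Int} (h1 : D i j = k)
    (h2 : D (i + 1) j = k + 1) (hX : k < X i) : ∃ j', j ≤ j' ∧ D i j' = k ∧ D i (j' + 1) = k + 1 ∧
      B (i + 1) (j' + 1) ≠ 0 ∧ D (i + 1) (j' + 1) = k + 1 := by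
  obtain ⟨j', h3, h4, h5⟩ := H.stepE hm h1 hX
  have h6 := H.monoC (i + 1) h3
  have h7 := h (i + 1) (j' + 1)
  simp only [add_sub_cancel_right] at h7
  have h8 : B (i + 1) (j' + 1) ≠ 0 := fun h9 => by have := h7.2 h9; omega
  exact ⟨j', h3, h4, h5, h8, by have := h7.1 h8; omega⟩
lemma rowA (H : Hgt m n l D X Y) (hn : 0 < n) (h : FR A D) (hf : FL A B D) {i j : Int} (hB : B i j ≠ 0) :
    ∃ j', j' ≤ j ∧ A i j' ≠ 0 ∧ D i j' = D i j ∧ D i (j' - 1) = D i j - 1 := by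
  obtain ⟨J, hJ⟩ := H.lowC hn (D i j)
  obtain ⟨j', h1, h2, h3, h4⟩ := H.findE (i := i) (a := J) (b := j) (k := D i j - 1)
    (by by_contra! hh; have := hJ i J (by omega); omega) (by omega)
  refine ⟨j' + 1, by omega, fun h5 => ?_, by omega, by simpa using h3⟩
  have h6 := (h i (j' + 1)).2 h5
  have h7 := (FR_BR H h hf i j).1 hB
  simp only [add_sub_cancel_right] at h6
  rcases eq_or_lt_of_le (show j' + 1 ≤ j by omega) with h8 | h8
  · subst h8
    have := hf i (j' + 1)
    simp only [add_sub_cancel_right] at this h7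
    omega
  · have := H.monoC (i - 1) (show j' + 1 ≤ j - 1 by omega)
    omega
lemma rowB (H : Hgt m n l D X Y) (hm : 0 < m) (h : FR A D) (hf : FL A B D) {i j : Int} (hA : A i j ≠ 0)
    (hX : D i j - 1 < X (i - 1)) :
    ∃ j', j ≤ j' ∧ B i j' ≠ 0 ∧ D i j' = D i j ∧ D (i - 1) (j' - 1) = D i j - 1 ∧ D (i - 1) j' = D i j := by
  have h1 := (h i j).1 hA
  obtain ⟨j', h3, h4, h5⟩ := H.stepE hm (i := i - 1) (j := j - 1) (k := D i j - 1) (by omega) hX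
  have hB : B i (j' + 1) ≠ 0 := by
    intro hB
    have h6 := (FR_BR H h hf i (j' + 1)).2 hB
    have h7 := hf i (j' + 1)
    have h8 := H.monoC i (show j - 1 ≤ j' by omega)
    have h9 := (h i (j' + 1))
    simp only [add_sub_cancel_right] at h6 h7 h9
    rcases eq_or_lt_of_le h3 with h10 | h10
    · subst h10; simp only [sub_add_cancel] at *; omega
    · have := H.monoC i (show j ≤ j' by omega); omega
  have := (FR_BR H h hf i (j' + 1)).1 hB
  simp only [add_sub_cancel_right] at this
  exact ⟨j' + 1, by omega, hB, by omega, by simpa using h4, by omega⟩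
lemma BR_mono (H : Hgt m n l D X Y) (h : BR B D) {c c' : Cell} (hc : NW c c') (hB : c' ∈ supp B) :
    D c.1 c.2 < D c'.1 c'.2 := by
  have := (h c'.1 c'.2).1 (show B c'.1 c'.2 ≠ 0 from hB)
  have := H.mono (show c.1 ≤ c'.1 - 1 by have := hc.1; omega) (show c.2 ≤ c'.2 - 1 by have := hc.2; omega)
  omega
theorem domNE (hm : 0 < m) (hn : 0 < n) (hA : IsGAP m n A) (S : SWD m n l A D X Y e) (hf : FL A B D)
    (H' : Hgt m n l D' X' Y') (hB : FR B D') {M : Int} (hM : ∀ i j, D' i j - D i j ≤ M)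
    (hMe : ∃ i j, D' i j - D i j = M) : ∃ i, X' i - X i = M := by
  by_contra hcon
  have H := S.H
  have br := FR_BR H S.fr hf
  have hno : ∀ i j, D' i j - D i j = M -> D i j < X i := by
    intro i j h1
    by_contra! h2
    apply hcon
    have h3 := H.le_X hm i j
    have h4 := H'.le_X hm i j
    obtain ⟨J, hJ⟩ := H.X_at hm i
    obtain ⟨J', hJ'⟩ := H'.X_at hm i
    have h5 := hM i (max J J')
    rw [hJ _ (le_max_left _ _), hJ' _ (le_max_right _ _)] at h5
    exact ⟨i, by omega⟩
  have hB' : ∀ i j, B i j ≠ 0 -> D' i j = D' (i - 1) (j - 1) + 1 ∧ D (i - 1) (j - 1) = D i j - 1 :=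
    fun i j h => ⟨(hB i j).1 h, (br i j).1 h⟩
  have h1 : ∀ i j, D' i j - D i j = M -> B i j ≠ 0 -> ∃ i' j', i' < i ∧ j' < j ∧ B i' j' ≠ 0 ∧
      D' i' j' - D i' j' = M ∧ D i' j' = D i j - 1 := by
    intro i j hz hb
    obtain ⟨c, hc, q1, q2, q3⟩ := FR_attain H' hm hn hB (i - 1) (j - 1)
    have := hB' i j hb
    have := H.mono q1 q2
    have := hM c.1 c.2
    exact ⟨c.1, c.2, by omega, by omega, hc, by omega, by omega⟩
  have h0 : ∃ i j, D' i j - D i j = M ∧ B i j ≠ 0 := by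
    obtain ⟨i, j, hij⟩ := hMe
    obtain ⟨c, hc, q1, q2, q3⟩ := FR_attain H' hm hn hB i j
    have := H.mono q1 q2
    have := hM c.1 c.2
    exact ⟨c.1, c.2, by omega, hc⟩
  have hper : ∀ a i j, D' (i + a * m) (j + a * n) - D (i + a * m) (j + a * n) = D' i j - D i j := by
    intro a i j; rw [H.per, H'.per]; ring
  have gB : IsGAP m n B := (GAP_FL H hm hn hf).1 hA
  let T : Set Cell := {c | c ∈ supp A ∧ ∃ s : Cell, D' s.1 s.2 - D s.1 s.2 = M ∧ B s.1 s.2 ≠ 0 ∧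
    D s.1 s.2 = D c.1 c.2 ∧ neLe c s}
  have pnT : PN m n l T (dD D) := by
    refine ⟨?_, H.lpos, ?_, fun a c _ => H.dper a c, fun c hc c' hc' => S.cn.pn.mono c hc.1 c' hc'.1, ?_,
      fun k => (S.cn.pn.fin k).subset fun c hc => ⟨hc.1.1, hc.2⟩⟩
    · obtain ⟨i, j, hz, hb⟩ := h0
      obtain ⟨j', q1, q2, q3, _⟩ := rowA H hn S.fr hf hb
      exact ⟨(i, j'), q2, (i, j), hz, hb, q3.symm, le_rfl, q1⟩
    · rintro a c ⟨hc, s, q1, q2, q3, q4⟩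
      refine ⟨S.cn.pn.mem a c hc, sh m n a s, ?_, ?_, ?_, neLe_sh.2 q4⟩
      · exact (hper a _ _).trans q1
      · simpa [sh, supp_sh gB] using q2
      · simp only [sh, H.per]; omega
    · rintro c ⟨hc, s, q1, q2, q3, q4⟩
      obtain ⟨i, j, r1, r2, r3, r4, r5⟩ := h1 _ _ q1 q2
      obtain ⟨j', t1, t2, t3, _⟩ := rowA H hn S.fr hf r3
      have q41 := q4.1
      have q42 := q4.2
      rcases lt_or_ge j' c.2 with h | h
      · exact ⟨(i, j'), ⟨t2, (i, j), r4, r3, t3.symm, le_rfl, t1⟩,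
          ⟨by simp only; omega, h⟩, by simp only [dD]; omega⟩
      · obtain ⟨c', v1, v2, v3⟩ := S.cn.pn.pred c hc
        refine ⟨c', ⟨v1, (i, j), r4, r3, by simp only [dD] at *; omega, ?_⟩, v2, v3⟩
        have := v2.2
        refine ⟨?_, by simp only; omega⟩
        by_contra! hlt
        have := S.cn.pn.mono c' v1 (i, j') t2 ⟨hlt, by simp only; omega⟩
        simp only [dD] at *; omega
  obtain ⟨e', w1, _, _⟩ := river pnT
  have heT : ∀ k, e k ∈ T := by
    intro k
    have h2 := S.sw e' (fun k => ⟨(w1 k).1.1, (w1 k).2⟩) k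
    obtain ⟨_, s, q1, q2, q3, q4⟩ := (w1 k).1
    have h3 := (w1 k).2.1
    have h4 := (S.cn.tight k).2.1
    exact ⟨(S.cn.tight k).1, s, q1, q2, by simp only [dD] at *; omega, neLe_trans h2 q4⟩
  let Zh : Cell -> Prop := fun y => ∃ x : Cell, D' x.1 x.2 - D x.1 x.2 = M ∧ D x.1 x.2 = D y.1 y.2 ∧ neLe y x
  have h3 : ∀ y g : Cell, Zh y -> g ∈ supp B -> D g.1 g.2 = D y.1 y.2 + 1 -> NW y g -> Zh g := by
    rintro y g ⟨x, x1, x2, x3⟩ hg hk hyg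
    have hgB := hB' g.1 g.2 hg
    have x31 := x3.1
    have y1 := hyg.1
    have y2 := hyg.2
    rcases lt_or_ge x.2 g.2 with h | h
    · refine ⟨g, ?_, rfl, le_rfl, le_rfl⟩
      have := H'.mono (show x.1 ≤ g.1 - 1 by omega) (show x.2 ≤ g.2 - 1 by omega)
      have := hM g.1 g.2
      omega
    · obtain ⟨i', r1, r2, r3, r4⟩ := H.findS (j := x.2) (a := x.1) (b := g.1) (k := D x.1 x.2) le_rfl
        (by have := H.monoC g.1 h; omega)
      have zw : D' i' x.2 - D i' x.2 = M := by
        have := H'.monoR x.2 r1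
        have := hM i' x.2
        omega
      obtain ⟨j', t1, t2, t3, t4, t5⟩ := cornerE H hm br r3 r4 (by have := hno _ _ zw; omega)
      have := H'.monoC i' t1
      have := hM (i' + 1) (j' + 1)
      have := hB' _ _ t4
      simp only [add_sub_cancel_right] at this
      have := hM i' j'
      exact ⟨(i' + 1, j' + 1), by simp only; omega, by simp only; omega, by simp only; omega, by simp only; omega⟩
  have all : ∀ c ∈ supp A, Zh c := by
    refine S.cn.gen Zh (fun k => ?_) ?_
    · obtain ⟨_, s, q1, q2, q3, q4⟩ := heT k
      exact ⟨s, q1, q3, q4⟩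
    · rintro c hc c' hc' hz hnw hd
      have z := hz
      obtain ⟨x, x1, x2, x3⟩ := z
      have y1 := hnw.1
      have y2 := hnw.2
      have x31 := x3.1
      simp only [dD] at hd
      have := hno _ _ x1
      have := H.X_mono hm (show x.1 ≤ c'.1 - 1 by omega)
      obtain ⟨j', r1, r2, r3, -⟩ := rowB H hm S.fr hf (i := c'.1) (j := c'.2) hc' (by omega)
      obtain ⟨x', x1', x2', x3'⟩ := h3 c (c'.1, j') hz r2 (by simp only; omega) ⟨y1, by simp only; omega⟩
      refine ⟨x', x1', by simp only at *; omega, x3'.1, ?_⟩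
      have := x3'.2
      simp only at *; omega
  obtain ⟨J, hJ⟩ := H.X_at hm 0
  obtain ⟨c, hc, q1, q2, q3⟩ := FR_attain H hm hn S.fr 0 J
  obtain ⟨x, x1, x2, x3⟩ := all c hc
  have := hno _ _ x1
  have := H.X_mono hm (show x.1 ≤ 0 by have := x3.1; omega)
  have := hJ J le_rfl
  omega
end
end
section
lemma per_bdd {m : Nat} (hm : 0 < m) {f : Int -> Int} (h : ∀ a i, f (i + a * m) = f i) : ∃ C, 0 ≤ C ∧ ∀ i, f i ≤ C := by
  have hm' : (0 : Int) < m := by exact_mod_cast hm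
  obtain ⟨K, hK⟩ := (Set.finite_Ico (0 : Int) m).image f |>.bddAbove
  refine ⟨max 0 K, le_max_left _ _, fun i => le_max_of_le_right ?_⟩
  have h1 := h (i / m) (i % m)
  rw [mul_comm, Int.emod_add_mul_ediv] at h1
  rw [h1]
  exact hK ⟨_, ⟨Int.emod_nonneg _ hm'.ne', Int.emod_lt_of_pos _ hm'⟩, rfl⟩
lemma XY_sep {m n : Nat} (hm : 0 < m) (hn : 0 < n) {l : Int} (hl : 0 < l) {X Y : Int -> Int}
    (hX : ∀ a i, X (i + a * m) = X i + a * l) (hY : ∀ a i, Y (i + a * n) = Y i + a * l) (C : Int) :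
    ∃ N : Int, ∀ i j, n * i + N ≤ m * j -> X i ≤ Y j - C := by
  have hm' : (0 : Int) < m := by exact_mod_cast hm
  have hn' : (0 : Int) < n := by exact_mod_cast hn
  obtain ⟨CX, h1, h2⟩ := per_bdd hm (f := fun i => X i - (i / m) * l) (fun a i => by
    simp only [hX, Int.add_mul_ediv_right _ _ hm'.ne']; ring)
  obtain ⟨CY, h3, h4⟩ := per_bdd hn (f := fun i => (i / n) * l - Y i) (fun a i => by
    simp only [hY, Int.add_mul_ediv_right _ _ hn'.ne']; ring)
  refine ⟨m * n * (CX + CY + |C| + 1), fun i j hij => ?_⟩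
  have h5 := h2 i
  have h6 := h4 j
  have a1 := Int.ediv_mul_le i hm'.ne'
  have a2 := Int.lt_ediv_add_one_mul_self j hn'
  have h7 : (m * n : Int) * (CX + CY + |C| + 1 + i / m) < m * n * (j / n + 1) := by nlinarith
  have h8 : CX + CY + |C| + 1 + i / m < j / n + 1 := lt_of_mul_lt_mul_left h7 (by positivity)
  have h9 := le_abs_self C
  have h10 := abs_nonneg C
  have h11 : (CX + CY + |C|) ≤ (j / n - i / m) * l := by nlinarith
  nlinarith
structure EE (B : Mat) (X Y : Int -> Int) (E : Int -> Int -> Int) : Prop where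
  r : ∀ i j, E (i - 1) j ≤ E i j
  c : ∀ i j, E i (j - 1) ≤ E i j
  b : ∀ i j, B i j ≠ 0 -> E (i - 1) (j - 1) ≤ E i j - 1
  x : ∀ i j, E i j ≤ X i
  y : ∀ i j, E i j ≤ Y j
lemma EE_of_BR {m n : Nat} (hm : 0 < m) (hn : 0 < n) {l : Int} {D : Int -> Int -> Int} {X Y : Int -> Int} {B : Mat}
    (H : Hgt m n l D X Y) (h : BR B D) : EE B X Y D :=
  ⟨fun i j => (H.row i j).1, fun i j => (H.col i j).1, fun i j hb => ((h i j).1 hb).le,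
    H.le_X hm, H.le_Y hn⟩
theorem maxSol {m n : Nat} (hm : 0 < m) (hn : 0 < n) {l : Int} (hl : 0 < l) {X Y : Int -> Int} {B : Mat}
    (gB : IsGAP m n B)
    (sX : ∀ i, X (i - 1) ≤ X i ∧ X i ≤ X (i - 1) + 1) (sY : ∀ i, Y (i - 1) ≤ Y i ∧ Y i ≤ Y (i - 1) + 1)
    (hX : ∀ a i, X (i + a * m) = X i + a * l) (hY : ∀ a i, Y (i + a * n) = Y i + a * l)
    (hB : B = 0 ∨ ∃ l' D' X' Y', l' ≤ l ∧ Hgt m n l' D' X' Y' ∧ FR B D') :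
    ∃ D, Hgt m n l D X Y ∧ BR B D ∧ ∀ E, EE B X Y E -> ∀ i j, E i j ≤ D i j := by
  have hm' : (0 : Int) < m := by exact_mod_cast hm
  have hn' : (0 : Int) < n := by exact_mod_cast hn
  have ne : ∃ E, EE B X Y E := by
    rcases hB with h | ⟨l', D', X', Y', h1, H, h2⟩
    · subst h
      refine ⟨fun i j => min (X i) (Y j), ?_, ?_, ?_, ?_, ?_⟩
      · intro i j; have := sX i; omega
      · intro i j; have := sY j; omega
      · intro i j h; exact absurd rfl h
      · intro i j; exact min_le_left _ _
      · intro i j; exact min_le_right _ _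
    · obtain ⟨C1, p1, q1⟩ := per_bdd hm (f := fun i => X' i + (l - l') * (i / m) - X i) (fun a i => by
        simp only [hX, H.X_per hm, Int.add_mul_ediv_right _ _ hm'.ne']; ring)
      obtain ⟨C2, p2, q2⟩ := per_bdd hn (f := fun i => Y' i + (l - l') * (i / n) - Y i) (fun a i => by
        simp only [hY, H.Y_per hn, Int.add_mul_ediv_right _ _ hn'.ne']; ring)
      have g0 : 0 ≤ l - l' := by omega
      have gm : ∀ i, (i - 1) / (m : Int) ≤ i / m := fun i => Int.ediv_le_ediv hm' (by omega)
      have gn : ∀ i, (i - 1) / (n : Int) ≤ i / n := fun i => Int.ediv_le_ediv hn' (by omega)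
      refine ⟨fun i j => D' i j + (l - l') * min (i / m) (j / n) - (C1 + C2), ?_, ?_, ?_, ?_, ?_⟩
      · intro i j
        have := mul_le_mul_of_nonneg_left (min_le_min_right (j / (n : Int)) (gm i)) g0
        have := (H.row i j).1; omega
      · intro i j
        have := mul_le_mul_of_nonneg_left (min_le_min_left (i / (m : Int)) (gn j)) g0
        have := (H.col i j).1; omega
      · intro i j hb
        have := mul_le_mul_of_nonneg_left (min_le_min (gm i) (gn j)) g0
        have := (h2 i j).1 hb; omega
      · intro i j
        have := mul_le_mul_of_nonneg_left (min_le_left (i / (m : Int)) (j / n)) g0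
        have := q1 i
        have := H.le_X hm i j; omega
      · intro i j
        have := mul_le_mul_of_nonneg_left (min_le_right (i / (m : Int)) (j / n)) g0
        have := q2 j
        have := H.le_Y hn i j; omega
  have hD : ∀ i j, ∃ v, (∃ E, EE B X Y E ∧ E i j = v) ∧ ∀ E, EE B X Y E -> E i j ≤ v := by
    intro i j
    obtain ⟨E0, h0⟩ := ne
    obtain ⟨v, h1, h2⟩ := Int.exists_greatest_of_bdd (P := fun v => ∃ E, EE B X Y E ∧ E i j = v)
      ⟨X i, by rintro _ ⟨E, hE, rfl⟩; exact hE.x i j⟩ ⟨_, E0, h0, rfl⟩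
    exact ⟨v, h1, fun E hE => h2 _ ⟨E, hE, rfl⟩⟩
  choose D hD1 hD2 using hD
  have DE : EE B X Y D := by
    refine ⟨?_, ?_, ?_, ?_, ?_⟩
    · intro i j
      obtain ⟨E, hE, h⟩ := hD1 (i - 1) j
      have := hD2 i j E hE; have := hE.r i j; omega
    · intro i j
      obtain ⟨E, hE, h⟩ := hD1 i (j - 1)
      have := hD2 i j E hE; have := hE.c i j; omega
    · intro i j hb
      obtain ⟨E, hE, h⟩ := hD1 (i - 1) (j - 1)
      have := hD2 i j E hE; have := hE.b i j hb; omega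
    · intro i j
      obtain ⟨E, hE, h⟩ := hD1 i j
      have := hE.x i j; omega
    · intro i j
      obtain ⟨E, hE, h⟩ := hD1 i j
      have := hE.y i j; omega
  have up : ∀ E, EE B X Y E -> ∀ i j, E i j ≤ D i j := fun E hE i j => hD2 i j E hE
  have row : ∀ i j, D i j ≤ D (i - 1) j + 1 := by
    intro i j
    have := up (fun i j => max (D i j) (D (i + 1) j - 1)) ⟨?_, ?_, ?_, ?_, ?_⟩ (i - 1) j
    · simp only [sub_add_cancel] at this; omega
    · intro i j
      have := DE.r i j; have := DE.r (i + 1) j; simp only [sub_add_cancel, add_sub_cancel_right] at *; omega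
    · intro i j
      have := DE.c i j; have := DE.c (i + 1) j; omega
    · intro i j hb
      have := DE.b i j hb; have := DE.c i j; simp only [sub_add_cancel]; omega
    · intro i j
      have := DE.x i j; have := DE.x (i + 1) j; have := sX (i + 1)
      simp only [add_sub_cancel_right] at *; omega
    · intro i j
      have := DE.y i j; have := DE.y (i + 1) j; omega
  have col : ∀ i j, D i j ≤ D i (j - 1) + 1 := by
    intro i j
    have := up (fun i j => max (D i j) (D i (j + 1) - 1)) ⟨?_, ?_, ?_, ?_, ?_⟩ i (j - 1)
    · simp only [sub_add_cancel] at this; omega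
    · intro i j
      have := DE.r i j; have := DE.r i (j + 1); omega
    · intro i j
      have := DE.c i j; have := DE.c i (j + 1); simp only [sub_add_cancel, add_sub_cancel_right] at *; omega
    · intro i j hb
      have := DE.b i j hb; have := DE.r i j; simp only [sub_add_cancel]; omega
    · intro i j
      have := DE.x i j; have := DE.x i (j + 1); omega
    · intro i j
      have := DE.y i j; have := DE.y i (j + 1); have := sY (j + 1)
      simp only [add_sub_cancel_right] at *; omega
  have br : BR B D := by
    intro i j
    have key : ∀ v, v ≤ D (i - 1) j -> v ≤ D i (j - 1) -> (B i j ≠ 0 -> v ≤ D i j - 1) -> v ≤ D (i - 1) (j - 1) := by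
      intro v v1 v2 v3
      have := up (fun a b => if a = i - 1 ∧ b = j - 1 then max (D a b) v else D a b) ⟨?_, ?_, ?_, ?_, ?_⟩ (i - 1) (j - 1)
      · simp at this; exact this
      · intro a b
        have := DE.r a b
        by_cases h1 : a - 1 = i - 1 ∧ b = j - 1
        · have e1 : a = i := by omega
          obtain ⟨_, rfl⟩ := h1
          subst e1
          rw [if_pos (by omega), if_neg (by omega)]; omega
        · rw [if_neg h1]; split_ifs <;> omega
      · intro a b
        have := DE.c a b
        by_cases h1 : a = i - 1 ∧ b - 1 = j - 1
        · have e1 : b = j := by omega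
          obtain ⟨rfl, _⟩ := h1
          subst e1
          rw [if_pos (by omega), if_neg (by omega)]; omega
        · rw [if_neg h1]; split_ifs <;> omega
      · intro a b hb
        have := DE.b a b hb
        by_cases h1 : a - 1 = i - 1 ∧ b - 1 = j - 1
        · have e1 : a = i := by omega
          have e2 : b = j := by omega
          subst e1 e2
          have := v3 hb
          rw [if_pos (by omega), if_neg (by omega)]; omega
        · rw [if_neg h1]; split_ifs <;> omega
      · intro a b
        have := DE.x a b
        split_ifs with h
        · obtain ⟨rfl, rfl⟩ := h; have := DE.x (i - 1) j; omega
        · exact this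
      · intro a b
        have := DE.y a b
        split_ifs with h
        · obtain ⟨rfl, rfl⟩ := h; have := DE.y i (j - 1); omega
        · exact this
    have r1 := row i j
    have c1 := col i j
    have r2 := DE.r i (j - 1)
    have c2 := DE.c (i - 1) j
    constructor
    · intro hb
      have := DE.b i j hb
      have := key (D i j - 1) (by omega) (by omega) (fun _ => le_rfl)
      omega
    · intro hb
      have := key (min (D (i - 1) j) (D i (j - 1))) (min_le_left _ _) (min_le_right _ _) (fun h => absurd hb h)
      omega
  have per : ∀ a i j, D i j + a * l ≤ D (i + a * m) (j + a * n) := by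
    intro a i j
    have := up (fun i j => D (i - a * m) (j - a * n) + a * l) ⟨?_, ?_, ?_, ?_, ?_⟩ (i + a * m) (j + a * n)
    · simpa using this
    · intro i j
      have := DE.r (i - a * m) (j - a * n)
      rw [show i - a * m - 1 = i - 1 - a * m by ring] at this; omega
    · intro i j
      have := DE.c (i - a * m) (j - a * n)
      rw [show j - a * n - 1 = j - 1 - a * n by ring] at this; omega
    · intro i j hb
      have h := supp_sh gB (-a) i j
      rw [show i + -a * m = i - a * m by ring, show j + -a * n = j - a * n by ring] at h
      have := DE.b (i - a * m) (j - a * n) (by rw [h]; exact hb)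
      rw [show j - a * n - 1 = j - 1 - a * n by ring, show i - a * m - 1 = i - 1 - a * m by ring] at this; omega
    · intro i j
      have := DE.x (i - a * m) (j - a * n)
      have h := hX a (i - a * m)
      rw [sub_add_cancel] at h; omega
    · intro i j
      have := DE.y (i - a * m) (j - a * n)
      have h := hY a (j - a * n)
      rw [sub_add_cancel] at h; omega
  have per' : ∀ a i j, D (i + a * m) (j + a * n) = D i j + a * l := by
    intro a i j
    have h1 := per a i j
    have h2 := per (-a) (i + a * m) (j + a * n)
    rw [show i + a * m + -a * m = i by ring, show j + a * n + -a * n = j by ring] at h2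
    linarith
  have P := GAP_per gB
  refine ⟨D, ⟨hl, fun i j => ⟨DE.r i j, row i j⟩, fun i j => ⟨DE.c i j, col i j⟩, per', ?_, ?_⟩, br, up⟩
  · obtain ⟨C, hC0, hC⟩ := P.bdd hn (fun c => Y c.2 - D c.1 c.2) (fun a c _ => by simp only [sh, per', hY]; ring)
    obtain ⟨N, hN⟩ := XY_sep hm hn hl hX hY (|C| + 1)
    refine ⟨N, fun i j hij => le_antisymm (DE.x i j) ?_⟩
    have := up (fun i j => max (D i j) (min (X i) (Y j - (|C| + 1)))) ⟨?_, ?_, ?_, ?_, ?_⟩ i j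
    · have := hN i j hij; omega
    · intro i j; have := DE.r i j; have := sX i; omega
    · intro i j; have := DE.c i j; have := sY j; omega
    · intro i j hb
      have := DE.b i j hb; have h := (le_abs_self _).trans (hC (i, j) hb); have := sY j
      have := le_abs_self C
      simp only at h; omega
    · intro i j; have := DE.x i j; omega
    · intro i j; have := DE.y i j; have := abs_nonneg C; omega
  · obtain ⟨C, hC0, hC⟩ := P.bdd hn (fun c => X c.1 - D c.1 c.2) (fun a c _ => by simp only [sh, per', hX]; ring)
    obtain ⟨N, hN⟩ := XY_sep hn hm hl hY hX (|C| + 1)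
    refine ⟨N, fun i j hij => le_antisymm (DE.y i j) ?_⟩
    have := up (fun i j => max (D i j) (min (X i - (|C| + 1)) (Y j))) ⟨?_, ?_, ?_, ?_, ?_⟩ i j
    · have := hN j i hij; omega
    · intro i j; have := DE.r i j; have := sX i; omega
    · intro i j; have := DE.c i j; have := sY j; omega
    · intro i j hb
      have := DE.b i j hb; have h := (le_abs_self _).trans (hC (i, j) hb); have := sX i
      have := le_abs_self C
      simp only at h; omega
    · intro i j; have := DE.x i j; have := abs_nonneg C; omega
    · intro i j; have := DE.y i j; omega
end
section
section
variable {m n l : Nat} {D D₀ : Int -> Int -> Int} {X Y X₀ Y₀ : Int -> Int} {A B : Mat} {e : Int -> Cell}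
lemma neLe_NW {a b : Cell} (h : NW a b) (h' : neLe a b) : False := by
  have := h.1; have := h'.1; omega
theorem isSW (hm : 0 < m) (hn : 0 < n) (hA : IsGAP m n A) (H : Hgt m n l D X Y) (fr : FR A D)
    (hf : FL A B D) (S : SWD m n l A D₀ X₀ Y₀ e)
    (hyp : ∀ e1, IsStreamEnum m n e1 l -> (∀ k, e1 k ∈ supp B) -> ∃ D' X' Y' e', SWD m n l B D' X' Y' e' ∧
      ∃ i, ∀ a b, D' a b - D a b ≤ X' i - X i) : ∃ M, ∀ i j, D₀ i j = D i j + M := by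
  have br := FR_BR H fr hf
  have gB : IsGAP m n B := (GAP_FL H hm hn hf).1 hA
  have H₀ := S.H
  have lpos : 0 < l := by exact_mod_cast H.lpos
  have pnA := FR_PN H hm hn hA fr
  have es : IsStreamEnum m n e l := tight_stream lpos S.cn.tight S.cn.eqv
  have tig := S.cn.tight
  obtain ⟨M, tM⟩ : ∃ M, ∀ k, D (e k).1 (e k).2 = k - M := by
    obtain ⟨r, hr⟩ := stream_tight lpos (fun a c hc => pnA.per a c hc) pnA.mono es (fun k => (tig k).1)
    refine ⟨r, fun k => ?_⟩
    have := (hr (k - r)).2.1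
    simpa [dD] using this
  have t0 : ∀ k, D₀ (e k).1 (e k).2 = k := fun k => (tig k).2.1
  have leA : ∀ c ∈ supp A, D₀ c.1 c.2 - D c.1 c.2 ≤ M := by
    refine S.cn.gen _ (fun k => by rw [t0, tM]; omega) ?_
    intro c hc c' hc' h1 h2 h3
    have := pnA.mono c hc c' hc' h2
    simp only [dD] at *; omega
  have le : ∀ i j, D₀ i j - D i j ≤ M := by
    intro i j
    obtain ⟨c, hc, q1, q2, q3⟩ := FR_attain H₀ hm hn S.fr i j
    have := leA c hc
    have := H.mono q1 q2
    omega
  refine ⟨M, ?_⟩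
  by_contra hU
  push Not at hU
  let K : Cell -> Prop := fun x => D₀ x.1 x.2 - D x.1 x.2 = M
  have Kse : ∀ {x y : Cell}, K x -> D y.1 y.2 = D x.1 x.2 -> x.1 ≤ y.1 -> x.2 ≤ y.2 -> K y := by
    intro x y hx hd h1 h2
    have := H₀.mono h1 h2
    have := le y.1 y.2
    simp only [K] at *; omega
  have Kedge : ∀ {c c' : Cell}, K c -> c' ∈ supp A -> D c'.1 c'.2 = D c.1 c.2 + 1 -> NW c c' -> K c' := by
    intro c c' hc hc' hd h
    have h1 := h.1
    have h2 := h.2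
    have := H₀.mono (show c.1 ≤ c'.1 - 1 by omega) (show c.2 ≤ c'.2 - 1 by omega)
    have := (S.fr c'.1 c'.2).1 hc'
    have := le c'.1 c'.2
    simp only [K] at *; omega
  have Kat : ∀ {x : Cell}, K x -> ∃ c ∈ supp A, c.1 ≤ x.1 ∧ c.2 ≤ x.2 ∧ D c.1 c.2 = D x.1 x.2 ∧ K c := by
    intro x hx
    obtain ⟨c, hc, q1, q2, q3⟩ := FR_attain H₀ hm hn S.fr x.1 x.2
    have := H.mono q1 q2
    have := le c.1 c.2
    refine ⟨c, hc, q1, q2, ?_, ?_⟩ <;> simp only [K] at * <;> omega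
  have cmp : ∀ {c c' : Cell}, c ∈ supp A -> c' ∈ supp A -> D c.1 c.2 = D c'.1 c'.2 -> neLe c c' ∨ neLe c' c := by
    intro c c' h h' hd
    apply neLe_total_of <;> intro hh
    · have := pnA.mono c h c' h' hh; simp only [dD] at *; omega
    · have := pnA.mono c' h' c h hh; simp only [dD] at *; omega
  have Ke : ∀ k, K (e k) := by intro k; simp only [K]; rw [t0, tM]; omega
  have Ksh : ∀ a c, K c -> K (sh m n a c) := by
    intro a c hc; simp only [K, sh, H.per, H₀.per] at *; omega
  have Ush : ∀ a c, ¬ K c -> ¬ K (sh m n a c) := by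
    intro a c hc h
    have := Ksh (-a) _ h
    rw [sh_neg] at this; exact hc this
  have pnU : PN m n l {c | c ∈ supp A ∧ ¬ K c} (dD D) := by
    refine ⟨?_, H.lpos, fun a c hc => ⟨pnA.mem a c hc.1, Ush a c hc.2⟩, fun a c _ => H.dper a c,
      fun c hc c' hc' => pnA.mono c hc.1 c' hc'.1, ?_, fun k => (pnA.fin k).subset fun c hc => ⟨hc.1.1, hc.2⟩⟩
    · obtain ⟨i, j, hij⟩ := hU
      obtain ⟨c, hc, q1, q2, q3⟩ := FR_attain H hm hn fr i j
      refine ⟨c, hc, fun hk => ?_⟩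
      have := Kse (y := (i, j)) hk q3.symm q1 q2
      simp only [K] at this; omega
    · rintro c ⟨hc, hk⟩
      obtain ⟨c', h1, h2, h3⟩ := pnA.pred c hc
      exact ⟨c', ⟨h1, fun hk' => hk (Kedge hk' hc (by simp only [dD] at *; omega) h2)⟩, h2, h3⟩
  have swt : ∀ {c c' y y' : Cell}, K c -> c ∈ supp A -> NW c c' -> y ∈ supp A -> y' ∈ supp A -> ¬ K y' -> NW y y' ->
      D y.1 y.2 = D c.1 c.2 -> D y'.1 y'.2 = D c.1 c.2 + 1 -> neLe y' c' -> neLe y c := by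
    intro c c' y y' hK hc hcc hy hy' hU hyy h1 h2 h3
    rcases cmp hy hc h1 with h | h
    · exact h
    · exact absurd (Kedge hK hy' h2 (switch hcc hyy h h3).1) hU
  have noT : ∀ y ∈ supp A, ¬ K y -> ¬ neLe y (e (D y.1 y.2 + M)) := by
    intro y0 hy0 hyU hyT
    have pnT : PN m n l {c | c ∈ supp A ∧ ¬ K c ∧ neLe c (e (D c.1 c.2 + M))} (dD D) := by
      refine ⟨⟨y0, hy0, hyU, hyT⟩, H.lpos, ?_, fun a c _ => H.dper a c,
        fun c hc c' hc' => pnA.mono c hc.1 c' hc'.1, ?_, fun k => (pnA.fin k).subset fun c hc => ⟨hc.1.1, hc.2⟩⟩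
      · rintro a c ⟨h1, h2, h3⟩
        refine ⟨pnA.mem a c h1, Ush a c h2, ?_⟩
        have := H.dper a c
        simp only [dD] at this
        rw [this, show D c.1 c.2 + a * l + M = D c.1 c.2 + M + a * l by ring, <- S.cn.eqv]
        exact neLe_sh.2 h3
      · rintro c ⟨h1, h2, h3⟩
        obtain ⟨c', ⟨v1, v2⟩, v3, v4⟩ := pnU.pred c ⟨h1, h2⟩
        simp only [dD] at v4
        refine ⟨c', ⟨v1, v2, ?_⟩, v3, v4⟩
        have := (tig (D c'.1 c'.2 + M)).2.2
        rw [show D c'.1 c'.2 + M + 1 = D c.1 c.2 + M by omega] at this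
        have hh := tM (D c'.1 c'.2 + M)
        exact swt (Ke _) (tig _).1 this v1 h1 h2 v3 (by omega) (by omega) h3
    obtain ⟨e', w1, w2, _⟩ := river pnT
    have es' : IsStreamEnum m n e' l := tight_stream lpos w1 w2
    obtain ⟨r, hr⟩ := stream_tight lpos (fun a c hc => S.cn.pn.per a c hc) S.cn.pn.mono es' (fun k => (w1 k).1.1)
    have h1 := S.sw _ hr 0
    have h2 := (w1 (0 + r)).1.2
    have h3 := (w1 (0 + r)).2.1
    have h4 := (hr 0).2.1
    have h5 := le (e' (0 + r)).1 (e' (0 + r)).2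
    simp only [dD, K] at *
    rw [h3] at h2
    have h6 := neLe_trans h1 h2.2
    exact neLe_NW (Tight.mono tig (by have := h2.1; omega)) h6
  have swA : ∀ x ∈ supp A, K x -> ∀ y ∈ supp A, D y.1 y.2 = D x.1 x.2 -> neLe y x -> K y := by
    refine S.cn.gen _ ?_ ?_
    · intro k _ y hy hd hn
      by_contra hU
      apply noT y hy hU
      rwa [hd, tM, sub_add_cancel]
    · intro c hc c' hc' hP hnw hd hK y hy hyd hyn
      by_contra hU
      have h1 := pnA.mono c hc c' hc' hnw
      have h2 := le c.1 c.2
      have hKc : K c := by simp only [dD, K] at *; omega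
      obtain ⟨y1, ⟨v1, v2⟩, v3, v4⟩ := pnU.pred y ⟨hy, hU⟩
      have e1 : D c'.1 c'.2 = D c.1 c.2 + 1 := by simp only [dD, K] at *; omega
      simp only [dD] at v4
      exact v2 (hP hKc y1 v1 (by omega) (swt hKc hc hnw v1 hy hU v3 (by omega) (by omega) hyn))
  have Ksw : ∀ {x y : Cell}, K x -> D y.1 y.2 = D x.1 x.2 -> neLe y x -> K y := by
    intro x y hx hd hn
    obtain ⟨x', a1, a2, a3, a4, a5⟩ := Kat hx
    obtain ⟨y', b1, b2, b3, b4⟩ := FR_attain H hm ‹0 < n› fr y.1 y.2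
    have hn1 := hn.1
    have hn2 := hn.2
    rcases cmp b1 a1 (by omega) with h | h
    · exact Kse (swA x' a1 a5 y' b1 (by omega) h) b4.symm b2 b3
    · have := h.2
      exact Kse a5 (by omega) (by omega) (by omega)
  have noNE : ∀ {i j}, K (i, j) -> D i j < X i := by
    intro i j hz
    by_contra! hX
    have h0 := H.le_X hm i j
    obtain ⟨c', hc', hk⟩ := pnU.level_ne (D i j + 1)
    obtain ⟨c, ⟨v1, v2⟩, v3, v4⟩ := pnU.pred c' hc'
    simp only [dD] at *
    have hrow : i < c'.1 := by
      by_contra! hh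
      have := H.X_mono hm hh
      have := H.le_X hm c'.1 c'.2
      omega
    obtain ⟨x, a1, a2, a3, a4, a5⟩ := Kat hz
    simp only at a2 a3 a4
    have := v3.2
    rcases cmp v1 a1 (by omega) with h | h
    · exact v2 (Ksw a5 (by omega) h)
    · have := h.2
      exact hc'.2 (Kedge a5 hc'.1 (by omega) ⟨by omega, by omega⟩)
  have KB : ∀ {y g : Cell}, K y -> g ∈ supp B -> D g.1 g.2 = D y.1 y.2 + 1 -> NW y g -> K g := by
    intro y g hy hg hd hnw
    have h1 := hnw.1
    have h2 := hnw.2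
    have h3 := (br g.1 g.2).1 hg
    have kp : K (g.1 - 1, g.2 - 1) := Kse hy (by simp only; omega) (by simp only; omega) (by simp only; omega)
    obtain ⟨j', q1, q2, q3, _⟩ := rowA H hn fr hf hg
    have h4 := (fr g.1 j').1 q2
    have k1 : K (g.1 - 1, j' - 1) := Ksw kp (by simp only; omega) ⟨le_rfl, by simp only; omega⟩
    have k2 : K (g.1, j') := Kedge k1 q2 (by simp only; omega) ⟨by simp only; omega, by simp only; omega⟩
    exact Kse k2 q3.symm le_rfl q1
  let TB : Set Cell := {g | g ∈ supp B ∧ K g ∧ (∀ x, K x -> D x.1 x.2 = D g.1 g.2 -> g.1 ≤ x.1) ∧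
    D (g.1 - 1) g.2 = D g.1 g.2 ∧ K (g.1 - 1, g.2 - 1)}
  have TBne : ∀ k, ∃ g ∈ TB, D g.1 g.2 = k := by
    intro k
    obtain ⟨i0, hi0⟩ := H.lowR hm k
    obtain ⟨I, ⟨t, ht1, ht2, ht3⟩, hI⟩ := Int.exists_least_of_bdd
      (P := fun I => ∃ t : Cell, K t ∧ D t.1 t.2 = k ∧ t.1 = I)
      ⟨i0, by rintro _ ⟨t, _, h, rfl⟩; exact (hi0 t.1 t.2 h.ge).le⟩
      ⟨_, e (k + M), Ke _, by rw [tM]; omega, rfl⟩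
    obtain ⟨u, hu, huk⟩ := pnU.level_ne k
    simp only [dD] at huk
    have huI : u.1 < I := by
      by_contra! hh
      rcases le_or_gt t.2 u.2 with h | h
      · exact hu.2 (Kse ht1 (by omega) (by omega) h)
      · exact hu.2 (Ksw ht1 (by omega) ⟨by omega, by omega⟩)
    obtain ⟨J, hJ⟩ := H.lowC hn k
    obtain ⟨j', h1, h2, h3, h4⟩ := H.findE (i := I) (a := J) (b := t.2) (k := k - 1)
      (by by_contra! hh; have := hJ I J (by omega); omega) (by rw [<- ht3]; omega)
    have kt : K (I, j' + 1) := Ksw ht1 (by simp only; omega) ⟨by simp only; omega, by simp only; omega⟩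
    have hAt : A I (j' + 1) ≠ 0 := by
      intro h0
      have e1 := (S.fr I (j' + 1)).2 h0
      have e2 := le I j'
      have e3 := le (I - 1) (j' + 1)
      have e4 := H.row I (j' + 1)
      simp only [add_sub_cancel_right, K] at *
      have := hI (I - 1) ⟨(I - 1, j' + 1), by simp only; omega, by simp only; omega, rfl⟩
      omega
    have kp : K (I - 1, j') := by
      have e1 := (S.fr I (j' + 1)).1 hAt
      have e2 := (fr I (j' + 1)).1 hAt
      simp only [add_sub_cancel_right, K] at *
      omega
    have e2 := (fr I (j' + 1)).1 hAt
    simp only [add_sub_cancel_right] at e2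
    obtain ⟨j, r1, r2, r3, r4, r5⟩ := rowB H hm fr hf hAt (by
      have := H.le_X hm (I - 1) u.2
      have := H.monoR u.2 (show u.1 ≤ I - 1 by omega)
      omega)
    refine ⟨(I, j), ⟨r2, Kse kt (by simp only; omega) le_rfl r1, ?_, by simp only; omega, ?_⟩, by simp only; omega⟩
    · intro x hx hd; exact hI _ ⟨x, hx, by simp only at hd; omega, rfl⟩
    · exact Kse kp (by simp only; omega) le_rfl (by simp only; omega)
  have TBnw : ∀ s ∈ TB, ∀ g ∈ TB, D g.1 g.2 = D s.1 s.2 + 1 -> NW s g := by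
    rintro s ⟨s1, s2, s3, s4, s5⟩ g ⟨g1, g2, g3, g4, g5⟩ hd
    have hp := (br g.1 g.2).1 g1
    have h1 := s3 _ g5 (by simp only; omega)
    simp only at h1
    refine ⟨by omega, ?_⟩
    by_contra! h2
    obtain ⟨i', r1, r2, r3, r4⟩ := H.findS (j := s.2) (a := s.1) (b := g.1) (k := D s.1 s.2) le_rfl
      (by have := H.monoC g.1 h2; omega)
    have kw : K (i', s.2) := Kse s2 r3 r1 le_rfl
    obtain ⟨j', t1, t2, t3, t4, t5⟩ := cornerE H hm br r3 r4 (by have := noNE kw; omega)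
    have kw' : K (i', j') := Kse kw (by simp only; omega) le_rfl t1
    have kg : K (i' + 1, j' + 1) := KB kw' t4 (by simp only; omega) ⟨by simp only; omega, by simp only; omega⟩
    have h3 := g3 _ kg (by simp only; omega)
    simp only at h3
    have h4 := H.monoC (g.1 - 1) h2
    rw [show g.1 - 1 = i' by omega] at h4 g4
    omega
  have TBmono : ∀ c ∈ supp B, ∀ c' ∈ supp B, NW c c' -> dD D c < dD D c' :=
    fun c _ c' h' h => BR_mono H br h h'
  have PB := GAP_per gB
  have pnTB : PN m n l TB (dD D) := by
    refine ⟨?_, H.lpos, ?_, fun a c _ => H.dper a c, fun c hc c' hc' => TBmono c hc.1 c' hc'.1, ?_, ?_⟩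
    · obtain ⟨g, hg, _⟩ := TBne 0
      exact ⟨g, hg⟩
    · rintro a g ⟨g1, g2, g3, g4, g5⟩
      refine ⟨PB.mem a g g1, Ksh a g g2, ?_, ?_, ?_⟩
      · intro x hx hd
        have h1 := g3 (sh m n (-a) x) (Ksh _ _ hx) (by
          have := H.dper (-a) x
          have := H.dper a g
          simp only [dD] at *; linarith)
        simp only [sh] at *; linarith
      · have := H.per a (g.1 - 1) g.2
        have := H.per a g.1 g.2
        simp only [sh]
        rw [show g.1 + a * m - 1 = g.1 - 1 + a * m by ring]; omega
      · have := Ksh a _ g5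
        simp only [sh] at *
        rwa [show g.1 + a * m - 1 = g.1 - 1 + a * m by ring, show g.2 + a * n - 1 = g.2 - 1 + a * n by ring]
    · intro c hc
      obtain ⟨g, hg, hgk⟩ := TBne (D c.1 c.2 - 1)
      exact ⟨g, hg, TBnw g hg c hc (by omega), hgk⟩
    · intro k
      refine (PB.fin hn H.lpos (d := dD D) (fun a c _ => H.dper a c) k).subset fun c hc => ⟨hc.1.1, hc.2⟩
  obtain ⟨eB, w1, w2, _⟩ := river pnTB
  have esB : IsStreamEnum m n eB l := tight_stream lpos w1 w2
  obtain ⟨D', X', Y', e', S', i, hi⟩ := hyp eB esB (fun k => (w1 k).1.1)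
  have H' := S'.H
  have tig' := S'.cn.tight
  have es' : IsStreamEnum m n e' l := tight_stream lpos tig' S'.cn.eqv
  obtain ⟨f, tf⟩ : ∃ f, ∀ k, D (e' k).1 (e' k).2 = k - f := by
    obtain ⟨r, hr⟩ := stream_tight lpos (fun a c _ => H.dper a c) TBmono es' (fun k => (tig' k).1)
    refine ⟨r, fun k => ?_⟩
    have := (hr (k - r)).2.1
    simpa [dD] using this
  have Ke' : ∀ k, K (e' k) := by
    intro k
    obtain ⟨r, hr⟩ := stream_tight lpos (fun a c hc => S'.cn.pn.per a c hc) S'.cn.pn.mono esB (fun k => (w1 k).1.1)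
    have h1 := S'.sw _ hr k
    have h2 := hi i
    obtain h3 := (w1 (k - f)).2.1
    simp only [dD] at h3
    rcases neLe_total_of (c := e' k) (c' := eB (k - f))
      (fun h => by have := TBmono _ (tig' k).1 _ (w1 (k - f)).1.1 h; simp only [dD, tf] at this; omega)
      (fun h => by have := TBmono _ (w1 (k - f)).1.1 _ (tig' k).1 h; simp only [dD, tf] at this; omega) with h | h
    · exact Ksw (w1 (k - f)).1.2.1 (by rw [tf]; omega) h
    · have h4 := neLe_trans h h1
      rcases lt_trichotomy (k - f) (k + r) with h5 | h5 | h5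
      · exact absurd h4 (neLe_NW (Tight.mono w1 h5))
      · rw [<- h5] at h4 h1
        have := neLe_antisymm h h1
        rw [<- this]; exact (w1 _).1.2.1
      · have h6 := Tight.mono w1 h5
        have h7 := h6.2
        have h8 := h4.2
        omega
  have genK : ∀ g ∈ supp B, D' g.1 g.2 - D g.1 g.2 ≤ f ∧ (D' g.1 g.2 - D g.1 g.2 = f -> K g) := by
    refine S'.cn.gen _ ?_ ?_
    · intro k
      have := (tig' k).2.1
      simp only [dD] at this
      exact ⟨by rw [this, tf]; omega, fun _ => Ke' k⟩
    · intro c hc c' hc' ⟨h1, h2⟩ hnw hd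
      have := TBmono c hc c' hc' hnw
      simp only [dD] at *
      exact ⟨by omega, fun h3 => KB (h2 (by omega)) hc' (by omega) hnw⟩
  obtain ⟨J, hJ⟩ := H.X_at hm i
  obtain ⟨J', hJ'⟩ := H'.X_at hm i
  have z1 := hJ _ (le_max_left J J')
  have z2 := hJ' _ (le_max_right J J')
  obtain ⟨c, hc, q1, q2, q3⟩ := FR_attain H' hm hn S'.fr i (max J J')
  have h1 := genK c hc
  have h2 := H.mono q1 q2
  have h3 := hi (e' 0).1 (e' 0).2
  have h4 := (tig' 0).2.1
  simp only [dD] at h4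
  rw [h4, tf] at h3
  have kc := h1.2 (by omega)
  have kz : K (i, max J J') := Kse kc (by simp only; omega) q1 q2
  have := noNE kz
  omega
end
end
section
section
variable {m n l : Nat} {D D₁ : Int -> Int -> Int} {X Y : Int -> Int} {A B : Mat} {e : Int -> Cell}
def ng (c : Cell) : Cell := (-c.1, -c.2)
lemma ng_ng (c : Cell) : ng (ng c) = c := by simp [ng]
lemma ng_sh (a : Int) (c : Cell) : ng (sh m n a c) = sh m n (-a) (ng c) := by
  simp only [ng, sh, Prod.mk.injEq]; constructor <;> ring
lemma NW_ng {c c' : Cell} (h : NW c c') : NW (ng c') (ng c) := by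
  simp only [NW, ng] at *; omega
lemma succ_stream (hn : 0 < n) (gB : IsGAP m n B) (H : Hgt m n l D X Y) (br : BR B D) {Z : Set Cell}
    (hZ : Z ⊆ supp B) (ne : Z.Nonempty) (zs : ∀ a, ∀ c ∈ Z, sh m n a c ∈ Z)
    (suc : ∀ c ∈ Z, ∃ c' ∈ Z, NW c c' ∧ D c'.1 c'.2 = D c.1 c.2 + 1) :
    ∃ e, IsStreamEnum m n e l ∧ (∀ k, e k ∈ Z) ∧ ∀ k, D (e k).1 (e k).2 = k := by
  have hdp : ∀ a c, - dD D (ng (sh m n a c)) = - dD D (ng c) + a * l := by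
    intro a c
    rw [ng_sh, H.dper]; ring
  have pn : PN m n l {c | ng c ∈ Z} (fun c => - dD D (ng c)) := by
    refine ⟨?_, H.lpos, ?_, fun a c _ => hdp a c, ?_, ?_, ?_⟩
    · obtain ⟨c, hc⟩ := ne
      exact ⟨ng c, by simpa [ng_ng] using hc⟩
    · intro a c hc
      simp only [Set.mem_ofPred_eq] at *
      rw [ng_sh]; exact zs _ _ hc
    · intro c hc c' hc' h
      have := BR_mono H br (NW_ng h) (hZ hc)
      simp only [dD] at *; omega
    · intro c hc
      obtain ⟨c', h1, h2, h3⟩ := suc _ hc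
      refine ⟨ng c', by simpa [ng_ng] using h1, by simpa [ng_ng] using NW_ng h2, ?_⟩
      simp only [dD, ng_ng]; omega
    · intro k
      have := ((GAP_per gB).fin hn H.lpos (fun a c _ => H.dper a c) (-k))
      refine (this.image ng).subset ?_
      rintro c ⟨h1, h2⟩
      exact ⟨ng c, ⟨hZ h1, by omega⟩, ng_ng c⟩
  obtain ⟨e, h1, h2, _⟩ := river pn
  refine ⟨fun k => ng (e (-k)), ⟨by exact_mod_cast H.lpos, fun k => ?_, fun k => ?_⟩, fun k => (h1 _).1, fun k => ?_⟩
  · have := (h1 (-(k + 1))).2.2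
    rw [show -(k + 1) + 1 = -k by ring] at this
    exact NW_ng this
  · rw [tauC_eq, show (1 : Int) = -(-1) by ring, <- ng_sh, h2]
    congr 2; ring
  · have := (h1 (-k)).2.1
    simp only [dD] at this ⊢; omega
theorem T5 (hm : 0 < m) (hn : 0 < n) (hA : IsGAP m n A) (S : SWD m n l A D₁ X Y e) (hf : FL A B D₁)
    (H : Hgt m n l D X Y) (br : BR B D) (le : ∀ i j, D₁ i j ≤ D i j) : D = D₁ := by
  have H₁ := S.H
  have gB : IsGAP m n B := (GAP_FL H₁ hm hn hf).1 hA
  have br₁ := FR_BR H₁ S.fr hf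
  obtain ⟨M, ⟨i0, j0, h0⟩, hM⟩ := diff_max hm hn H₁ H
  rcases le_or_gt M 0 with hM0 | hM0
  · funext i j
    have := hM i j; have := le i j; omega
  exfalso
  have corner : ∀ x : Cell, D x.1 x.2 - D₁ x.1 x.2 = M -> ∃ c ∈ supp B, D c.1 c.2 - D₁ c.1 c.2 = M ∧ NW x c ∧
      D₁ c.1 c.2 = D₁ x.1 x.2 + 1 := by
    rintro ⟨i, j⟩ hx
    simp only at hx
    have b1 := H.le_Y hn i j
    obtain ⟨I, hI⟩ := H₁.Y_at hn j
    obtain ⟨i', c1, _, c2, c3⟩ := H₁.findS (j := j) (a := i) (b := I) (k := D₁ i j) le_rfl (by rw [hI I le_rfl]; omega)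
    have d1 := H.monoR j c1
    have d2 := hM i' j
    have b2 := H.le_X hm i' j
    obtain ⟨j', p1, p2, p3, p4, p5⟩ := cornerE H₁ hm br₁ c2 c3 (by omega)
    have q1 := H.mono c1 p1
    have q2 := (br (i' + 1) (j' + 1)).1 p4
    have q3 := hM (i' + 1) (j' + 1)
    simp only [add_sub_cancel_right] at q2
    refine ⟨(i' + 1, j' + 1), p4, ?_, ⟨?_, ?_⟩, p5⟩ <;> simp only <;> omega
  obtain ⟨e1, s1, s2, s3⟩ := succ_stream (Z := {c | c ∈ supp B ∧ D c.1 c.2 - D₁ c.1 c.2 = M}) hn gB H₁ br₁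
    (fun c hc => hc.1)
    (by obtain ⟨c, h1, h2, _⟩ := corner (i0, j0) h0; exact ⟨c, h1, h2⟩)
    (by rintro a c ⟨h1, h2⟩
        refine ⟨(GAP_per gB).mem a c h1, ?_⟩
        simp only [sh, H.per, H₁.per] at *; omega)
    (by rintro c ⟨h1, h2⟩
        obtain ⟨c', a1, a2, a3, a4⟩ := corner c h2
        exact ⟨c', ⟨a1, a2⟩, a3, a4⟩)
  have mono₁ : ∀ c ∈ supp B, ∀ c' ∈ supp B, NW c c' -> dD D₁ c < dD D₁ c' := fun c _ c' h h' => BR_mono H₁ br₁ h' h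
  obtain ⟨d, hd⟩ := CN_exists hm hn gB s1 (fun k => (s2 k).1) (fun e' l' h1 h2 => by
    exact_mod_cast flow_le_of_mono (fun a c _ => H₁.dper a c) mono₁ h1 h2)
  have cn := CN_of gB hn s1 (fun k => (s2 k).1) hd
  obtain ⟨D2, X2, Y2, H2, fr2, hD2⟩ := Ext hm hn gB cn.pn
  have key : ∀ c ∈ supp B, D2 c.1 c.2 - D₁ c.1 c.2 ≤ 0 ∧ (D2 c.1 c.2 - D₁ c.1 c.2 = 0 -> D c.1 c.2 - D₁ c.1 c.2 = M) := by
    refine cn.gen _ (fun k => ?_) ?_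
    · have := (cn.tight k).2.1
      rw [hD2 _ (s2 k).1] at this
      have := s3 k
      have := (s2 k).2
      omega
    · intro c hc c' hc' h1 h2 h3
      rw [hD2 c hc, hD2 c' hc'] at h3
      have := mono₁ c hc c' hc' h2
      have := BR_mono H br h2 hc'
      have := hM c'.1 c'.2
      simp only [dD] at *
      omega
  have key2 : ∀ i j, D2 i j - D₁ i j ≤ 0 := by
    intro i j
    obtain ⟨c, a1, a2, a3, a4⟩ := FR_attain H2 hm hn fr2 i j
    have := (key c a1).1
    have := H₁.mono a2 a3
    omega
  obtain ⟨i, hi⟩ := domNE hm hn hA S hf H2 fr2 key2 ⟨(e1 0).1, (e1 0).2, by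
    have := (cn.tight 0).2.1
    rw [hD2 _ (s2 0).1] at this
    have := s3 0
    omega⟩
  obtain ⟨J1, hJ1⟩ := H₁.X_at hm i
  obtain ⟨J2, hJ2⟩ := H2.X_at hm i
  have y1 := hJ1 (max J1 J2) (le_max_left _ _)
  have y2 := hJ2 (max J1 J2) (le_max_right _ _)
  obtain ⟨c, a1, a2, a3, a4⟩ := FR_attain H2 hm hn fr2 i (max J1 J2)
  have := key c a1
  have := H₁.mono a2 a3
  have := H.mono a2 a3
  have := H.le_X hm i (max J1 J2)
  omega
end
end
section
def Gal (x X : Int -> Int) : Prop := ∀ k i, x k ≤ i ↔ k ≤ X i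
structure Str (m l : Nat) (x : Int -> Int) : Prop where
  lt : ∀ k, x k < x (k + 1)
  per : ∀ a k, x (k + a * l) = x k + a * m
structure XF (m l : Nat) (X : Int -> Int) : Prop where
  step : ∀ i, X (i - 1) ≤ X i ∧ X i ≤ X (i - 1) + 1
  per : ∀ a i, X (i + a * m) = X i + a * l
lemma Str.add {m l : Nat} {x : Int -> Int} (h : Str m l x) (k : Int) (j : Nat) : x k + j ≤ x (k + j) := by
  induction j with
  | zero => simp
  | succ j ih =>
    have := h.lt (k + j)
    push_cast
    rw [show k + ((j : Int) + 1) = k + j + 1 by ring]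
    omega
lemma Str.mono {m l : Nat} {x : Int -> Int} (h : Str m l x) {k k' : Int} (hk : k ≤ k') : x k + (k' - k) ≤ x k' := by
  have := h.add k (k' - k).toNat
  rw [show k + ((k' - k).toNat : Int) = k' by omega] at this
  omega
lemma Str.le_iff {m l : Nat} {x : Int -> Int} (h : Str m l x) {k k' : Int} : x k ≤ x k' ↔ k ≤ k' := by
  constructor
  · intro hk
    by_contra hh
    have := h.mono (show k' ≤ k by omega); omega
  · intro hk
    have := h.mono hk; omega
lemma Gal_str {m l : Nat} {x X : Int -> Int} (hX : XF m l X) (h : Gal x X) : Str m l x := by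
  constructor
  · intro k
    have h1 := (h (k + 1) _).1 le_rfl
    have h2 := hX.step (x (k + 1))
    have := (h k (x (k + 1) - 1)).2 (by omega)
    omega
  · intro a k
    have h1 : ∀ i, x (k + a * l) ≤ i ↔ x k + a * m ≤ i := by
      intro i
      have h2 := hX.per a (i - a * m)
      rw [sub_add_cancel] at h2
      rw [h, h2, add_le_add_iff_right, <- h]; omega
    exact le_antisymm ((h1 _).2 le_rfl) ((h1 _).1 le_rfl)
lemma Gal_of_X {m l : Nat} (hl : 0 < l) {X : Int -> Int} (hX : XF m l X) : ∃ x, Gal x X := by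
  have hl' : (0 : Int) < l := by exact_mod_cast hl
  have : ∀ k, ∃ a, ∀ i, a ≤ i ↔ k ≤ X i := by
    intro k
    obtain ⟨i0, hi0⟩ := low_of (f := X) hl' (fun x => (hX.step x).1) hX.per k
    obtain ⟨a, h1, h2⟩ := Int.exists_least_of_bdd (P := fun i => k ≤ X i) ⟨i0, fun z hz => (hi0 z hz).le⟩
      ⟨0 + |k - X 0| * m, by
        rw [hX.per]
        have := le_abs_self (k - X 0)
        nlinarith [abs_nonneg (k - X 0)]⟩
    refine ⟨a, fun i => ⟨fun h => h1.trans (mono_of_step (fun x => (hX.step x).1) h), h2 i⟩⟩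
  choose x hx using this
  exact ⟨x, hx⟩
lemma Gal_of_x {m l : Nat} (hm : 0 < m) {x : Int -> Int} (h : Str m l x) : ∃ X, Gal x X ∧ XF m l X := by
  have hm' : (0 : Int) < m := by exact_mod_cast hm
  have : ∀ i, ∃ a, ∀ k, x k ≤ i ↔ k ≤ a := by
    intro i
    obtain ⟨a, h1, h2⟩ := Int.exists_greatest_of_bdd (P := fun k => x k ≤ i) ⟨|i - x 0|, fun z hz => by
        rcases le_or_gt z 0 with h0 | h0
        · exact h0.trans (abs_nonneg _)
        · have := h.mono h0.le
          have := le_abs_self (i - x 0); omega⟩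
      ⟨0 + (- |i - x 0|) * l, by
        rw [h.per]
        have := neg_abs_le (i - x 0)
        nlinarith [abs_nonneg (i - x 0)]⟩
    exact ⟨a, fun k => ⟨h2 k, fun hk => (h.le_iff.2 hk).trans h1⟩⟩
  choose X hX using this
  have G : Gal x X := fun k i => hX i k
  refine ⟨X, G, fun i => ?_, fun a i => ?_⟩
  · have h1 := (G _ i).2 le_rfl
    have h2 := h.lt (X i - 1)
    rw [sub_add_cancel] at h2
    have := (G (X i - 1) (i - 1)).1 (by omega)
    have h3 := (G _ (i - 1)).2 le_rfl
    have := (G (X (i - 1)) i).1 (by omega)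
    omega
  · have h1 : ∀ k, k ≤ X (i + a * m) ↔ k ≤ X i + a * l := by
      intro k
      have h2 := h.per a (k - a * l)
      rw [sub_add_cancel] at h2
      rw [<- G, h2, add_le_add_iff_right, G]; omega
    exact le_antisymm ((h1 _).1 le_rfl) ((h1 _).2 le_rfl)
lemma gal_dom {x x' X X' : Int -> Int} {K K1 K2 : Int} (h : Gal (fun k => x (k + K1)) X)
    (h' : Gal (fun k => x' (k + K2)) X') : (∀ i, x i ≤ x' (i + K)) ↔ ∀ i, X' i - X i ≤ K + K1 - K2 := by
  constructor
  · intro hx i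
    have h1 := (h' (X' i) i).2 le_rfl
    have h2 := hx (X' i + K2 - K)
    rw [sub_add_cancel] at h2
    have h3 := (h (X' i + K2 - K - K1) i).1 (by simpa only [sub_add_cancel] using h2.trans h1)
    omega
  · intro hX i
    have h1 := (h' (i + K - K2) (x' (i + K))).1 (by simp)
    have h2 := hX (x' (i + K))
    have := (h (i - K1) (x' (i + K))).2 (by omega)
    simpa using this
lemma Hgt.XF {m n l : Nat} {D X Y} (H : Hgt m n l D X Y) (hm : 0 < m) : XF m l X := ⟨H.X_step hm, H.X_per hm⟩
lemma Hgt.YF {m n l : Nat} {D X Y} (H : Hgt m n l D X Y) (hn : 0 < n) : AffineRSK.XF n l Y := ⟨H.Y_step hn, H.Y_per hn⟩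
lemma Hgt.add {m n : Nat} {l : Int} {D X Y} (H : Hgt m n l D X Y) (c : Int) :
    Hgt m n l (fun i j => D i j + c) (fun i => X i + c) (fun i => Y i + c) := by
  refine ⟨H.lpos, fun i j => ?_, fun i j => ?_, fun a i j => ?_, ?_, ?_⟩
  · have := H.row i j; omega
  · have := H.col i j; omega
  · have := H.per a i j; omega
  · obtain ⟨N, h⟩ := H.hX
    exact ⟨N, fun i j hij => by rw [h i j hij]⟩
  · obtain ⟨N, h⟩ := H.hY
    exact ⟨N, fun i j hij => by rw [h i j hij]⟩
lemma XY_add {m n : Nat} (hm : 0 < m) (hn : 0 < n) {l : Int} {D X Y D' X' Y'} (H : Hgt m n l D X Y) (H' : Hgt m n l D' X' Y')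
    {c : Int} (h : ∀ i j, D' i j = D i j + c) : (∀ i, X' i = X i + c) ∧ ∀ j, Y' j = Y j + c := by
  constructor
  · intro i
    obtain ⟨J, h1⟩ := H.X_at hm i
    obtain ⟨J', h2⟩ := H'.X_at hm i
    rw [<- h1 (max J J') (le_max_left _ _), <- h2 (max J J') (le_max_right _ _), h]
  · intro i
    obtain ⟨J, h1⟩ := H.Y_at hn i
    obtain ⟨J', h2⟩ := H'.Y_at hn i
    rw [<- h1 (max J J') (le_max_left _ _), <- h2 (max J J') (le_max_right _ _), h]
section
variable {m n l l' : Nat} {D D' : Int -> Int -> Int} {X Y X' Y' x y x' y' : Int -> Int} {A B C A' : Mat} {e e' : Int -> Cell}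
lemma SWD.str (S : SWD m n l A D X Y e) : IsStreamEnum m n e l :=
  tight_stream (by exact_mod_cast S.H.lpos) S.cn.tight S.cn.eqv
lemma stepData (hm : 0 < m) (hn : 0 < n) (hA : IsGAP m n A) {d : Cell -> Int}
    (he : IsSWChannelEnum m n A e) (hd : IsChannelNumbering A e d) :
    ∃ (l : Nat) (D : Int -> Int -> Int) (X Y : Int -> Int), SWD m n l A D X Y e ∧ IsChannelNumbering A e (dD D) ∧
      ∀ c ∈ supp A, d c = D c.1 c.2 := by
  obtain ⟨l, h1, cn, _⟩ := SW_formal hn hA he hd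
  obtain ⟨D, X, Y, H, fr, hD⟩ := Ext hm hn hA cn.pn
  have hd' : IsChannelNumbering A e (dD D) := fun c hc => by
    have := hd c hc
    rwa [hD c hc] at this
  obtain ⟨_, _, _, h3⟩ := SW_formal hn hA he hd'
  exact ⟨l, D, X, Y, ⟨H, fr, CN_of hA hn h1 (fun k => (cn.tight k).1) hd', h3⟩, hd', hD⟩
lemma SWD_unique (hm : 0 < m) (hn : 0 < n) (S : SWD m n l A D X Y e)
    (S' : SWD m n l' A D' X' Y' e') : l = l' ∧ ∃ r, ∀ i j, D' i j = D i j + r := by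
  have hl : l = l' := by
    have h1 := flow_le_of_mono S.cn.pn.per S.cn.pn.mono S'.str (fun k => (S'.cn.tight k).1)
    have h2 := flow_le_of_mono S'.cn.pn.per S'.cn.pn.mono S.str (fun k => (S.cn.tight k).1)
    omega
  subst hl
  refine ⟨rfl, ?_⟩
  have lpos := S.str.1
  obtain ⟨r, hr⟩ := stream_tight lpos S.cn.pn.per S.cn.pn.mono S'.str (fun k => (S'.cn.tight k).1)
  obtain ⟨r', hr'⟩ := stream_tight lpos S'.cn.pn.per S'.cn.pn.mono S.str (fun k => (S.cn.tight k).1)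
  have h1 := S.sw _ hr
  have h2 := S'.sw _ hr'
  have h3 : ∀ k, neLe (e k) (e (k + r + r')) := fun k => neLe_trans (h1 k) (h2 (k + r))
  have h4 : r + r' = 0 := by
    rcases lt_trichotomy (r + r') 0 with h | h | h
    · have h5 := h3 0
      have h6 := Tight.mono S.cn.tight (show 0 + r + r' < 0 by omega)
      have := h5.2; have := h6.2; omega
    · exact h
    · exact (neLe_NW (Tight.mono S.cn.tight (show 0 < 0 + r + r' by omega)) (h3 0)).elim
  have h5 : ∀ k, e k = e' (k + r) := by
    intro k
    have := h2 (k + r)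
    simp only [add_assoc, h4, add_zero] at this
    exact neLe_antisymm (h1 k) this
  have t : ∀ k, D (e k).1 (e k).2 = k := fun k => (S.cn.tight k).2.1
  have t' : ∀ k, D' (e' k).1 (e' k).2 = k := fun k => (S'.cn.tight k).2.1
  have le1 : ∀ c ∈ supp A, D' c.1 c.2 ≤ D c.1 c.2 + r := by
    refine S'.cn.gen _ (fun k => ?_) ?_
    · have h6 := t (k - r)
      rw [h5, sub_add_cancel] at h6
      rw [t', h6]; omega
    · intro c hc c' hc' h1 h2 h3
      have := S.cn.pn.mono c hc c' hc' h2
      simp only [dD] at *; omega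
  have le2 : ∀ c ∈ supp A, D c.1 c.2 + r ≤ D' c.1 c.2 := by
    refine S.cn.gen _ (fun k => ?_) ?_
    · rw [t, h5, t']
    · intro c hc c' hc' h1 h2 h3
      have := S'.cn.pn.mono c hc c' hc' h2
      simp only [dD] at *; omega
  refine ⟨r, fun i j => ?_⟩
  obtain ⟨c, a1, a2, a3, a4⟩ := FR_attain S.H hm hn S.fr i j
  obtain ⟨c', b1, b2, b3, b4⟩ := FR_attain S'.H hm hn S'.fr i j
  have := le1 c' b1
  have := le2 c a1
  have := S.H.mono b2 b3
  have := S'.H.mono a2 a3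
  omega
def Step (m n : Nat) (A B : Mat) (x y : Int -> Int) (l : Nat) : Prop := ∃ D X Y e K, IsSWChannelEnum m n A e ∧
  IsChannelNumbering A e (dD D) ∧ SWD m n l A D X Y e ∧ FL A B D ∧ Gal (fun k => x (k + K)) X ∧
  Gal (fun k => y (k + K)) Y
lemma Str.unshift {K : Int} (h : Str m l (fun k => x (k + K))) : Str m l x := by
  constructor
  · intro k
    have := h.lt (k - K)
    simp only [sub_add_cancel] at this
    rwa [show k - K + 1 + K = k + 1 by ring] at this
  · intro a k
    have := h.per a (k - K)
    simp only [sub_add_cancel] at this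
    rwa [show k - K + a * l + K = k + a * l by ring] at this
lemma Step.strx (hm : 0 < m) (h : Step m n A B x y l) : Str m l x := by
  obtain ⟨D, X, Y, e, K, -, -, h1, -, h2, -⟩ := h
  exact (Gal_str (h1.H.XF hm) h2).unshift
lemma Step.stry (hn : 0 < n) (h : Step m n A B x y l) : Str n l y := by
  obtain ⟨D, X, Y, e, K, -, -, h1, -, -, h2⟩ := h
  exact (Gal_str (h1.H.YF hn) h2).unshift
lemma Step.lpos (h : Step m n A B x y l) : 0 < l := by
  obtain ⟨D, X, Y, e, K, -, -, h1, -, h2, -⟩ := h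
  exact h1.str.1
lemma Step.lle (h : Step m n A B x y l) : l ≤ m ∧ l ≤ n := by
  obtain ⟨D, X, Y, e, K, -, -, h1, -, h2, -⟩ := h
  exact stream_flow_le h1.str
lemma Step.gap (hm : 0 < m) (hn : 0 < n) (hA : IsGAP m n A) (h : Step m n A B x y l) :
    IsGAP m n B ∧ Hsum n B < Hsum n A ∧ A ≠ 0 := by
  obtain ⟨D, X, Y, e, K, -, -, h1, h2, -⟩ := h
  refine ⟨(GAP_FL h1.H hm hn h2).1 hA, Hsum_FL h1.H hm hn hA h2, ?_⟩
  rintro rfl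
  exact (h1.cn.tight 0).1 rfl
theorem Th1 (hm : 0 < m) (hn : 0 < n) (hA : IsGAP m n A) (h0 : A ≠ 0) : ∃ B x y l, Step m n A B x y l := by
  obtain ⟨e, d, h1, h2⟩ := SW_exists hm hn hA h0
  obtain ⟨l, D, X, Y, S, h3, -⟩ := stepData hm hn hA h1 h2
  obtain ⟨B, hB⟩ := FL_exists S.H S.fr
  obtain ⟨x, hx⟩ := Gal_of_X S.str.1 (S.H.XF hm)
  obtain ⟨y, hy⟩ := Gal_of_X S.str.1 (S.H.YF hn)
  exact ⟨B, x, y, l, D, X, Y, e, 0, h1, h3, S, hB, by simpa using hx, by simpa using hy⟩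
lemma Gal_shift {K K' r : Int} (h : Gal (fun k => x (k + K)) X) (h' : Gal (fun k => x' (k + K')) X')
    (hr : ∀ i, X' i = X i + r) (k : Int) : x' k = x (k - r - K' + K) := by
  have : ∀ i, x' k ≤ i ↔ x (k - r - K' + K) ≤ i := by
    intro i
    have h1 := h' (k - K') i
    have h2 := h (k - r - K') i
    simp only [sub_add_cancel] at h1
    rw [h1, h2, hr]; omega
  exact le_antisymm ((this _).2 le_rfl) ((this _).1 le_rfl)
theorem Th2 (hm : 0 < m) (hn : 0 < n) (h : Step m n A B x y l)
    (h' : Step m n A C x' y' l') : B = C ∧ l = l' ∧ ∃ K, (∀ k, x' k = x (k + K)) ∧ ∀ k, y' k = y (k + K) := by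
  obtain ⟨D, X, Y, e, K, -, -, S, f, g1, g2⟩ := h
  obtain ⟨D', X', Y', e', K', -, -, S', f', g1', g2'⟩ := h'
  obtain ⟨rfl, r, hr⟩ := SWD_unique hm hn S S'
  refine ⟨?_, rfl, ?_⟩
  · funext i j
    have h1 := f i j
    have h2 := f' i j
    simp only [hr] at h2
    omega
  · obtain ⟨h1, h2⟩ := XY_add hm hn S.H S'.H hr
    refine ⟨- r - K' + K, fun k => ?_, fun k => ?_⟩
    · rw [Gal_shift g1 g1' h1 k]; congr 1; ring
    · rw [Gal_shift g2 g2' h2 k]; congr 1; ring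
theorem Th3 (hm : 0 < m) (hn : 0 < n) (hA : IsGAP m n A) (h : Step m n A B x y l)
    (h' : Step m n B C x' y' l') : l' ≤ l ∧ (l' = l -> ∀ K, (∀ i, x i ≤ x' (i + K)) -> ∀ i, y i ≤ y' (i + K)) := by
  obtain ⟨D, X, Y, e, K1, -, -, S, f, g1, g2⟩ := h
  obtain ⟨D', X', Y', e', K2, -, -, S', f', g1', g2'⟩ := h'
  have br := FR_BR S.H S.fr f
  constructor
  · have := flow_le_of_mono (S := supp B) (d := dD D) (fun a c _ => S.H.dper a c)
      (fun c _ c' h h' => BR_mono S.H br h' h) S'.str (fun k => (S'.cn.tight k).1)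
    omega
  rintro rfl K hK
  obtain ⟨M, h1, h2⟩ := diff_max hm hn S.H S'.H
  obtain ⟨i, hi⟩ := domNE hm hn hA S f S'.H S'.fr h2 h1
  have h3 := (gal_dom g1 g1').1 hK i
  refine (gal_dom g2 g2').2 fun j => ?_
  obtain ⟨J, h4⟩ := S.H.Y_at hn j
  obtain ⟨J', h5⟩ := S'.H.Y_at hn j
  have := h4 (max J J') (le_max_left _ _)
  have := h5 (max J J') (le_max_right _ _)
  have := h2 (max J J') j
  omega
theorem Th4 (hm : 0 < m) (hn : 0 < n) (hl : 0 < l) (gB : IsGAP m n B) (sx : Str m l x) (sy : Str n l y)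
    (hB : B = 0 ∨ ∃ C x' y' l', Step m n B C x' y' l' ∧ l' ≤ l ∧
      (l' = l -> ∀ K, (∀ i, x i ≤ x' (i + K)) -> ∀ i, y i ≤ y' (i + K))) :
    ∃ A, IsGAP m n A ∧ Step m n A B x y l := by
  obtain ⟨X, gX, fX⟩ := Gal_of_x hm sx
  obtain ⟨Y, gY, fY⟩ := Gal_of_x hn sy
  obtain ⟨D, H, br, mx⟩ := maxSol hm hn (by exact_mod_cast hl) gB fX.step fY.step fX.per fY.per (by
    refine hB.imp_right ?_
    rintro ⟨C, x', y', l', ⟨D', X', Y', e', K, -, -, S, -⟩, h2, -⟩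
    exact ⟨l', D', X', Y', by exact_mod_cast h2, S.H, S.fr⟩)
  obtain ⟨A, hf⟩ := FL_exists' H br
  have fr := BR_FR H br hf
  have gA : IsGAP m n A := (GAP_FL H hm hn hf).2 gB
  have pn := FR_PN H hm hn gA fr
  have hA0 : A ≠ 0 := by
    rintro rfl
    obtain ⟨c, hc⟩ := pn.ne
    exact hc rfl
  obtain ⟨e, d, h1, h2⟩ := SW_exists hm hn gA hA0
  obtain ⟨l₀, D₀, X₀, Y₀, S, h3, -⟩ := stepData hm hn gA h1 h2
  have hl₀ : l₀ = l := by
    have q1 := flow_le_of_mono pn.per pn.mono S.str (fun k => (S.cn.tight k).1)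
    obtain ⟨e1, w1, w2, -⟩ := river pn
    have q2 := flow_le_of_mono S.cn.pn.per S.cn.pn.mono (tight_stream hl w1 w2) (fun k => (w1 k).1)
    omega
  subst hl₀
  obtain ⟨M, hM⟩ := isSW hm hn gA H fr hf S (by
    intro e1 he1 hs
    rcases hB with rfl | ⟨C, x', y', l', ⟨D', X', Y', e', K, -, -, S', -, g1, g2⟩, h2, h3⟩
    · exact (hs 0 rfl).elim
    have q := flow_le_of_mono S'.cn.pn.per S'.cn.pn.mono he1 hs
    obtain rfl : l' = l₀ := by omega
    refine ⟨D', X', Y', e', S', ?_⟩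
    obtain ⟨c0, -, hc0⟩ := per_bdd hm (f := fun i => X' i - X i) (fun a i => by
      simp only [S'.H.X_per hm, H.X_per hm]; ring)
    obtain ⟨c, ⟨i, hi⟩, hc⟩ := Int.exists_greatest_of_bdd (P := fun c => ∃ i, X' i - X i = c)
      ⟨c0, by rintro z ⟨i, rfl⟩; exact hc0 i⟩ ⟨_, 0, rfl⟩
    have gX0 : Gal (fun k => x (k + 0)) X := by simpa using gX
    have gY0 : Gal (fun k => y (k + 0)) Y := by simpa using gY
    have hx : ∀ i, X' i - X i ≤ c := fun i => hc _ ⟨i, rfl⟩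
    have hy := (gal_dom gY0 g2).1 (h3 rfl (c + K) ((gal_dom gX0 g1).2 fun i => by have := hx i; omega))
    have ee : EE B X Y (fun i j => D' i j - c) := by
      have := S'.H
      refine ⟨fun i j => ?_, fun i j => ?_, fun i j hb => ?_, fun i j => ?_, fun i j => ?_⟩
      · have := this.row i j; omega
      · have := this.col i j; omega
      · have := (S'.fr i j).1 hb; omega
      · have := this.le_X hm i j; have := hx i; omega
      · have := this.le_Y hn i j; have := hy j; omega
    refine ⟨i, fun a b => ?_⟩
    have := mx _ ee a b
    omega)
  obtain ⟨q1, q2⟩ := XY_add hm hn H S.H hM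
  refine ⟨A, gA, D₀, X₀, Y₀, e, -M, h1, h3, S, fun i j => ?_, fun k i => ?_, fun k i => ?_⟩
  · have := hf i j
    simp only [hM]; omega
  · rw [q1, gX]; omega
  · rw [q2, gY]; omega
lemma Gal_Xs {K K' : Int} (h : Gal (fun k => x (k + K)) X) (h' : Gal (fun k => x (k + K')) X') (i : Int) :
    X' i = X i + (K - K') := by
  have : ∀ k, k ≤ X' i ↔ k ≤ X i + (K - K') := by
    intro k
    have h1 := h (k + K' - K) i
    have h2 := h' k i
    simp only [sub_add_cancel] at h1
    rw [<- h2, h1]; omega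
  exact le_antisymm ((this _).1 le_rfl) ((this _).2 le_rfl)
theorem Th5 (hm : 0 < m) (hn : 0 < n) (hA : IsGAP m n A) (hA' : IsGAP m n A') (h : Step m n A B x y l)
    (h' : Step m n A' B x y l) : A = A' := by
  obtain ⟨D, X, Y, e, K, -, -, S, f, g1, g2⟩ := h
  obtain ⟨D', X', Y', e', K', -, -, S', f', g1', g2'⟩ := h'
  have H := S.H
  have br := FR_BR H S.fr f
  have gB : IsGAP m n B := (GAP_FL H hm hn f).1 hA
  have sX := Gal_Xs g1 g1'
  have sY := Gal_Xs g2 g2'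
  obtain ⟨E, HE, brE, mx⟩ := maxSol hm hn H.lpos gB (H.X_step hm) (H.Y_step hn) (H.X_per hm) (H.Y_per hn) (by
    by_cases h0 : B = 0
    · exact Or.inl h0
    · obtain ⟨e1, d, h1, h2⟩ := SW_exists hm hn gB h0
      obtain ⟨l₀, D₀, X₀, Y₀, S0, h3, -⟩ := stepData hm hn gB h1 h2
      exact Or.inr ⟨l₀, D₀, X₀, Y₀, flow_le_of_mono (S := supp B) (d := dD D) (fun a c _ => S.H.dper a c)
        (fun c _ c' h h' => BR_mono S.H br h' h) S0.str (fun k => (S0.cn.tight k).1), S0.H, S0.fr⟩)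
  have e1 := T5 hm hn hA S f HE brE (mx _ (EE_of_BR hm hn H br))
  have br' := FR_BR S'.H S'.fr f'
  have HE' := HE.add (K - K')
  rw [show (fun i => X i + (K - K')) = X' from (funext sX).symm,
    show (fun i => Y i + (K - K')) = Y' from (funext sY).symm] at HE'
  have e2 := T5 hm hn hA' S' f' HE' (by
    intro i j
    have := brE i j
    simp only; omega) (by
    intro i j
    have ee : EE B X Y (fun i j => D' i j - (K - K')) := by
      have := EE_of_BR hm hn S'.H br'
      refine ⟨fun i j => ?_, fun i j => ?_, fun i j hb => ?_, fun i j => ?_, fun i j => ?_⟩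
      · have := this.r i j; omega
      · have := this.c i j; omega
      · have := this.b i j hb; omega
      · have := this.x i j; have := sX i; omega
      · have := this.y i j; have := sY j; omega
    have := mx _ ee i j
    omega)
  funext i j
  have h1 := f i j
  have h2 := f' i j
  rw [<- e1] at h1
  rw [<- e2] at h2
  simp only at h2
  omega
end
end
section
structure Reg (R : Int -> Int -> Prop) (i0 j0 : Int) : Prop where
  up : ∀ {i j i' j'}, R i j -> i ≤ i' -> j ≤ j' -> R i' j'
  lo : ∀ {i j}, R i j -> i0 < i ∧ j0 < j
  ne : ∃ i j, R i j
def IC (R : Int -> Int -> Prop) (c : Cell) : Prop := R c.1 c.2 ∧ ¬ R (c.1 - 1) c.2 ∧ ¬ R c.1 (c.2 - 1)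
def OC (R : Int -> Int -> Prop) (c : Cell) : Prop :=
  R (c.1 - 1) c.2 ∧ R c.1 (c.2 - 1) ∧ ¬ R (c.1 - 1) (c.2 - 1)
section
variable {R : Int -> Int -> Prop} {i0 j0 : Int} {z : Int -> Cell}
lemma Reg.corner (h : Reg R i0 j0) {i j : Int} (hR : R i j) : ∃ c, IC R c ∧ c.1 ≤ i ∧ c.2 ≤ j := by
  obtain ⟨s, ⟨i', j', h1, h2, h3, h4⟩, hs⟩ := Int.exists_least_of_bdd
    (P := fun s => ∃ i' j', R i' j' ∧ i' ≤ i ∧ j' ≤ j ∧ i' + j' = s)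
    ⟨i0 + j0, by rintro z ⟨i', j', h1, -, -, rfl⟩; have := h.lo h1; omega⟩ ⟨_, i, j, hR, le_rfl, le_rfl, rfl⟩
  refine ⟨(i', j'), ⟨h1, fun h5 => ?_, fun h5 => ?_⟩, h2, h3⟩
  · have := hs _ ⟨i' - 1, j', h5, by omega, h3, rfl⟩; omega
  · have := hs _ ⟨i', j' - 1, h5, h2, by omega, rfl⟩; omega
lemma Reg.edge (h : Reg R i0 j0) {x : Int} (h1 : ∃ j, R x j) (h2 : ∀ i j, R i j -> x ≤ i) :
    ∃ j1, IC R (x, j1) ∧ ∀ c, IC R c -> c.2 ≤ j1 ∧ (c.2 = j1 -> c.1 = x) := by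
  obtain ⟨j, hj⟩ := h1
  obtain ⟨⟨i', j'⟩, hc, a, b⟩ := h.corner hj
  have := h2 _ _ hc.1
  obtain rfl : i' = x := by simp only at *; omega
  refine ⟨j', hc, fun c hc' => ?_⟩
  have := h2 _ _ hc'.1
  constructor
  · by_contra hh
    exact hc'.2.2 (h.up hc.1 this (by simp only; omega))
  · intro hh
    by_contra h3
    exact hc'.2.1 (h.up hc.1 (by simp only; omega) (by simp only; omega))
lemma Reg.flip (h : Reg R i0 j0) : Reg (fun i j => R j i) j0 i0 :=
  ⟨fun h1 h2 h3 => h.up h1 h3 h2, fun h1 => (h.lo h1).symm, by obtain ⟨i, j, h1⟩ := h.ne; exact ⟨j, i, h1⟩⟩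
lemma backPost_iff (h : Reg R i0 j0) (hz : innerCorners z = {c | IC R c}) {x y : Int} (h1 : ∃ j, R x j)
    (h2 : ∀ i j, R i j -> x ≤ i) (h3 : ∃ i, R i y) (h4 : ∀ i j, R i j -> y ≤ j) (c : Cell) :
    IsBackPost z c ↔ c = (x, y) := by
  obtain ⟨j1, a1, a2⟩ := h.edge h1 h2
  obtain ⟨i1, b1, b2⟩ := h.flip.edge (x := y) h3 (fun i j => h4 j i)
  have b1' : IC R (i1, y) := ⟨b1.1, b1.2.2, b1.2.1⟩
  unfold IsBackPost
  rw [hz]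
  constructor
  · rintro ⟨cr, h5, cl, h6, h7, h8, rfl⟩
    have e1 := (a2 cr h5).2 (le_antisymm (a2 cr h5).1 (h7 _ a1))
    have e2 := h8 _ b1'
    have e3 := h4 _ _ h6.1
    simp only at *
    rw [e1]
    congr 1
    omega
  · rintro rfl
    exact ⟨_, a1, _, b1', fun c' hc' => (a2 c' hc').1, fun c' hc' => h4 _ _ hc'.1, rfl⟩
lemma zz_fst (hz : IsZigZag z) {s t : Int} (h : s ≤ t) : (z t).1 ≤ (z s).1 := by
  have := mono_of_step (f := fun t => -(z t).1) (fun x => by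
    rcases hz.1 (x - 1) with h | h <;> rw [sub_add_cancel] at h <;> simp only [h] <;> omega) h
  omega
lemma zz_snd (hz : IsZigZag z) {s t : Int} (h : s ≤ t) : (z s).2 ≤ (z t).2 :=
  mono_of_step (f := fun t => (z t).2) (fun x => by
    rcases hz.1 (x - 1) with h | h <;> rw [sub_add_cancel] at h <;> simp only [h] <;> omega) h
lemma zz_diag (hz : IsZigZag z) (t : Int) : (z t).2 - (z t).1 = (z 0).2 - (z 0).1 + t := by
  have st : ∀ x, (z (x + 1)).2 - (z (x + 1)).1 = (z x).2 - (z x).1 + 1 := fun x => by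
    rcases hz.1 x with h | h <;> simp only [h] <;> omega
  induction t with
  | zero => simp
  | succ i ih => rw [st, ih]; ring
  | pred i ih =>
    have := st (-(i : Int) - 1)
    rw [sub_add_cancel] at this
    omega
lemma zz_mem (hz : IsZigZag z) (t : Int) : ∃ c ∈ innerCorners z, c.1 ≤ (z t).1 ∧ c.2 ≤ (z t).2 := by
  rcases hz.1 t with h | h
  · obtain ⟨N, hN⟩ := hz.2.2
    obtain ⟨s, ⟨hs, hs'⟩, hm⟩ := Int.exists_greatest_of_bdd (P := fun s => s < t ∧ z (s + 1) = ((z s).1 - 1, (z s).2))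
      ⟨t, fun s hs => hs.1.le⟩ ⟨min N (t - 1), by omega, hN _ (min_le_left _ _)⟩
    have hE : ∀ u, s < u -> u ≤ t -> z (u + 1) = ((z u).1, (z u).2 + 1) := by
      intro u h1 h2
      rcases eq_or_lt_of_le h2 with rfl | h2
      · exact h
      · rcases hz.1 u with h3 | h3
        · exact h3
        · have := hm u ⟨h2, h3⟩; omega
    refine ⟨z (s + 1), ⟨s + 1, rfl, by simpa using hs', hE _ (by omega) (by omega)⟩, ?_, zz_snd hz (by omega)⟩
    have : ∀ j : Nat, s + 1 + j ≤ t -> (z (s + 1 + j)).1 = (z (s + 1)).1 := by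
      intro j
      induction j with
      | zero => simp
      | succ j ih =>
        intro hj
        push_cast at hj ⊢
        rw [<- add_assoc, hE _ (by omega) (by omega)]
        exact ih (by omega)
    have := this (t - (s + 1)).toNat (by omega)
    rw [show s + 1 + ((t - (s + 1)).toNat : Int) = t by omega] at this
    omega
  · obtain ⟨N, hN⟩ := hz.2.1
    obtain ⟨s, ⟨hs, hs'⟩, hm⟩ := Int.exists_least_of_bdd (P := fun s => t < s ∧ z (s + 1) = ((z s).1, (z s).2 + 1))
      ⟨t, fun s hs => hs.1.le⟩ ⟨max N (t + 1), by omega, hN _ (le_max_left _ _)⟩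
    have hE : ∀ u, t ≤ u -> u < s -> z (u + 1) = ((z u).1 - 1, (z u).2) := by
      intro u h1 h2
      rcases eq_or_lt_of_le h1 with rfl | h1
      · exact h
      · rcases hz.1 u with h3 | h3
        · have := hm u ⟨h1, h3⟩; omega
        · exact h3
    refine ⟨z s, ⟨s, rfl, by simpa using hE (s - 1) (by omega) (by omega), hs'⟩, zz_fst hz hs.le, ?_⟩
    have : ∀ j : Nat, t + j ≤ s -> (z (t + j)).2 = (z t).2 := by
      intro j
      induction j with
      | zero => simp
      | succ j ih =>
        intro hj
        push_cast at hj ⊢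
        rw [<- add_assoc, hE _ (by omega) (by omega)]
        exact ih (by omega)
    have := this (s - t).toNat (by omega)
    rw [show t + ((s - t).toNat : Int) = s by omega] at this
    omega
lemma outer_eq (h : Reg R i0 j0) (hz : IsZigZag z) (hi : innerCorners z = {c | IC R c}) :
    outerCorners z = {c | OC R c} := by
  have m1 : ∀ t, R (z t).1 (z t).2 := by
    intro t
    obtain ⟨c, hc, h1, h2⟩ := zz_mem hz t
    rw [hi] at hc
    exact h.up hc.1 h1 h2
  have m2 : ∀ t, ¬ R ((z t).1 - 1) ((z t).2 - 1) := by
    intro t hR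
    obtain ⟨c, hc, h1, h2⟩ := h.corner hR
    have hc' : c ∈ innerCorners z := by rw [hi]; exact hc
    obtain ⟨s, rfl, -⟩ := hc'
    rcases le_total s t with hs | hs
    · have := zz_fst hz hs; omega
    · have := zz_snd hz hs; omega
  ext c
  constructor
  · rintro ⟨t, rfl, h1, h2⟩
    have a := m1 (t - 1)
    have b := m1 (t + 1)
    rw [h2] at b
    refine ⟨b, ?_, m2 t⟩
    have e1 := congrArg Prod.fst h1
    have e2 := congrArg Prod.snd h1
    simp only at e1 e2
    rw [show (z t).2 - 1 = (z (t - 1)).2 by omega, e1]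
    exact a
  · rintro ⟨h1, h2, h3⟩
    have hd := zz_diag hz (c.2 - c.1 - ((z 0).2 - (z 0).1))
    set t := c.2 - c.1 - ((z 0).2 - (z 0).1) with ht
    have e : z t = c := by
      have q1 : c.1 ≤ (z t).1 := by
        by_contra hh
        exact h3 (h.up (m1 t) (by omega) (by omega))
      have q2 : (z t).1 ≤ c.1 := by
        by_contra hh
        exact m2 t (h.up h1 (by omega) (by omega))
      ext <;> omega
    refine ⟨t, e, ?_, ?_⟩
    · rcases hz.1 (t - 1) with h4 | h4 <;> rw [sub_add_cancel] at h4
      · exact h4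
      · exfalso
        have := m2 (t - 1)
        rw [e] at h4
        have e1 := congrArg Prod.fst h4
        have e2 := congrArg Prod.snd h4
        simp only at e1 e2
        rw [<- e1, <- e2] at this
        exact this h2
    · rcases hz.1 t with h4 | h4
      · exfalso
        have := m2 (t + 1)
        rw [h4, e] at this
        simp only [add_sub_cancel_right] at this
        exact this h1
      · exact h4
lemma zz_exists (h : Reg R i0 j0) : ∃ z, IsZigZag z ∧ innerCorners z = {c | IC R c} := by
  have : ∀ t : Int, ∃ a, ∀ i, a ≤ i ↔ R i (i + t) := by
    intro t
    obtain ⟨i, j, hij⟩ := h.ne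
    obtain ⟨a, h1, h2⟩ := Int.exists_least_of_bdd (P := fun i => R i (i + t)) ⟨i0, fun z hz => (h.lo hz).1.le⟩
      ⟨max i (j - t), h.up hij (by omega) (by omega)⟩
    exact ⟨a, fun i => ⟨fun hi => h.up h1 hi (by omega), h2 i⟩⟩
  choose f hf using this
  have st : ∀ t, f (t + 1) ≤ f t ∧ f t ≤ f (t + 1) + 1 := by
    intro t
    have h1 := (hf t _).1 le_rfl
    have h2 := (hf (t + 1) _).1 le_rfl
    exact ⟨(hf _ _).2 (h.up h1 le_rfl (by omega)), (hf _ _).2 (h.up h2 (by omega) (by omega))⟩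
  have lo : ∀ t, i0 < f t ∧ j0 < f t + t := fun t => h.lo ((hf t _).1 le_rfl)
  have an : ∀ {s t}, s ≤ t -> f t ≤ f s := by
    intro s t hst
    have := mono_of_step (f := fun t => - f t) (fun x => by have := (st (x - 1)).1; rw [sub_add_cancel] at this; omega) hst
    omega
  have mo : ∀ {s t}, s ≤ t -> f s + s ≤ f t + t :=
    fun hst => mono_of_step (f := fun t => f t + t) (fun x => by
      have := (st (x - 1)).2; rw [sub_add_cancel] at this; omega) hst
  refine ⟨fun t => (f t, f t + t), ⟨fun t => ?_, ?_, ?_⟩, ?_⟩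
  · have := st t
    rcases eq_or_ne (f (t + 1)) (f t) with h1 | h1
    · left; simp only [h1]; ext <;> simp only <;> omega
    · right; simp only [show f (t + 1) = f t - 1 by omega]; ext <;> simp only <;> omega
  · obtain ⟨a, ⟨N, hN⟩, ha⟩ := Int.exists_least_of_bdd (P := fun a => ∃ t, f t = a) ⟨i0, by
      rintro z ⟨t, rfl⟩; exact (lo t).1.le⟩ ⟨_, 0, rfl⟩
    refine ⟨N, fun t ht => ?_⟩
    have h1 := an ht
    have h2 := an (show N ≤ t + 1 by omega)
    have h3 := ha _ ⟨t, rfl⟩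
    have h4 := ha _ ⟨t + 1, rfl⟩
    ext <;> simp only <;> omega
  · obtain ⟨a, ⟨N, hN⟩, ha⟩ := Int.exists_least_of_bdd (P := fun a => ∃ t, f t + t = a) ⟨j0, by
      rintro z ⟨t, rfl⟩; exact (lo t).2.le⟩ ⟨_, 0, rfl⟩
    refine ⟨N - 1, fun t ht => ?_⟩
    have h1 := mo (show t ≤ N by omega)
    have h2 := mo (show t + 1 ≤ N by omega)
    have h3 := ha _ ⟨t, rfl⟩
    have h4 := ha _ ⟨t + 1, rfl⟩
    ext <;> simp only <;> omega
  · ext c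
    constructor
    · rintro ⟨t, rfl, h1, h2⟩
      have e1 := congrArg Prod.fst h1
      have e2 := congrArg Prod.fst h2
      simp only at e1 e2
      refine ⟨(hf t _).1 le_rfl, fun hh => ?_, fun hh => ?_⟩ <;> simp only at hh
      · rw [show f t + t = f t - 1 + (t + 1) by ring, <- hf] at hh; omega
      · rw [show f t + t - 1 = f t + (t - 1) by ring, <- hf] at hh; omega
    · rintro ⟨h1, h2, h3⟩
      have a1 : f (c.2 - c.1) ≤ c.1 := (hf _ _).2 (by simpa using h1)
      have a2 : c.1 < f (c.2 - c.1 - 1) := by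
        rw [<- not_le, hf, show c.1 + (c.2 - c.1 - 1) = c.2 - 1 by ring]; exact h3
      have a3 : c.1 - 1 < f (c.2 - c.1 + 1) := by
        rw [<- not_le, hf, show c.1 - 1 + (c.2 - c.1 + 1) = c.2 by ring]; exact h2
      have b1 := st (c.2 - c.1)
      have b2 := st (c.2 - c.1 - 1)
      rw [sub_add_cancel] at b2
      refine ⟨c.2 - c.1, ?_, ?_, ?_⟩ <;> ext <;> simp only <;> omega
end
section
variable {m n l : Nat} {D : Int -> Int -> Int} {X Y x y : Int -> Int} {A B : Mat} {e : Int -> Cell} {d : Cell -> Int}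
lemma Hgt.reg (H : Hgt m n l D X Y) (hm : 0 < m) (hn : 0 < n) (k : Int) :
    ∃ i0 j0, Reg (fun i j => k ≤ D i j) i0 j0 := by
  obtain ⟨i0, h1⟩ := H.lowR hm k
  obtain ⟨j0, h2⟩ := H.lowC hn k
  refine ⟨i0, j0, fun h3 h4 h5 => h3.trans (H.mono h4 h5), fun h => ⟨h1 _ _ h, h2 _ _ h⟩, ?_⟩
  refine ⟨0 + |k - D 0 0| * m, 0 + |k - D 0 0| * n, ?_⟩
  rw [H.per]
  have := H.lpos
  have := le_abs_self (k - D 0 0)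
  nlinarith [abs_nonneg (k - D 0 0)]
lemma nwMax_eq (H : Hgt m n l D X Y) (hm : 0 < m) (hn : 0 < n) (fr : FR A D)
    (hd : ∀ c ∈ supp A, d c = D c.1 c.2) (k : Int) :
    nwMaximal (levelSet A d k) = {c | IC (fun i j => k ≤ D i j) c} := by
  ext ⟨i, j⟩
  constructor
  · rintro ⟨⟨h1, h2⟩, h3⟩
    rw [hd _ h1] at h2
    simp only at h2
    refine ⟨h2.ge, fun h4 => ?_, fun h4 => ?_⟩ <;> simp only at h4
    · obtain ⟨c, a1, a2, a3, a4⟩ := FR_attain H hm hn fr (i - 1) j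
      have := H.row i j
      have := h3 c ⟨a1, by rw [hd _ a1]; omega⟩ ⟨by simp only; omega, a3⟩
      subst this; simp only at a2; omega
    · obtain ⟨c, a1, a2, a3, a4⟩ := FR_attain H hm hn fr i (j - 1)
      have := H.col i j
      have := h3 c ⟨a1, by rw [hd _ a1]; omega⟩ ⟨a2, by simp only; omega⟩
      subst this; simp only at a3; omega
  · rintro ⟨h1, h2, h3⟩
    simp only at h1 h2 h3
    have h4 : (i, j) ∈ supp A := fun h0 => by have := (fr i j).2 h0; omega
    have := H.row i j
    refine ⟨⟨h4, by rw [hd _ h4]; simp only; omega⟩, ?_⟩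
    rintro ⟨i', j'⟩ ⟨h5, h6⟩ ⟨h7, h8⟩
    rw [hd _ h5] at h6
    simp only at *
    by_contra hne
    by_cases hi : i' ≤ i - 1
    · have := H.mono hi h8; omega
    · by_cases hj : j' ≤ j - 1
      · have := H.mono h7 hj; omega
      · exact hne (by ext <;> simp only <;> omega)
theorem Br1 (hm : 0 < m) (hn : 0 < n) (hA : IsGAP m n A) (hd : IsSWNumbering m n A d) :
    ∃ B x y l, Step m n A B x y l ∧ FlatEntries A B (IsInnerOf A d) (IsOuterOf A d) ∧
      backPostSet A d = Set.range (fun k => (x k, y k)) := by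
  obtain ⟨e, h1, h2⟩ := hd
  obtain ⟨l, D, X, Y, S, h3, hd⟩ := stepData hm hn hA h1 h2
  have H := S.H
  have fr := S.fr
  obtain ⟨B, hB⟩ := FL_exists H fr
  obtain ⟨x, hx⟩ := Gal_of_X S.str.1 (S.H.XF hm)
  obtain ⟨y, hy⟩ := Gal_of_X S.str.1 (S.H.YF hn)
  have nw := nwMax_eq H hm hn fr hd
  have ex : ∀ k, ∃ z, ZigZagAt A d k z := by
    intro k
    obtain ⟨i0, j0, r⟩ := H.reg hm hn k
    obtain ⟨z, a, b⟩ := zz_exists r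
    exact ⟨z, a, by rw [b, nw]⟩
  have inn : ∀ c, IsInnerOf A d c ↔ D (c.1 - 1) c.2 < D c.1 c.2 ∧ D c.1 (c.2 - 1) < D c.1 c.2 := by
    intro c
    constructor
    · rintro ⟨k, z, a, b⟩
      rw [a.2, nw] at b
      obtain ⟨b1, b2, b3⟩ := b
      simp only at *; omega
    · rintro ⟨a, b⟩
      obtain ⟨z, hz⟩ := ex (D c.1 c.2)
      refine ⟨_, z, hz, ?_⟩
      rw [hz.2, nw]
      exact ⟨le_rfl, not_le.2 a, not_le.2 b⟩
  have out : ∀ c, IsOuterOf A d c ↔ D (c.1 - 1) (c.2 - 1) < D (c.1 - 1) c.2 ∧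
      D (c.1 - 1) (c.2 - 1) < D c.1 (c.2 - 1) := by
    intro c
    constructor
    · rintro ⟨k, z, a, b⟩
      obtain ⟨i0, j0, r⟩ := H.reg hm hn k
      rw [outer_eq r a.1 (by rw [a.2, nw])] at b
      obtain ⟨b1, b2, b3⟩ := b
      simp only at *; omega
    · rintro ⟨a, b⟩
      obtain ⟨z, hz⟩ := ex (D (c.1 - 1) (c.2 - 1) + 1)
      obtain ⟨i0, j0, r⟩ := H.reg hm hn (D (c.1 - 1) (c.2 - 1) + 1)
      refine ⟨_, z, hz, ?_⟩
      rw [outer_eq r hz.1 (by rw [hz.2, nw])]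
      exact ⟨by simp only; omega, by simp only; omega, by simp only; omega⟩
  have bp : ∀ k z c, ZigZagAt A d k z -> (IsBackPost z c ↔ c = (x k, y k)) := by
    intro k z c hz
    obtain ⟨i0, j0, r⟩ := H.reg hm hn k
    refine backPost_iff r (by rw [hz.2, nw]) ?_ ?_ ?_ ?_ c
    · obtain ⟨J, hJ⟩ := H.X_at hm (x k)
      exact ⟨J, by rw [hJ J le_rfl]; exact (hx _ _).1 le_rfl⟩
    · intro i j hij
      exact (hx _ _).2 (hij.trans (H.le_X hm i j))
    · obtain ⟨J, hJ⟩ := H.Y_at hn (y k)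
      exact ⟨J, by rw [hJ J le_rfl]; exact (hy _ _).1 le_rfl⟩
    · intro i j hij
      exact (hy _ _).2 (hij.trans (H.le_Y hn i j))
  refine ⟨B, x, y, l, ⟨D, X, Y, e, 0, h1, h3, S, hB, by simpa using hx, by simpa using hy⟩, ?_, ?_⟩
  · intro c
    rw [inn, out]
    have a1 := hB c.1 c.2
    have a2 := H.row c.1 c.2
    have a3 := H.col c.1 c.2
    have a4 := H.row c.1 (c.2 - 1)
    have a5 := H.col (c.1 - 1) c.2
    have a6 := fr c.1 c.2
    rcases Nat.eq_zero_or_pos (A c.1 c.2) with h7 | h7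
    · have := a6.2 h7; omega
    · have := a6.1 (by omega); omega
  · ext c
    constructor
    · rintro ⟨k, z, a, b⟩
      exact ⟨k, ((bp k z c a).1 b).symm⟩
    · rintro ⟨k, rfl⟩
      obtain ⟨z, hz⟩ := ex k
      exact ⟨k, z, hz, (bp k z _ hz).2 rfl⟩
lemma FE_unique {A B C : Mat} {I O : Cell -> Prop} (h : FlatEntries A B I O) (h' : FlatEntries A C I O) : B = C := by
  funext i j
  have h1 := h (i, j)
  have h2 := h' (i, j)
  by_cases a : I (i, j)
  · have := h1.1 a; have := h2.1 a; simp only at *; omega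
  · by_cases b : O (i, j)
    · have := h1.2.1 b; have := h2.2.1 b; simp only at *; omega
    · have := h1.2.2 a b; have := h2.2.2 a b; simp only at *; omega
lemma Step.flat (hm : 0 < m) (hn : 0 < n) (hA : IsGAP m n A) (h : Step m n A B x y l) : FlatRel m n A B ∧
    ∃ d, IsSWNumbering m n A d ∧ IsStreamEnum m n (fun k => (x k, y k)) l ∧
      Set.range (fun k => (x k, y k)) = backPostSet A d := by
  have sx := h.strx hm
  have sy := h.stry hn
  have lpos := h.lpos
  have h' := h
  obtain ⟨D, X, Y, e, K, h1, h2, -⟩ := h'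
  obtain ⟨B', x', y', l', hs, hf, hb⟩ := Br1 hm hn hA ⟨e, h1, h2⟩
  obtain ⟨rfl, rfl, K, e1, e2⟩ := Th2 hm hn h hs
  refine ⟨⟨_, ⟨e, h1, h2⟩, hf⟩, _, ⟨e, h1, h2⟩, ⟨lpos, fun k => ⟨sx.lt k, sy.lt k⟩, fun k => ?_⟩, ?_⟩
  · have q1 := sx.per 1 k
    have q2 := sy.per 1 k
    simp only [one_mul] at q1 q2
    simp only [tauC, q1, q2]
  · rw [hb]
    ext c
    constructor
    · rintro ⟨k, rfl⟩; exact ⟨k - K, by simp [e1, e2]⟩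
    · rintro ⟨k, rfl⟩; exact ⟨k + K, by simp [e1, e2]⟩
lemma enum_shift {f g : Int -> Cell} (hf : ∀ k, NW (f k) (f (k + 1))) (hg : ∀ k, NW (g k) (g (k + 1)))
    (h : Set.range f = Set.range g) : ∃ K, ∀ k, g k = f (k + K) := by
  have mf : StrictMono fun k => (f k).1 := strictMono_int_of_lt_succ fun k => (hf k).1
  have mg : StrictMono fun k => (g k).1 := strictMono_int_of_lt_succ fun k => (hg k).1
  have h1 : ∀ k, ∃ j, f j = g k := fun k => by
    have : g k ∈ Set.range f := h ▸ ⟨k, rfl⟩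
    exact this
  choose φ hφ using h1
  have mφ : StrictMono φ := fun a b hab => by
    have := mg hab
    simp only [<- hφ] at this
    exact mf.lt_iff_lt.1 this
  have sφ : ∀ j, ∃ k, φ k = j := fun j => by
    have : f j ∈ Set.range g := h ▸ ⟨j, rfl⟩
    obtain ⟨k, hk⟩ := this
    refine ⟨k, mf.injective ?_⟩
    simp only [hφ, hk]
  have st : ∀ k, φ (k + 1) = φ k + 1 := by
    intro k
    obtain ⟨j, hj⟩ := sφ (φ k + 1)
    have a1 := mφ (show k < k + 1 by omega)
    have a2 : k < j := mφ.lt_iff_lt.1 (by omega)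
    have a3 := mφ.le_iff_le.2 (show k + 1 ≤ j by omega)
    omega
  refine ⟨φ 0, fun k => ?_⟩
  have : φ k = k + φ 0 := by
    induction k with
    | zero => simp
    | succ i ih => rw [st, ih]; ring
    | pred i ih => have := st (-(i : Int) - 1); rw [sub_add_cancel] at this; omega
  rw [<- this, hφ]
lemma Step.of_flat (hm : 0 < m) (hn : 0 < n) (hA : IsGAP m n A) (hf : FlatRel m n A B)
    (hd : IsSWNumbering m n A d) (he : IsStreamEnum m n e l) (hr : Set.range e = backPostSet A d) :
    Step m n A B (fun k => (e k).1) (fun k => (e k).2) l := by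
  obtain ⟨d', hd', hf⟩ := hf
  obtain ⟨B1, x1, y1, l1, s1, f1, -⟩ := Br1 hm hn hA hd'
  obtain ⟨B2, x2, y2, l2, s2, -, b2⟩ := Br1 hm hn hA hd
  obtain rfl := FE_unique hf f1
  obtain ⟨rfl, rfl, -⟩ := Th2 hm hn s1 s2
  have sx := s2.strx hm
  have sy := s2.stry hn
  obtain ⟨K, hK⟩ := enum_shift (f := fun k => (x2 k, y2 k)) (fun k => ⟨sx.lt k, sy.lt k⟩) he.2.1 (by rw [hr, b2])
  have hl : l1 = l := by
    have q1 := he.2.2 0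
    rw [hK, hK] at q1
    have q2 := congrArg Prod.fst q1
    have q3 := sx.per 1 (0 + K)
    simp only [tauC, one_mul] at q2 q3
    rw [<- q3] at q2
    have := sx.le_iff.1 q2.le
    have := sx.le_iff.1 q2.ge
    omega
  subst hl
  obtain ⟨D, X, Y, e, K', h1, h2, S, h3, h4, h5⟩ := s2
  refine ⟨D, X, Y, e, K' - K, h1, h2, S, h3, ?_, ?_⟩
  · intro k i
    rw [<- h4]; simp only [hK]; rw [show k + (K' - K) + K = k + K' by ring]
  · intro k i
    rw [<- h5]; simp only [hK]; rw [show k + (K' - K) + K = k + K' by ring]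
end
end
section
section
variable {m n l N s : Nat} {A B : Mat} {x y : Int -> Int} {c : Nat -> Int} {μ : Nat -> Nat} {P Q P' : Nat -> Nat -> Int}
lemma colExt_def (z : Int) : colExt N l c z = c (z % l).toNat + N * (z / l) := rfl
lemma colExt_nat {p : Nat} (hp : p < l) : colExt N l c p = c p := by
  rw [colExt_def, Int.emod_eq_of_lt (by omega) (by omega), Int.ediv_eq_zero_of_lt (by omega) (by omega)]
  simp
lemma colExt_per (hl : 0 < l) (a k : Int) : colExt N l c (k + a * l) = colExt N l c k + a * N := by
  rw [colExt_def, colExt_def, Int.add_mul_emod_self_right, Int.add_mul_ediv_right _ _ (by omega)]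
  ring
lemma exists_pq (hl : 0 < l) (z : Int) : ∃ (p : Nat) (a : Int), p < l ∧ z = p + a * l := by
  have h1 := Int.emod_nonneg z (b := (l : Int)) (by omega)
  have h2 := Int.emod_lt_of_pos z (b := (l : Int)) (by omega)
  refine ⟨(z % l).toNat, z / l, by omega, ?_⟩
  have := Int.emod_add_mul_ediv z l
  rw [mul_comm] at this
  omega
lemma colExt_eq (hl : 0 < l) (hx : Str N l x) {r : Int} (h : ∀ p : Nat, p < l -> c p = x (r + p)) (z : Int) :
    colExt N l c z = x (r + z) := by
  obtain ⟨p, a, hp, rfl⟩ := exists_pq hl z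
  rw [colExt_per hl, colExt_nat hp, h p hp, <- add_assoc, hx.per]
lemma colExt_str (hl : 0 < l) (h1 : ∀ p : Nat, p + 1 < l -> c p < c (p + 1)) (h2 : c (l - 1) - c 0 < N) :
    Str N l (colExt N l c) := by
  refine ⟨fun k => ?_, fun a k => colExt_per hl a k⟩
  obtain ⟨p, a, hp, rfl⟩ := exists_pq hl k
  rcases Nat.lt_or_ge (p + 1) l with h | h
  · rw [show (p : Int) + a * l + 1 = (p + 1 : Nat) + a * l by push_cast; ring, colExt_per hl, colExt_per hl,
      colExt_nat hp, colExt_nat h]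
    have := h1 p h
    omega
  · obtain rfl : l = p + 1 := by omega
    have e : (p : Int) + a * (p + 1 : Nat) + 1 = (0 : Nat) + (a + 1) * (p + 1 : Nat) := by push_cast; ring
    rw [e, colExt_per hl, colExt_per hl, colExt_nat hp, colExt_nat hl]
    simp only [Nat.add_sub_cancel] at h2
    linarith
lemma Str.norm (hl : 0 < l) (hx : Str m l x) : ∃ r : Int, ∀ p : Nat, p < l -> 1 ≤ x (r + p) ∧ x (r + p) ≤ m := by
  obtain ⟨r, h1, h2⟩ := Int.exists_least_of_bdd (P := fun k => 1 ≤ x k) ⟨min 0 (1 - x 0), fun k hk => by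
      by_contra hh
      have := hx.mono (show k ≤ 0 by omega)
      omega⟩ ⟨max 0 (1 - x 0), by
      have := hx.mono (show 0 ≤ max 0 (1 - x 0) by omega)
      omega⟩
  refine ⟨r, fun p hp => ⟨?_, ?_⟩⟩
  · have := hx.mono (show r ≤ r + p by omega)
    omega
  · have h3 : ¬ 1 ≤ x (r - 1) := fun h => by have := h2 _ h; omega
    have h4 := hx.per 1 (r - 1)
    have := hx.mono (show r + p ≤ r - 1 + 1 * l by omega)
    omega
lemma Str.shift (hx : Str m l x) (K : Int) : Str m l (fun k => x (k + K)) :=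
  ⟨fun k => by simpa only [add_right_comm] using hx.lt (k + K), fun a k => by
    have := hx.per a (k + K); simpa only [add_right_comm] using this⟩
lemma Step.shift (h : Step m n A B x y l) (r : Int) :
    Step m n A B (fun k => x (k + r)) (fun k => y (k + r)) l := by
  obtain ⟨D, X, Y, e, K, h1, h2, h3, h4, h5, h6⟩ := h
  refine ⟨D, X, Y, e, K - r, h1, h2, h3, h4, fun k => ?_, fun k => ?_⟩
  · simpa only [add_assoc, sub_add_cancel] using h5 k
  · simpa only [add_assoc, sub_add_cancel] using h6 k
lemma blockStart_spec (t : Nat) : blockStart μ t ≤ t ∧ μ (blockStart μ t) = μ t :=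
  ⟨Nat.sInf_le rfl, Nat.sInf_mem (s := {t' | μ t' = μ t}) ⟨t, rfl⟩⟩
lemma anti_of (hμ : ∀ t : Nat, t + 1 < s -> μ (t + 1) ≤ μ t) {u t : Nat} (h : u ≤ t) (ht : t < s) : μ t ≤ μ u := by
  induction t, h using Nat.le_induction with
  | base => exact le_rfl
  | succ t h ih => exact (hμ t ht).trans (ih (by omega))
lemma block_eq (hμ : ∀ t : Nat, t + 1 < s -> μ (t + 1) ≤ μ t) {u t : Nat} (ht : t < s) (h1 : blockStart μ t ≤ u)
    (h2 : u ≤ t) : μ u = μ t := by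
  have := anti_of hμ h2 ht
  have := anti_of hμ h1 (by omega)
  have := (blockStart_spec (μ := μ) t).2
  omega
lemma eta_succ (hμ : ∀ t : Nat, t + 1 < s -> μ (t + 1) ≤ μ t) {t : Nat} (ht : t + 1 < s) (h : μ t = μ (t + 1)) :
    etaCol N μ P (t + 1) = etaCol N μ P t + rOff N μ P t := by
  have e : blockStart μ (t + 1) = blockStart μ t := by unfold blockStart; rw [h]
  unfold etaCol
  rw [e, Finset.sum_Ico_succ_top (blockStart_spec t).1]
lemma colExt_congr (hl : 0 < l) {c' : Nat -> Int} (h : ∀ p < l, c p = c' p) : colExt N l c = colExt N l c' := by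
  funext z
  have h1 := Int.emod_nonneg z (b := (l : Int)) (by omega)
  have h2 := Int.emod_lt_of_pos z (b := (l : Int)) (by omega)
  rw [colExt_def, colExt_def, h _ (by omega)]
lemma eta_congr (hμ : ∀ t : Nat, t + 1 < s -> μ (t + 1) ≤ μ t) (h0 : ∀ t < s, 0 < μ t)
    (h : ∀ t < s, ∀ x < μ t, P x t = P' x t) {t : Nat} (ht : t < s) : etaCol N μ P t = etaCol N μ P' t := by
  unfold etaCol
  refine Finset.sum_congr rfl fun u hu => ?_
  rw [Finset.mem_Ico] at hu
  have e1 := block_eq hμ ht hu.1 hu.2.le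
  have e2 := block_eq hμ ht (by omega : _ ≤ u + 1) (by omega)
  have e : (fun x => colExt N (μ u) (fun y => P y (u + 1)) x) = fun x => colExt N (μ u) (fun y => P' y (u + 1)) x := by
    funext z
    rw [colExt_congr (h0 u (by omega))]
    intro p hp
    exact h (u + 1) (by omega) p (by omega)
  have e' := fun z => congrFun e z
  unfold rOff pairCond tauPow
  simp only [e']
  congr 1
  ext r
  have := h u (by omega)
  constructor
  · rintro ⟨a1, a2, a3⟩
    exact ⟨fun x hx => by rw [<- this _ (by omega), <- this _ hx]; exact a1 x hx, a2,
      fun x hx => by rw [<- this _ hx]; exact a3 x hx⟩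
  · rintro ⟨a1, a2, a3⟩
    exact ⟨fun x hx => by rw [this _ (by omega), this _ hx]; exact a1 x hx, a2,
      fun x hx => by rw [this _ hx]; exact a3 x hx⟩
def ceX (m : Nat) (μ : Nat -> Nat) (P : Nat -> Nat -> Int) (t : Nat) (z : Int) : Int := colExt m (μ t) (fun x => P x t) z
noncomputable def ceY (m n : Nat) (μ : Nat -> Nat) (P Q : Nat -> Nat -> Int) (t : Nat) (z : Int) : Int :=
  colExt n (μ t) (fun x => Q x t) (z - etaCol m μ P t)
lemma rOff_spec {t : Nat} (e : μ t = μ (t + 1)) (h0 : 0 < μ t) (sx : Str m (μ t) (ceX m μ P t))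
    (sx' : Str m (μ (t + 1)) (ceX m μ P (t + 1))) (h : ∀ x < μ t, 1 ≤ P x t ∧ P x t ≤ m)
    (h' : ∀ x < μ (t + 1), 1 ≤ P x (t + 1) ∧ P x (t + 1) ≤ m) (K : Int) :
    (∀ z, ceX m μ P t z ≤ ceX m μ P (t + 1) (z + K)) ↔ (rOff m μ P t : Int) ≤ K := by
  have key : ∀ r : Nat, pairCond m μ P t r ↔ ∀ z, ceX m μ P t z ≤ ceX m μ P (t + 1) (z + r) := by
    intro r
    constructor
    · rintro ⟨-, -, a⟩ z
      obtain ⟨p, b, hp, rfl⟩ := exists_pq h0 z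
      have := a p hp
      have e1 := sx'.per b (p + r)
      rw [<- e] at e1
      rw [sx.per, add_right_comm, e1]
      unfold ceX tauPow at *
      rw [colExt_nat hp, <- e]
      linarith
    · intro a
      refine ⟨fun x hx => ?_, fun x hx => ?_, fun x hx => ?_⟩
      · have := sx.lt x
        rw [show (x : Int) + 1 = (x + 1 : Nat) by push_cast; rfl] at this
        unfold ceX at this
        rwa [colExt_nat (by omega), colExt_nat hx] at this
      · have := sx'.lt (x + r)
        unfold ceX at this
        rw [<- e, add_right_comm] at this
        unfold tauPow
        push_cast
        exact this
      · have := a x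
        unfold ceX at this
        rwa [colExt_nat hx, <- e] at this
  have mem : pairCond m μ P t (rOff m μ P t) := by
    refine Nat.sInf_mem (s := {r | pairCond m μ P t r}) ⟨μ t, (key _).2 fun z => ?_⟩
    obtain ⟨p, b, hp, rfl⟩ := exists_pq h0 z
    have e1 := sx'.per (b + 1) p
    rw [<- e] at e1
    rw [sx.per, show (p : Int) + b * μ t + μ t = p + (b + 1) * μ t by ring, e1]
    unfold ceX
    rw [colExt_nat hp, colExt_nat (by omega)]
    have := h p hp
    have := h' p (by omega)
    linarith
  constructor
  · intro a
    have hK : 0 ≤ K := by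
      by_contra hh
      have a0 := a 0
      have b1 := sx'.per (-1) ((μ t - 1 : Nat) : Int)
      have b2 := sx'.mono (show 0 + K ≤ ((μ t - 1 : Nat) : Int) + -1 * μ (t + 1) by omega)
      have b3 : ceX m μ P t 0 = P 0 t := colExt_nat (p := 0) h0
      have b4 : ceX m μ P (t + 1) ((μ t - 1 : Nat) : Int) = P (μ t - 1) (t + 1) := colExt_nat (by omega)
      have := h 0 h0
      have := h' (μ t - 1) (by omega)
      omega
    have := Nat.sInf_le (s := {r | pairCond m μ P t r}) (m := K.toNat) ((key _).2 (by
      rw [Int.toNat_of_nonneg hK]; exact a))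
    unfold rOff
    omega
  · intro a z
    have := (key _).1 mem z
    have := sx'.mono (show z + rOff m μ P t ≤ z + K by omega)
    omega
def KR (m n : Nat) (A : Mat) (s : Nat) (μ : Nat -> Nat) (P Q : Nat -> Nat -> Int) : Prop :=
  (∀ t, s ≤ t -> μ t = 0) ∧ PadZeroT s μ P ∧ PadZeroT s μ Q ∧ ∃ Aseq : Nat -> Mat, Aseq 0 = A ∧ Aseq s = 0 ∧
    ∀ t < s, Step m n (Aseq t) (Aseq (t + 1)) (ceX m μ P t) (ceY m n μ P Q t) (μ t) ∧
      ∀ x < μ t, 1 ≤ P x t ∧ P x t ≤ m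
lemma gap_seq (hm : 0 < m) (hn : 0 < n) {S : Nat -> Mat} {X Y : Nat -> Int -> Int} (g : IsGAP m n (S 0))
    (h : ∀ t < s, IsGAP m n (S t) -> Step m n (S t) (S (t + 1)) (X t) (Y t) (μ t)) :
    ∀ t ≤ s, IsGAP m n (S t) := by
  intro t
  induction t with
  | zero => exact fun _ => g
  | succ t ih =>
    intro ht
    have := ih (by omega)
    exact ((h t ht this).gap hm hn this).1
lemma anti_seq (hm : 0 < m) (hn : 0 < n) {S : Nat -> Mat} {X Y : Nat -> Int -> Int} (g : ∀ t ≤ s, IsGAP m n (S t))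
    (h : ∀ t < s, Step m n (S t) (S (t + 1)) (X t) (Y t) (μ t)) (t : Nat) (ht : t + 1 < s) : μ (t + 1) ≤ μ t :=
  (Th3 hm hn (g t (by omega)) (h t (by omega)) (h (t + 1) ht)).1
lemma KR_of (hm : 0 < m) (hn : 0 < n) (hA : IsGAP m n A) (h : KappaRel m n A s μ P Q) : KR m n A s μ P Q := by
  obtain ⟨P', Q', ρ, ⟨S, ⟨h0, -, h1, h2⟩, h3⟩, h4, h5, h6, h7⟩ := h
  refine ⟨h7, h5, h6, S, h0, h1, ?_⟩
  choose! d e a1 a2 a3 a4 using h3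
  have st : ∀ t < s, IsGAP m n (S t) -> Step m n (S t) (S (t + 1)) (fun k => (e t k).1) (fun k => (e t k).2) (μ t) :=
    fun t ht g => Step.of_flat hm hn g (h2 t ht) (a1 t ht) (a2 t ht) (a3 t ht)
  have g := gap_seq hm hn (h0 ▸ hA) st
  have st := fun t ht => st t ht (g t (le_of_lt ht))
  have an := anti_seq hm hn g st
  intro t ht
  obtain ⟨r1, r2, b1, b2, b3⟩ := a4 t ht
  have l0 := (st t ht).lpos
  have sx := (st t ht).strx hm
  have sy := (st t ht).stry hn
  have hη := eta_congr (N := m) an (fun t ht => (st t ht).lpos) (fun t ht x hx => (h4 t ht x hx).1) ht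
  have ex : ∀ z, ceX m μ P t z = (e t (z + (r1 + 1))).1 := by
    intro z
    unfold ceX
    rw [add_comm]
    exact colExt_eq l0 sx (fun p hp => by rw [(h4 t ht p hp).1]; exact (b1 p hp).1) z
  have ey : ∀ z, ceY m n μ P Q t z = (e t (z + (r1 + 1))).2 := by
    intro z
    unfold ceY
    rw [colExt_eq l0 sy (r := r1 + 1 + etaCol m μ P t) (fun p hp => ?_)]
    · congr 2; ring
    · rw [(h4 t ht p hp).2]
      unfold tauPow
      rw [colExt_eq l0 sy (r := r2 + 1) (fun p hp => (b2 p hp).1), b3, hη]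
      congr 2; ring
  refine ⟨?_, fun x hx => ?_⟩
  · rw [show ceX m μ P t = _ from funext ex, show ceY m n μ P Q t = _ from funext ey]
    exact (st t ht).shift (r1 + 1)
  · rw [(h4 t ht x hx).1]; exact (b1 x hx).2
lemma ceY_nat {t p : Nat} (hp : p < μ t) : ceY m n μ P Q t (p + etaCol m μ P t) = Q p t := by
  unfold ceY
  rw [add_sub_cancel_right, colExt_nat hp]
lemma KR.to (hm : 0 < m) (hn : 0 < n) (hA : IsGAP m n A) (h : KR m n A s μ P Q) : KappaRel m n A s μ P Q := by
  obtain ⟨h7, h5, h6, S, h0, h1, h2⟩ := h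
  have g := gap_seq hm hn (h0 ▸ hA) (fun t ht _ => (h2 t ht).1)
  have hr : ∀ t, ∃ r : Int, t < s -> ∀ p : Nat, p < μ t -> 1 ≤ ceY m n μ P Q t (r + p) ∧ ceY m n μ P Q t (r + p) ≤ n := by
    intro t
    by_cases ht : t < s
    · obtain ⟨r, hr⟩ := ((h2 t ht).1.stry hn).norm (h2 t ht).1.lpos
      exact ⟨r, fun _ => hr⟩
    · exact ⟨0, fun h => absurd h ht⟩
  choose r hr using hr
  refine ⟨P, fun x t => ceY m n μ P Q t (r t + x), fun t => - r t, ⟨S, ⟨h0, fun t ht => ?_, h1, fun t ht => ?_⟩,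
    fun t ht => ?_⟩, fun t ht x hx => ⟨rfl, ?_⟩, h5, h6, h7⟩
  · exact ((h2 t ht).1.gap hm hn (g t ht.le)).2.2
  · exact ((h2 t ht).1.flat hm hn (g t ht.le)).1
  · obtain ⟨-, d, a1, a2, a3⟩ := (h2 t ht).1.flat hm hn (g t ht.le)
    refine ⟨d, _, a1, a2, a3, -1, r t - 1, fun p hp => ⟨?_, (h2 t ht).2 p hp⟩, fun p hp => ⟨?_, hr t ht p hp⟩, by ring⟩
    · simp only [neg_add_cancel, zero_add]
      exact (colExt_nat (c := fun x => P x t) hp).symm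
    · simp only [sub_add_cancel]
  · unfold tauPow
    rw [colExt_eq (h2 t ht).1.lpos ((h2 t ht).1.stry hn) (r := r t) (fun p hp => rfl), <- ceY_nat (m := m) (n := n) (P := P) (Q := Q) hx]
    congr 1; ring
lemma KR.target (hm : 0 < m) (hn : 0 < n) (hA : IsGAP m n A) (h : KR m n A s μ P Q) : InTargetRSK m n s μ P Q := by
  obtain ⟨h7, h5, h6, S, h0, h1, h2⟩ := h
  have g := gap_seq hm hn (h0 ▸ hA) (fun t ht _ => (h2 t ht).1)
  have an := anti_seq hm hn g (fun t ht => (h2 t ht).1)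
  refine ⟨⟨an, fun t ht => ⟨(h2 t ht).1.lpos, (h2 t ht).1.lle⟩, h7⟩, h5, h6, fun t ht x hx => ?_,
    fun t ht => (h2 t ht).2, fun t ht x hx => ?_, fun t ht => ?_, fun t ht e x hx => ?_⟩
  · have := ((h2 t ht).1.strx hm).lt x
    rw [show (x : Int) + 1 = (x + 1 : Nat) by push_cast; rfl] at this
    unfold ceX at this
    rwa [colExt_nat (by omega), colExt_nat hx] at this
  · have := ((h2 t ht).1.stry hn).lt (x + etaCol m μ P t)
    rwa [add_right_comm, show (x : Int) + 1 = (x + 1 : Nat) by push_cast; rfl, ceY_nat hx, ceY_nat (by omega)] at this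
  · have l0 := (h2 t ht).1.lpos
    have b1 := ((h2 t ht).1.stry hn).lt ((μ t - 1 : Nat) + etaCol m μ P t)
    have b2 := ((h2 t ht).1.stry hn).per 1 ((0 : Nat) + etaCol m μ P t)
    rw [ceY_nat (by omega)] at b1 b2
    rw [show ((μ t - 1 : Nat) : Int) + etaCol m μ P t + 1 = (0 : Nat) + etaCol m μ P t + 1 * μ t by omega] at b1
    omega
  · have ht' : t < s := by omega
    have b := (Th3 hm hn (g t (by omega)) (h2 t ht').1 (h2 _ ht).1).2 e.symm (rOff m μ P t)
      ((rOff_spec e (h2 t ht').1.lpos ((h2 t ht').1.strx hm) ((h2 _ ht).1.strx hm) (h2 t ht').2 (h2 _ ht).2 _).2 le_rfl)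
      (x + etaCol m μ P t)
    rw [ceY_nat hx, add_assoc, <- Nat.cast_add, <- eta_succ an ht e, ceY_nat (by omega)] at b
    exact b
lemma KR_uniq (hm : 0 < m) (hn : 0 < n) (hA : IsGAP m n A) (hA' : IsGAP m n B) (h : KR m n A s μ P Q)
    (h' : KR m n B s μ P Q) : A = B := by
  obtain ⟨-, -, -, S, h0, h1, h2⟩ := h
  obtain ⟨-, -, -, S', h0', h1', h2'⟩ := h'
  have g := gap_seq hm hn (h0 ▸ hA) (fun t ht _ => (h2 t ht).1)
  have g' := gap_seq hm hn (h0' ▸ hA') (fun t ht _ => (h2' t ht).1)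
  have : ∀ k ≤ s, S (s - k) = S' (s - k) := by
    intro k
    induction k with
    | zero => intro _; rw [Nat.sub_zero, h1, h1']
    | succ k ih =>
      intro hk
      have a := (h2 (s - (k + 1)) (by omega)).1
      have a' := (h2' (s - (k + 1)) (by omega)).1
      rw [show s - (k + 1) + 1 = s - k by omega] at a a'
      rw [<- ih (by omega)] at a'
      exact Th5 hm hn (g _ (by omega)) (g' _ (by omega)) a a'
  have := this s le_rfl
  rwa [Nat.sub_self, h0, h0'] at this
lemma gap_zero : IsGAP m n 0 := by
  constructor <;> simp
lemma KR_inv (hm : 0 < m) (hn : 0 < n) (h : InTargetRSK m n s μ P Q) : ∃ A, IsGAP m n A ∧ KR m n A s μ P Q := by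
  obtain ⟨⟨an, hμ, h7⟩, h5, h6, p1, p2, q1, q2, q3⟩ := h
  have sx : ∀ t < s, Str m (μ t) (ceX m μ P t) := fun t ht => colExt_str (hμ t ht).1 (p1 t ht) (by
    have := p2 t ht 0 (hμ t ht).1
    have := p2 t ht (μ t - 1) (by have := (hμ t ht).1; omega)
    omega)
  have sy : ∀ t < s, Str n (μ t) (ceY m n μ P Q t) := fun t ht =>
    (colExt_str (hμ t ht).1 (q1 t ht) (q2 t ht)).shift (- etaCol m μ P t)
  have dom : ∀ t, t + 1 < s -> μ (t + 1) = μ t -> ∀ K, (∀ i, ceX m μ P t i ≤ ceX m μ P (t + 1) (i + K)) ->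
      ∀ i, ceY m n μ P Q t i ≤ ceY m n μ P Q (t + 1) (i + K) := by
    intro t ht e K hK i
    have ht' : t < s := by omega
    have a := (rOff_spec e.symm (hμ t ht').1 (sx t ht') (sx _ ht) (p2 t ht') (p2 _ ht) K).1 hK
    have a1 := (sy _ ht).mono (show i + rOff m μ P t ≤ i + K by omega)
    have a2 : ceY m n μ P Q t i ≤ ceY m n μ P Q (t + 1) (i + rOff m μ P t) := by
      unfold ceY
      rw [eta_succ an ht e.symm, e]
      obtain ⟨p, b, hp, hz⟩ := exists_pq (hμ t ht').1 (i - etaCol m μ P t)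
      rw [hz, show i + (rOff m μ P t : Int) - (etaCol m μ P t + rOff m μ P t : Nat) = p + b * μ t by push_cast; linarith,
        colExt_per (hμ t ht').1, colExt_per (hμ t ht').1, colExt_nat hp, colExt_nat hp]
      have := q3 t ht e.symm p hp
      linarith
    omega
  have main : ∀ k ≤ s, ∃ S : Nat -> Mat, S s = 0 ∧ IsGAP m n (S (s - k)) ∧ ∀ t, s - k ≤ t -> t < s ->
      Step m n (S t) (S (t + 1)) (ceX m μ P t) (ceY m n μ P Q t) (μ t) := by
    intro k
    induction k with
    | zero => exact fun _ => ⟨fun _ => 0, rfl, gap_zero, fun t h1 h2 => by omega⟩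
    | succ k ih =>
      intro hk
      obtain ⟨S, a1, a2, a3⟩ := ih (by omega)
      obtain ⟨u, hu⟩ : ∃ u, u = s - (k + 1) := ⟨_, rfl⟩
      have hu1 : s - k = u + 1 := by omega
      rw [hu1] at a2 a3
      rw [<- hu]
      obtain ⟨A, b1, b2⟩ := Th4 hm hn (hμ u (by omega)).1 a2 (sx u (by omega)) (sy u (by omega)) (by
        rcases Nat.lt_or_ge (u + 1) s with h | h
        · exact Or.inr ⟨_, _, _, _, a3 _ le_rfl h, an u h, dom u h⟩
        · left; rwa [show u + 1 = s by omega])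
      refine ⟨Function.update S u A, ?_, by simpa using b1, fun t h1 h2 => ?_⟩
      · rw [Function.update_of_ne (by omega), a1]
      · rcases h1.eq_or_lt with rfl | h1
        · rw [Function.update_self, Function.update_of_ne (by omega)]; exact b2
        · rw [Function.update_of_ne (by omega), Function.update_of_ne (by omega)]; exact a3 t h1 h2
  obtain ⟨S, a1, a2, a3⟩ := main s le_rfl
  rw [Nat.sub_self] at a2 a3
  exact ⟨S 0, a2, h7, h5, h6, S, rfl, a1, fun t ht => ⟨a3 t (by omega) ht, p2 t ht⟩⟩
lemma chain_exists (hm : 0 < m) (hn : 0 < n) : ∀ (N : Nat) (A : Mat), IsGAP m n A -> Hsum n A ≤ N ->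
    ∃ (s : Nat) (S : Nat -> Mat) (X Y : Nat -> Int -> Int) (μ : Nat -> Nat), S 0 = A ∧ S s = 0 ∧ ∀ t < s,
      Step m n (S t) (S (t + 1)) (X t) (Y t) (μ t) ∧ ∀ p : Nat, p < μ t -> 1 ≤ X t p ∧ X t p ≤ m := by
  intro N
  induction N with
  | zero =>
    intro A hA h
    by_cases h0 : A = 0
    · exact ⟨0, fun _ => 0, 0, 0, 0, h0.symm, rfl, fun t ht => by omega⟩
    · obtain ⟨B, x, y, l, st⟩ := Th1 hm hn hA h0
      have := (st.gap hm hn hA).2.1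
      omega
  | succ N ih =>
    intro A hA h
    by_cases h0 : A = 0
    · exact ⟨0, fun _ => 0, 0, 0, 0, h0.symm, rfl, fun t ht => by omega⟩
    · obtain ⟨B, x, y, l, st⟩ := Th1 hm hn hA h0
      obtain ⟨a1, a2, -⟩ := st.gap hm hn hA
      obtain ⟨r, hr⟩ := (st.strx hm).norm st.lpos
      obtain ⟨s, S, X, Y, μ, b0, b1, b2⟩ := ih B a1 (by omega)
      refine ⟨s + 1, fun t => Nat.casesOn t A S, fun t => Nat.casesOn t (fun k => x (k + r)) X,
        fun t => Nat.casesOn t (fun k => y (k + r)) Y, fun t => Nat.casesOn t l μ, rfl, b1, fun t ht => ?_⟩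
      cases t with
      | zero =>
        refine ⟨?_, fun p hp => ?_⟩
        · show Step m n A (S 0) _ _ _
          rw [b0]; exact st.shift r
        · show 1 ≤ x (p + r) ∧ x (p + r) ≤ m
          rw [add_comm]; exact hr p hp
      | succ t => exact b2 t (by omega)
lemma KR_exists (hm : 0 < m) (hn : 0 < n) (hA : IsGAP m n A) : ∃ s μ P Q, KR m n A s μ P Q := by
  obtain ⟨s, S, X, Y, μ, b0, b1, b2⟩ := chain_exists hm hn _ A hA le_rfl
  obtain ⟨μ', hμ⟩ : ∃ μ' : Nat -> Nat, μ' = fun t => if t < s then μ t else 0 := ⟨_, rfl⟩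
  obtain ⟨P, hP⟩ : ∃ P : Nat -> Nat -> Int, P = fun x t => if t < s ∧ x < μ' t then X t x else 0 := ⟨_, rfl⟩
  obtain ⟨Q, hQ⟩ : ∃ Q : Nat -> Nat -> Int, Q = fun x t => if t < s ∧ x < μ' t then Y t (x + etaCol m μ' P t) else 0 :=
    ⟨_, rfl⟩
  refine ⟨s, μ', P, Q, fun t ht => ?_, fun x t ht => ?_, fun x t ht => ?_, S, b0, b1, fun t ht => ?_⟩
  · rw [hμ]; exact if_neg (by omega)
  · rw [hP]; exact if_neg (by omega)
  · rw [hQ]; exact if_neg (by omega)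
  obtain ⟨c1, c2⟩ := b2 t ht
  have e : μ' t = μ t := by rw [hμ]; exact if_pos ht
  rw [<- e] at c1 c2
  have eP : ∀ p < μ' t, P p t = X t p := fun p hp => by rw [hP]; exact if_pos ⟨ht, hp⟩
  have eQ : ∀ p < μ' t, Q p t = Y t (p + etaCol m μ' P t) := fun p hp => by rw [hQ]; exact if_pos ⟨ht, hp⟩
  have ex : ceX m μ' P t = X t := by
    funext z
    unfold ceX
    rw [colExt_eq c1.lpos (c1.strx hm) (r := 0) (fun p hp => by rw [zero_add]; exact eP p hp), zero_add]
  have ey : ceY m n μ' P Q t = Y t := by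
    funext z
    unfold ceY
    rw [colExt_eq c1.lpos (c1.stry hn) (r := etaCol m μ' P t) (fun p hp => by rw [add_comm]; exact eQ p hp)]
    congr 1; ring
  rw [ex, ey]
  exact ⟨c1, fun p hp => by rw [eP p hp]; exact c2 p hp⟩
lemma KR_det (hm : 0 < m) (hn : 0 < n) {s' : Nat} {μ' : Nat -> Nat} {Q' : Nat -> Nat -> Int} (hA : IsGAP m n A)
    (h : KR m n A s μ P Q) (h' : KR m n A s' μ' P' Q') : s = s' ∧ μ = μ' ∧ P = P' ∧ Q = Q' := by
  obtain ⟨h7, h5, h6, S, h0, h1, h2⟩ := h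
  obtain ⟨h7', h5', h6', S', h0', h1', h2'⟩ := h'
  have g := gap_seq hm hn (h0 ▸ hA) (fun t ht _ => (h2 t ht).1)
  have g' := gap_seq hm hn (h0' ▸ hA) (fun t ht _ => (h2' t ht).1)
  have eS : ∀ t, t ≤ s -> t ≤ s' -> S t = S' t := by
    intro t
    induction t with
    | zero => intro _ _; rw [h0, h0']
    | succ t ih =>
      intro a b
      have c := (h2' t b).1
      rw [<- ih (by omega) (by omega)] at c
      exact (Th2 hm hn (h2 t a).1 c).1
  obtain rfl : s = s' := by
    rcases lt_trichotomy s s' with h | h | h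
    · exact absurd ((eS s le_rfl h.le).symm.trans h1) ((h2' s h).1.gap hm hn (g' s h.le)).2.2
    · exact h
    · exact absurd ((eS s' h.le le_rfl).trans h1') ((h2 s' h).1.gap hm hn (g s' h.le)).2.2
  have th : ∀ t < s, μ t = μ' t ∧ ceX m μ' P' t = ceX m μ P t ∧ ceY m n μ' P' Q' t = ceY m n μ P Q t := by
    intro t ht
    have c := (h2' t ht).1
    rw [<- eS t ht.le ht.le] at c
    obtain ⟨-, e, K, hx, hy⟩ := Th2 hm hn (h2 t ht).1 c
    have l0 := c.lpos
    have z1 : ceX m μ P t 0 = P 0 t := colExt_nat (p := 0) (by omega)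
    have z1' : ceX m μ' P' t 0 = P' 0 t := colExt_nat (p := 0) (by omega)
    have z2 : ceX m μ P t ((μ t - 1 : Nat) : Int) = P (μ t - 1) t := colExt_nat (by omega)
    have z2' : ceX m μ' P' t ((μ t - 1 : Nat) : Int) = P' (μ t - 1) t := colExt_nat (by omega)
    have w1 := (h2 t ht).2 0 (by omega)
    have w1' := (h2' t ht).2 0 (by omega)
    have w2 := (h2 t ht).2 (μ t - 1) (by omega)
    have w2' := (h2' t ht).2 (μ t - 1) (by omega)
    have sx := (h2 t ht).1.strx hm
    have sx' := (h2' t ht).1.strx hm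
    have v := sx.per (-1) ((μ t - 1 : Nat) : Int)
    have v' := sx'.per (-1) ((μ t - 1 : Nat) : Int)
    have u := hx 0
    have u' := hx (-K)
    rw [neg_add_cancel] at u'
    obtain rfl : K = 0 := by
      rcases lt_trichotomy K 0 with h | h | h
      · have := sx.mono (show 0 + K ≤ ((μ t - 1 : Nat) : Int) + -1 * μ t by omega)
        omega
      · exact h
      · have := sx'.mono (show -K ≤ ((μ t - 1 : Nat) : Int) + -1 * μ' t by omega)
        omega
    exact ⟨e, funext fun k => by rw [hx, add_zero], funext fun k => by rw [hy, add_zero]⟩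
  obtain rfl : μ = μ' := by
    funext t
    by_cases ht : t < s
    · exact (th t ht).1
    · rw [h7 t (by omega), h7' t (by omega)]
  obtain rfl : P = P' := by
    funext x t
    by_cases ht : t < s ∧ x < μ t
    · have := congrFun (th t ht.1).2.1 x
      unfold ceX at this
      rw [colExt_nat ht.2, colExt_nat ht.2] at this
      exact this.symm
    · rw [h5 x t (by omega), h5' x t (by omega)]
  refine ⟨rfl, rfl, rfl, ?_⟩
  funext x t
  by_cases ht : t < s ∧ x < μ t
  · have := congrFun (th t ht.1).2.2 (x + etaCol m μ P t)
    rw [ceY_nat ht.2, ceY_nat ht.2] at this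
    exact this.symm
  · rw [h6 x t (by omega), h6' x t (by omega)]
end
end

/-- **Affine RSK correspondence.**
For all positive integers `m`, `n`, the map `κ : A ↦ (P₀, Q)` is a bijection
from `M̂_{m×n}` onto `⨆_{λ ∈ 𝒫_m ∩ 𝒫_n} CSST_[m](λ) × B_n(λ)`: every
`A ∈ M̂_{m×n}` has a unique image `(s, μ, P, Q)` (in particular `P = P₀` is
column semistandard with entries in `{1, …, m}`, the common shape lies in
`𝒫_m ∩ 𝒫_n`, and `Q ∈ B_n(λ)`), and every element of the target has a unique
preimage. -/
theorem affine_RSK_correspondence (m n : ℕ) (hm : 0 < m) (hn : 0 < n) :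
    (∀ A : Mat, IsGAP m n A →
      ∃! PQ : ℕ × (ℕ → ℕ) × (ℕ → ℕ → ℤ) × (ℕ → ℕ → ℤ),
        KappaRel m n A PQ.1 PQ.2.1 PQ.2.2.1 PQ.2.2.2 ∧
          InTargetRSK m n PQ.1 PQ.2.1 PQ.2.2.1 PQ.2.2.2) ∧
    ∀ (s : ℕ) (μ : ℕ → ℕ) (P Q : ℕ → ℕ → ℤ), InTargetRSK m n s μ P Q →
      ∃! A : Mat, IsGAP m n A ∧ KappaRel m n A s μ P Q := by
  constructor
  · intro A hA
    obtain ⟨s, μ, P, Q, h⟩ := KR_exists hm hn hA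
    refine ⟨(s, μ, P, Q), ⟨h.to hm hn hA, h.target hm hn hA⟩, ?_⟩
    rintro ⟨s', μ', P', Q'⟩ ⟨h', -⟩
    obtain ⟨rfl, rfl, rfl, rfl⟩ := KR_det hm hn hA h (KR_of hm hn hA h')
    rfl
  · intro s μ P Q h
    obtain ⟨A, hA, h'⟩ := KR_inv hm hn h
    exact ⟨A, ⟨hA, h'.to hm hn hA⟩, fun B ⟨hB, hk⟩ => KR_uniq hm hn hB hA (KR_of hm hn hB hk) h'⟩

end AffineRSK
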